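/- For every integer n ≥ 1: C(1,8;4n) = C(3,8;4n) = N(2,8;4n) = N(4,8;4n). -/

import Mathlib

/-- The rank of a partition: its largest part minus its number of parts. -/
def partitionRank {n : ℕ} (π : n.Partition) : ℤ :=
  (π.parts.sup : ℤ) - π.parts.card

/-- The crank of a partition: the largest part if there are no parts equal to 1,
otherwise the number of parts larger than the number of ones minus the number of ones. -/
def partitionCrank {n : ℕ} (π : n.Partition) : ℤ :=
  if π.parts.count 1 = 0 then (π.parts.sup : ℤ)
  else ((π.parts.filter (fun x => π.parts.count 1 < x)).card : ℤ) - π.parts.count 1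

/-- `N(a,M;n)`: the number of partitions of `n` whose rank is congruent to `a` modulo `M`. -/
def rankCount (a : ℤ) (M : ℕ) (n : ℕ) : ℕ :=
  (Finset.univ.filter (fun π : n.Partition => partitionRank π % M = a % M)).card

/-- `C(a,M;n)`: the number of partitions of `n` whose crank is congruent to `a` modulo `M`. -/
def crankCount (a : ℤ) (M : ℕ) (n : ℕ) : ℕ :=
  (Finset.univ.filter (fun π : n.Partition => partitionCrank π % M = a % M)).card


open Filter Topology

/-! ### Infinite products -/

/-- The infinite `q`-shifted factorial. -/
noncomputable def qp (x q : ℂ) : ℂ := ∏' n : ℕ, (1 - x * q ^ n)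

lemma qp_summable (x : ℂ) {q : ℂ} (hq : ‖q‖ < 1) : Summable (fun n : ℕ => ‖-(x * q ^ n)‖) := by
  simp only [norm_neg, norm_mul, norm_pow]
  exact (summable_geometric_of_lt_one (norm_nonneg _) hq).mul_left _

lemma qp_multipliable (x : ℂ) {q : ℂ} (hq : ‖q‖ < 1) :
    Multipliable (fun n : ℕ => (1 - x * q ^ n)) := by
  simpa [sub_eq_add_neg] using multipliable_one_add_of_summable (qp_summable x hq)

lemma qp_tendsto (x : ℂ) {q : ℂ} (hq : ‖q‖ < 1) :
    Tendsto (fun N => ∏ n ∈ Finset.range N, (1 - x * q ^ n)) atTop (𝓝 (qp x q)) :=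
  (qp_multipliable x hq).tendsto_prod_tprod_nat

lemma qp_ne_zero {x q : ℂ} (hq : ‖q‖ < 1) (h : ∀ n : ℕ, x * q ^ n ≠ 1) : qp x q ≠ 0 := by
  have := tprod_one_add_ne_zero_of_summable (f := fun n : ℕ => -(x * q ^ n)) (fun n hn => h n
    (by linear_combination -hn)) (qp_summable x hq)
  simpa [qp, sub_eq_add_neg] using this

lemma qp_ne_zero_of_lt {x q : ℂ} (hq : ‖q‖ < 1) (hx : ‖x‖ < 1) : qp x q ≠ 0 := by
  apply qp_ne_zero hq
  intro n hn
  have h1 : ‖x * q ^ n‖ < 1 := by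
    rw [norm_mul, norm_pow]
    calc ‖x‖ * ‖q‖ ^ n ≤ ‖x‖ * 1 := by
          gcongr
          exact pow_le_one₀ (norm_nonneg _) hq.le
      _ < 1 := by simpa using hx
  rw [hn] at h1
  simp at h1

lemma qp_succ (x : ℂ) {q : ℂ} (hq : ‖q‖ < 1) : qp x q = (1 - x) * qp (x * q) q := by
  have h1 := (qp_tendsto x hq).comp (tendsto_add_atTop_nat 1)
  have h2 := (qp_tendsto (x * q) hq).const_mul (1 - x)
  refine tendsto_nhds_unique h1 (h2.congr fun N => ?_)
  simp only [Function.comp]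
  rw [Finset.prod_range_succ', mul_comm]
  simp only [pow_zero, mul_one]
  congr 1
  apply Finset.prod_congr rfl
  intro n _
  ring

lemma norm_sq_lt {q : ℂ} (hq : ‖q‖ < 1) : ‖q ^ 2‖ < 1 := by
  rw [norm_pow]
  exact pow_lt_one₀ (norm_nonneg _) hq (by norm_num)

lemma qp_even_odd (x : ℂ) {q : ℂ} (hq : ‖q‖ < 1) :
    qp x q = qp x (q ^ 2) * qp (x * q) (q ^ 2) := by
  have h1 := qp_multipliable x (norm_sq_lt hq)
  have h2 := qp_multipliable (x * q) (norm_sq_lt hq)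
  have := tprod_even_mul_odd (f := fun n : ℕ => (1 - x * q ^ n))
    (h1.congr fun n => by rw [pow_mul]) (h2.congr fun n => by rw [pow_add, pow_mul]; ring)
  unfold qp
  rw [← this]
  congr 1
  · congr 1; ext n; rw [pow_mul]
  · congr 1; ext n; rw [pow_add, pow_mul]; ring

lemma qp_sq (x : ℂ) {q : ℂ} (hq : ‖q‖ < 1) :
    qp x q * qp (-x) q = qp (x ^ 2) (q ^ 2) := by
  unfold qp
  rw [← (qp_multipliable x hq).tprod_mul (qp_multipliable (-x) hq)]
  congr 1; ext n
  ring

/-! ### Finite reciprocals -/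

/-- `1/(q)_m`, extended by zero to negative `m`. -/
noncomputable def iq (q : ℂ) (m : ℤ) : ℂ :=
  if m < 0 then 0 else (∏ j ∈ Finset.range m.toNat, (1 - q * q ^ j))⁻¹

lemma pow_ne_one {q : ℂ} (hq : ‖q‖ < 1) (n : ℕ) : q * q ^ n ≠ 1 := by
  intro h
  have h1 : ‖q ^ (n + 1)‖ < 1 := by
    rw [norm_pow]; exact pow_lt_one₀ (norm_nonneg _) hq (by omega)
  rw [pow_succ', h] at h1
  simp at h1

lemma iq_rec {q : ℂ} (hq : ‖q‖ < 1) (m : ℤ) : (1 - q ^ m) * iq q m = iq q (m - 1) := by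
  rcases lt_trichotomy m 0 with h | h | h
  · simp [iq, h, show m - 1 < 0 by omega, show m < 1 by omega]
  · subst h; simp [iq]
  · obtain ⟨n, rfl⟩ : ∃ n : ℕ, m = n + 1 := ⟨(m - 1).toNat, by omega⟩
    have e1 : ((n : ℤ) + 1).toNat = n + 1 := by omega
    have e2 : ((n : ℤ) + 1 - 1).toNat = n := by omega
    simp only [iq, if_neg (show ¬ ((n : ℤ) + 1 < 0) by omega),
      if_neg (show ¬ ((n : ℤ) + 1 - 1 < 0) by omega), e1, e2]
    rw [Finset.prod_range_succ, mul_inv]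
    have h1 : (1 - q * q ^ n) ≠ 0 := sub_ne_zero.2 (pow_ne_one hq n).symm
    have h2 : q ^ ((n : ℤ) + 1) = q * q ^ n := by
      rw [← pow_succ']; exact_mod_cast zpow_natCast q (n + 1)
    rw [h2]
    field_simp

lemma iq_tendsto_nat {q : ℂ} (hq : ‖q‖ < 1) :
    Tendsto (fun n : ℕ => iq q n) atTop (𝓝 (qp q q)⁻¹) := by
  have := (qp_tendsto q hq).inv₀ (qp_ne_zero_of_lt hq hq)
  refine this.congr fun n => ?_
  simp [iq]

lemma iq_tendsto {q : ℂ} (hq : ‖q‖ < 1) (k : ℤ) :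
    Tendsto (fun n : ℕ => iq q (n + k)) atTop (𝓝 (qp q q)⁻¹) := by
  have h1 : Tendsto (fun n : ℕ => ((n : ℤ) + k).toNat) atTop atTop := by
    rw [tendsto_atTop]
    intro b
    filter_upwards [eventually_ge_atTop (b + k.natAbs)] with n hn
    omega
  refine ((iq_tendsto_nat hq).comp h1).congr' ?_
  filter_upwards [eventually_ge_atTop k.natAbs] with n hn
  simp only [Function.comp]
  congr 1
  omega

lemma iq_bound {q : ℂ} (hq : ‖q‖ < 1) : ∃ C : ℝ, 0 ≤ C ∧ ∀ m, ‖iq q m‖ ≤ C := by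
  obtain ⟨C, hC⟩ := (Metric.isBounded_range_of_tendsto _ (iq_tendsto_nat hq)).exists_norm_le
  have h0 : 0 ≤ C := (norm_nonneg _).trans (hC (iq q (0 : ℕ)) ⟨0, rfl⟩)
  refine ⟨C, h0, fun m => ?_⟩
  by_cases h : m < 0
  · simpa [iq, h] using h0
  · have := hC (iq q (m.toNat : ℕ)) ⟨m.toNat, rfl⟩
    rwa [Int.toNat_of_nonneg (by omega)] at this

/-! ### Gaussian summability -/

/-- Triangular numbers. -/
def tri (k : ℤ) : ℤ := k * (k + 1) / 2

lemma two_tri (k : ℤ) : 2 * tri k = k * (k + 1) := by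
  unfold tri
  exact Int.mul_ediv_cancel' (Int.even_mul_succ_self k).two_dvd

lemma summable_zpow_abs {r : ℝ} (h0 : 0 < r) (h1 : r < 1) : Summable (fun k : ℤ => r ^ |k|) := by
  rw [summable_int_iff_summable_nat_and_neg]
  constructor <;> simpa using summable_geometric_of_lt_one h0.le h1

/-- A general criterion: quadratic growth of exponents. -/
lemma summable_of_growth {r : ℝ} (h0 : 0 < r) (h1 : r < 1) (e : ℤ → ℤ) (c : ℤ)
    (he : ∀ k, |k| - c ≤ e k) : Summable (fun k : ℤ => r ^ e k) := by
  refine Summable.of_nonneg_of_le (fun k => by positivity) (fun k => ?_)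
    ((summable_zpow_abs h0 h1).mul_right (r ^ (-c)))
  rw [← zpow_add₀ h0.ne']
  exact zpow_le_zpow_right_of_le_one₀ h0 h1.le (by have := he k; omega)

lemma tri_growth (a k : ℤ) : |k| - (a ^ 2 + 2 * |a| + 3) ≤ tri k + a * k := by
  have h := two_tri k
  have h1 : |k| * |k| = k * k := abs_mul_abs_self k
  have h2 : |a| * |a| = a * a := abs_mul_abs_self a
  have h3 : -(|a| * |k|) ≤ a * k := by rw [← abs_mul]; exact neg_abs_le _
  have h4 : - |k| ≤ k := neg_abs_le k
  have h5 := abs_nonneg k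
  have h6 := abs_nonneg a
  nlinarith [sq_nonneg (|k| - |a| - 2), sq_nonneg (|k| - 2 * |a| - 3), sq_nonneg (|a| - |k|)]

lemma summable_tri {q : ℂ} (hq0 : q ≠ 0) (hq : ‖q‖ < 1) (a : ℤ) :
    Summable (fun k : ℤ => ‖q‖ ^ (tri k + a * k)) :=
  summable_of_growth (norm_pos_iff.2 hq0) hq _ _ (tri_growth a)

lemma zpow_gen_le {r : ℝ} (h0 : 0 < r) (h1 : r < 1) {x : ℝ} (hx : 0 < x) :
    ∃ a : ℤ, 0 ≤ a ∧ ∀ k : ℤ, x ^ k ≤ r ^ (a * k) + r ^ (-a * k) := by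
  obtain ⟨n, hn⟩ := exists_pow_lt_of_lt_one (show 0 < min x x⁻¹ by positivity) h1
  refine ⟨n, by positivity, fun k => ?_⟩
  have hx1 : r ^ (n : ℤ) ≤ x := by
    rw [zpow_natCast]; exact hn.le.trans (min_le_left _ _)
  have hx2 : x ≤ r ^ (-(n : ℤ)) := by
    rw [zpow_neg, zpow_natCast]
    rw [le_inv_comm₀ hx (by positivity)]
    exact hn.le.trans (min_le_right _ _)
  rcases le_total 0 k with hk | hk
  · calc x ^ k ≤ (r ^ (-(n : ℤ))) ^ k := zpow_le_zpow_left₀ hk hx.le hx2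
      _ = r ^ (-(n : ℤ) * k) := by rw [← zpow_mul]
      _ ≤ _ := by have : 0 < r ^ ((n : ℤ) * k) := by positivity
                  linarith
  · calc x ^ k = (x ^ (-k))⁻¹ := by rw [zpow_neg, inv_inv]
      _ ≤ ((r ^ (n : ℤ)) ^ (-k))⁻¹ := by
          have h3 : 0 ≤ -k := by omega
          exact inv_anti₀ (by positivity) (zpow_le_zpow_left₀ h3 (by positivity) hx1)
      _ = r ^ ((n : ℤ) * k) := by rw [← zpow_mul, ← zpow_neg]; congr 1; ring
      _ ≤ _ := by have : 0 < r ^ (-(n : ℤ) * k) := by positivity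
                  linarith

lemma summable_tri_z {q : ℂ} (hq0 : q ≠ 0) (hq : ‖q‖ < 1) {z : ℂ} (hz : z ≠ 0) :
    Summable (fun k : ℤ => ‖q‖ ^ (tri k) * ‖z‖ ^ k) := by
  have hr := norm_pos_iff.2 hq0
  obtain ⟨a, -, ha⟩ := zpow_gen_le hr hq (norm_pos_iff.2 hz)
  refine Summable.of_nonneg_of_le (fun k => by positivity) (fun k => ?_)
    ((summable_tri hq0 hq a).add (summable_tri hq0 hq (-a)))
  rw [zpow_add₀ hr.ne', zpow_add₀ hr.ne', ← mul_add]
  gcongr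
  exact ha k

/-- bounded denominators -/
lemma inv_bound {q : ℂ} (hq0 : q ≠ 0) (hq : ‖q‖ < 1) (x : ℂ) (hx : x ≠ 0)
    (h : ∀ k : ℤ, x * q ^ k ≠ 1) : ∃ C : ℝ, 0 ≤ C ∧ ∀ k : ℤ, ‖(1 - x * q ^ k)⁻¹‖ ≤ C := by
  have t0 : Tendsto (fun n : ℕ => q ^ n) atTop (𝓝 0) := tendsto_pow_atTop_nhds_zero_of_norm_lt_one hq
  have t1 : Tendsto (fun n : ℕ => (1 - x * q ^ (n : ℤ))⁻¹) atTop (𝓝 1) := by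
    have : Tendsto (fun n : ℕ => (1 - x * q ^ n)⁻¹) atTop (𝓝 (1 - x * 0)⁻¹) :=
      ((t0.const_mul x).const_sub 1).inv₀ (by simp)
    simpa using this
  have t2 : Tendsto (fun n : ℕ => (1 - x * q ^ (-(n : ℤ)))⁻¹) atTop (𝓝 0) := by
    have : Tendsto (fun n : ℕ => q ^ n * (q ^ n - x)⁻¹) atTop (𝓝 (0 * (0 - x)⁻¹)) :=
      t0.mul ((t0.sub_const x).inv₀ (by simpa using hx))
    rw [zero_mul] at this
    refine this.congr fun n => ?_
    have hn : q ^ n ≠ 0 := pow_ne_zero _ hq0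
    have h1 : (1 - x * q ^ (-(n : ℤ))) ≠ 0 := sub_ne_zero.2 (h _).symm
    rw [zpow_neg, zpow_natCast] at h1 ⊢
    have h2 : q ^ n - x ≠ 0 := by
      intro h3; apply h1; field_simp; rw [sub_eq_zero] at h3; simp [h3]
    field_simp
  obtain ⟨C1, hC1⟩ := (Metric.isBounded_range_of_tendsto _ t1).exists_norm_le
  obtain ⟨C2, hC2⟩ := (Metric.isBounded_range_of_tendsto _ t2).exists_norm_le
  refine ⟨max C1 C2, ?_, fun k => ?_⟩
  · exact (norm_nonneg _).trans ((hC1 _ ⟨0, rfl⟩).trans (le_max_left _ _))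
  · obtain ⟨n, rfl | rfl⟩ := k.eq_nat_or_neg
    · exact (hC1 _ ⟨n, rfl⟩).trans (le_max_left _ _)
    · exact (hC2 _ ⟨n, rfl⟩).trans (le_max_right _ _)

/-! ### Jacobi triple product and the reciprocal theta partial fractions -/

/-- signed Gaussian weight -/
noncomputable def al (q : ℂ) (k : ℤ) : ℂ := (-1) ^ k * q ^ tri k

lemma norm_neg_one_zpow (k : ℤ) : ‖((-1 : ℂ)) ^ k‖ = 1 := by
  rw [norm_zpow]; simp

lemma norm_al (q : ℂ) (k : ℤ) : ‖al q k‖ = ‖q‖ ^ tri k := by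
  rw [al, norm_mul, norm_neg_one_zpow, one_mul, norm_zpow]

lemma tri_add_one (k : ℤ) : tri (k + 1) = tri k + (k + 1) := by
  have h1 := two_tri k
  have h2 := two_tri (k + 1)
  nlinarith

lemma al_succ {q : ℂ} (hq0 : q ≠ 0) (k : ℤ) : al q (k + 1) = - (q ^ (k + 1) * al q k) := by
  rw [al, al, tri_add_one, zpow_add₀ hq0, zpow_add_one₀ (by norm_num : (-1 : ℂ) ≠ 0)]
  ring

lemma al_pred {q : ℂ} (hq0 : q ≠ 0) (k : ℤ) : al q (k - 1) = - (q ^ (-k) * al q k) := by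
  have := al_succ hq0 (k - 1)
  rw [sub_add_cancel] at this
  rw [this, zpow_neg]
  field_simp

lemma al_ne_zero {q : ℂ} (hq0 : q ≠ 0) (k : ℤ) : al q k ≠ 0 :=
  mul_ne_zero (zpow_ne_zero _ (by norm_num)) (zpow_ne_zero _ hq0)

lemma summable_al_norm {q : ℂ} (hq0 : q ≠ 0) (hq : ‖q‖ < 1) {z : ℂ} (hz : z ≠ 0) (f : ℤ → ℂ)
    {C : ℝ} (hf : ∀ k, ‖f k‖ ≤ C) : Summable (fun k : ℤ => ‖al q k * z ^ k * f k‖) := by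
  refine Summable.of_nonneg_of_le (fun k => norm_nonneg _) (fun k => ?_)
    ((summable_tri_z hq0 hq hz).mul_right C)
  rw [norm_mul, norm_mul, norm_al, norm_zpow]
  exact mul_le_mul_of_nonneg_left (hf k) (by positivity)

lemma summable_al {q : ℂ} (hq0 : q ≠ 0) (hq : ‖q‖ < 1) {z : ℂ} (hz : z ≠ 0) (f : ℤ → ℂ)
    {C : ℝ} (hf : ∀ k, ‖f k‖ ≤ C) : Summable (fun k : ℤ => al q k * z ^ k * f k) :=
  (summable_al_norm hq0 hq hz f hf).of_norm

lemma tsum_shift (f : ℤ → ℂ) (c : ℤ) : ∑' k : ℤ, f (k + c) = ∑' k : ℤ, f k :=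
  (Equiv.addRight c).tsum_eq f

lemma tsum_neg_int (f : ℤ → ℂ) : ∑' k : ℤ, f (-k) = ∑' k : ℤ, f k :=
  (Equiv.neg ℤ).tsum_eq f

lemma iqiq_bound {q : ℂ} (hq : ‖q‖ < 1) :
    ∃ C : ℝ, 0 ≤ C ∧ ∀ m n, ‖iq q m * iq q n‖ ≤ C := by
  obtain ⟨C, h0, hC⟩ := iq_bound hq
  refine ⟨C * C, by positivity, fun m n => ?_⟩
  rw [norm_mul]
  exact mul_le_mul (hC _) (hC _) (norm_nonneg _) h0

/-- finite form of the triple product sum -/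
noncomputable def Jn (q z : ℂ) (n : ℕ) : ℂ :=
  ∑' k : ℤ, al q k * z ^ k * (iq q (n - k) * iq q (n + k))

lemma al_zero (q : ℂ) : al q 0 = 1 := by simp [al, tri]

lemma iq_zero (q : ℂ) : iq q 0 = 1 := by simp [iq]

lemma iq_neg (q : ℂ) {m : ℤ} (h : m < 0) : iq q m = 0 := by simp [iq, h]

lemma Jn_zero (q z : ℂ) : Jn q z 0 = 1 := by
  rw [Jn, tsum_eq_single 0]
  · simp [al_zero, iq_zero]
  · intro k hk
    rcases lt_or_gt_of_ne hk with h | h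
    · simp [iq_neg q h]
    · rw [iq_neg q (show ((0 : ℕ) : ℤ) - k < 0 by push_cast; omega)]; simp

lemma Jn_summable {q : ℂ} (hq0 : q ≠ 0) (hq : ‖q‖ < 1) {z : ℂ} (hz : z ≠ 0) (m n : ℤ) :
    Summable (fun k : ℤ => al q k * z ^ k * (iq q (m - k) * iq q (n + k))) := by
  obtain ⟨C, -, hC⟩ := iqiq_bound hq
  exact summable_al hq0 hq hz _ (fun k => hC _ _)

lemma Jn_rec {q : ℂ} (hq0 : q ≠ 0) (hq : ‖q‖ < 1) {z : ℂ} (hz : z ≠ 0) (n : ℕ) :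
    (1 - q * q ^ (2 * n + 1)) * (1 - q * q ^ (2 * n)) * Jn q z (n + 1) =
      (1 - z * q * q ^ n) * (1 - z⁻¹ * q ^ n) * Jn q z n := by
  have e1 : z * Jn q z n = ∑' k : ℤ, -(q ^ (-k) * al q k * z ^ k *
      (iq q (n + 1 - k) * iq q (n + k - 1))) := by
    rw [Jn, ← tsum_mul_left, ← tsum_shift _ (-1)]
    congr 1; ext k
    rw [← sub_eq_add_neg, al_pred hq0, zpow_sub_one₀ hz, show (n : ℤ) - (k - 1) = n + 1 - k by ring,
      show (n : ℤ) + (k - 1) = n + k - 1 by ring]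
    field_simp
  have e2 : z⁻¹ * Jn q z n = ∑' k : ℤ, -(q ^ (k + 1) * al q k * z ^ k *
      (iq q (n - k - 1) * iq q (n + 1 + k))) := by
    rw [Jn, ← tsum_mul_left, ← tsum_shift _ 1]
    congr 1; ext k
    rw [al_succ hq0, zpow_add_one₀ hz, show (n : ℤ) - (k + 1) = n - k - 1 by ring,
      show (n : ℤ) + (k + 1) = n + 1 + k by ring]
    field_simp
  have s0 := Jn_summable hq0 hq hz n n
  have s1 : Summable (fun k : ℤ => -(q ^ (-k) * al q k * z ^ k *
      (iq q (n + 1 - k) * iq q (n + k - 1)))) := by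
    refine (((Jn_summable hq0 hq hz n n).comp_injective
      (Equiv.addRight (-1 : ℤ)).injective).mul_left z).congr fun k => ?_
    simp only [Function.comp, Equiv.coe_addRight]
    rw [← sub_eq_add_neg, al_pred hq0, zpow_sub_one₀ hz, show (n : ℤ) - (k - 1) = n + 1 - k by ring,
      show (n : ℤ) + (k - 1) = n + k - 1 by ring]
    field_simp
  have s2 : Summable (fun k : ℤ => -(q ^ (k + 1) * al q k * z ^ k *
      (iq q (n - k - 1) * iq q (n + 1 + k)))) := by
    refine (((Jn_summable hq0 hq hz n n).comp_injective
      (Equiv.addRight (1 : ℤ)).injective).mul_left z⁻¹).congr fun k => ?_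
    simp only [Function.comp, Equiv.coe_addRight]
    rw [al_succ hq0, zpow_add_one₀ hz, show (n : ℤ) - (k + 1) = n - k - 1 by ring,
      show (n : ℤ) + (k + 1) = n + 1 + k by ring]
    field_simp
  have e3 : (1 - z * q * q ^ n) * (1 - z⁻¹ * q ^ n) * Jn q z n =
      (1 + q * q ^ n * q ^ n) * Jn q z n - q * q ^ n * (z * Jn q z n) - q ^ n * (z⁻¹ * Jn q z n) := by
    field_simp
    ring
  rw [e3, e1, e2, Jn, Jn, ← tsum_mul_left, ← tsum_mul_left, ← tsum_mul_left, ← tsum_mul_left,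
    ← Summable.tsum_sub (s0.mul_left _) (s1.mul_left _),
    ← Summable.tsum_sub ((s0.mul_left _).sub (s1.mul_left _)) (s2.mul_left _)]
  congr 1; ext k
  have r1 := iq_rec hq ((n : ℤ) + 1 - k)
  have r2 := iq_rec hq ((n : ℤ) + 1 + k)
  have r3 := iq_rec hq ((n : ℤ) - k)
  have r4 := iq_rec hq ((n : ℤ) + k)
  rw [show (n : ℤ) + 1 - k - 1 = n - k by ring] at r1
  rw [show (n : ℤ) + 1 + k - 1 = n + k by ring] at r2
  rw [← r3, ← r4, ← r1, ← r2]
  push_cast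
  have hqk : q ^ k ≠ 0 := zpow_ne_zero _ hq0
  have hqn : q ^ n ≠ 0 := pow_ne_zero _ hq0
  simp only [zpow_add₀ hq0, zpow_sub₀ hq0, zpow_neg, zpow_natCast, zpow_one, pow_add, pow_mul,
    pow_one]
  field_simp
  ring

lemma Jn_vanish_one {q : ℂ} (hq0 : q ≠ 0) (hq : ‖q‖ < 1) {z : ℂ} (hz : z ≠ 0)
    (h : (1 - z * q) * (1 - z⁻¹) = 0) (n : ℕ) : Jn q z (n + 1) = 0 := by
  have hne : ∀ n, (1 - q * q ^ (2 * n + 1)) * (1 - q * q ^ (2 * n)) ≠ 0 := fun n =>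
    mul_ne_zero (sub_ne_zero.2 (pow_ne_one hq _).symm) (sub_ne_zero.2 (pow_ne_one hq _).symm)
  induction n with
  | zero =>
    have := Jn_rec hq0 hq hz 0
    rw [Jn_zero] at this
    simp only [pow_zero, mul_one] at this
    rw [h] at this
    exact (mul_eq_zero.1 this).resolve_left (by simpa using hne 0)
  | succ n ih =>
    have := Jn_rec hq0 hq hz (n + 1)
    rw [ih, mul_zero] at this
    exact (mul_eq_zero.1 this).resolve_left (hne _)

lemma Jn_prod {q : ℂ} (hq0 : q ≠ 0) (hq : ‖q‖ < 1) {z : ℂ} (hz : z ≠ 0) (n : ℕ) :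
    (∏ j ∈ Finset.range (2 * n), (1 - q * q ^ j)) * Jn q z n =
      (∏ j ∈ Finset.range n, (1 - z * q * q ^ j)) * (∏ j ∈ Finset.range n, (1 - z⁻¹ * q ^ j)) := by
  induction n with
  | zero => simp [Jn_zero]
  | succ n ih =>
    rw [show 2 * (n + 1) = 2 * n + 1 + 1 by ring, Finset.prod_range_succ, Finset.prod_range_succ,
      Finset.prod_range_succ (fun j => (1 - z * q * q ^ j)), Finset.prod_range_succ _ n]
    have := Jn_rec hq0 hq hz n
    linear_combination (∏ j ∈ Finset.range (2 * n), (1 - q * q ^ j)) * this +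
      (1 - z * q * q ^ n) * (1 - z⁻¹ * q ^ n) * ih

lemma iqiq_tendsto {q : ℂ} (hq : ‖q‖ < 1) (k : ℤ) :
    Tendsto (fun n : ℕ => iq q (n - k) * iq q (n + k)) atTop (𝓝 ((qp q q)⁻¹ * (qp q q)⁻¹)) := by
  refine Tendsto.mul ?_ (iq_tendsto hq k)
  simpa [sub_eq_add_neg] using iq_tendsto hq (-k)

lemma Ln_tendsto {q : ℂ} (hq0 : q ≠ 0) (hq : ‖q‖ < 1) {z : ℂ} (hz : z ≠ 0) (f : ℤ → ℂ)
    {C : ℝ} (hf : ∀ k, ‖f k‖ ≤ C) :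
    Tendsto (fun n : ℕ => ∑' k : ℤ, al q k * z ^ k * (iq q (n - k) * iq q (n + k)) * f k) atTop
      (𝓝 (((qp q q)⁻¹ * (qp q q)⁻¹) * ∑' k : ℤ, al q k * z ^ k * f k)) := by
  obtain ⟨D, hD0, hD⟩ := iqiq_bound hq
  have h0 : 0 ≤ C := (norm_nonneg _).trans (hf 0)
  rw [← tsum_mul_left]
  refine tendsto_tsum_of_dominated_convergence
    (bound := fun k => ‖q‖ ^ tri k * ‖z‖ ^ k * (D * C)) ?_ ?_ ?_
  · exact (summable_tri_z hq0 hq hz).mul_right _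
  · intro k
    have := ((iqiq_tendsto hq k).const_mul (al q k * z ^ k)).mul_const (f k)
    convert this using 2
    ring
  · refine Eventually.of_forall fun n k => ?_
    rw [norm_mul, norm_mul, norm_mul, norm_al, norm_zpow, mul_assoc]
    refine mul_le_mul_of_nonneg_left ?_ (by positivity)
    exact mul_le_mul (hD _ _) (hf k) (norm_nonneg _) hD0

/-- Jacobi triple product. -/
lemma jtp {q : ℂ} (hq0 : q ≠ 0) (hq : ‖q‖ < 1) {z : ℂ} (hz : z ≠ 0) :
    ∑' k : ℤ, al q k * z ^ k = qp q q * qp (z * q) q * qp z⁻¹ q := by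
  have h1 := Ln_tendsto hq0 hq hz (fun _ => 1) (C := 1) (by simp)
  simp only [mul_one] at h1
  have h2 := (((qp_tendsto q hq).comp (tendsto_id.const_mul_atTop' (by norm_num : 0 < 2)))).mul h1
  have h3 := (qp_tendsto (z * q) hq).mul (qp_tendsto z⁻¹ hq)
  have h4 := tendsto_nhds_unique h2 (h3.congr fun n => (Jn_prod hq0 hq hz n).symm)
  have h5 : qp q q ≠ 0 := qp_ne_zero_of_lt hq hq
  field_simp at h4
  rw [h4]; ring

lemma key {q : ℂ} (hq0 : q ≠ 0) (hq : ‖q‖ < 1) {z : ℂ} (hz : z ≠ 0)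
    (h : ∀ k : ℤ, z * q ^ k ≠ 1) :
    ∑' k : ℤ, al q k * (1 - z * q ^ k)⁻¹ = qp q q ^ 2 / (qp z q * qp (q * z⁻¹) q) := by
  obtain ⟨C, hC0, hC⟩ := inv_bound hq0 hq z hz h
  obtain ⟨D, hD0, hD⟩ := iqiq_bound hq
  have hne : ∀ k : ℤ, 1 - z * q ^ k ≠ 0 := fun k => sub_ne_zero.2 (h k).symm
  set L : ℕ → ℂ := fun n => ∑' k : ℤ, al q k * (1 : ℂ) ^ k * (iq q (n - k) * iq q (n + k)) *
    (1 - z * q ^ k)⁻¹ with hL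
  have hlim := Ln_tendsto hq0 hq (one_ne_zero) _ hC
  have hsum : ∀ n : ℕ, Summable (fun k : ℤ => al q k * (1 : ℂ) ^ k *
      (iq q (n - k) * iq q (n + k)) * (1 - z * q ^ k)⁻¹) := fun n => by
    have := summable_al hq0 hq one_ne_zero
      (fun k => (iq q (n - k) * iq q (n + k)) * (1 - z * q ^ k)⁻¹) (C := D * C) (fun k => by
        rw [norm_mul]
        exact mul_le_mul (hD _ _) (hC k) (norm_nonneg _) hD0)
    exact this.congr fun k => by ring
  have L0 : L 0 = (1 - z)⁻¹ := by
    rw [hL]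
    simp only
    rw [tsum_eq_single 0]
    · simp [al_zero, iq_zero]
    · intro k hk
      rcases lt_or_gt_of_ne hk with h | h
      · simp [iq_neg q h]
      · rw [iq_neg q (show ((0 : ℕ) : ℤ) - k < 0 by push_cast; omega)]; simp
  have Lrec : ∀ n, (1 - z * q * q ^ n) * (1 - q * z⁻¹ * q ^ n) * L (n + 1) = L n := by
    intro n
    have v1 := Jn_vanish_one hq0 hq (one_ne_zero) (by simp) n
    have v2 := Jn_vanish_one hq0 hq (inv_ne_zero hq0) (by simp [hq0]) n
    have s1 := Jn_summable hq0 hq one_ne_zero ((n + 1 : ℕ) : ℤ) ((n + 1 : ℕ) : ℤ)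
    have s2 := Jn_summable hq0 hq (inv_ne_zero hq0) ((n + 1 : ℕ) : ℤ) ((n + 1 : ℕ) : ℤ)
    have e : L n = L n + q ^ (n + 1) * Jn q q⁻¹ (n + 1) - q ^ (n + 1) * z⁻¹ * Jn q 1 (n + 1) := by
      rw [v1, v2]; ring
    rw [e, hL, Jn, Jn]
    simp only
    rw [← tsum_mul_left, ← tsum_mul_left, ← tsum_mul_left,
      ← Summable.tsum_add (hsum n) (s2.mul_left _),
      ← Summable.tsum_sub ((hsum n).add (s2.mul_left _)) (s1.mul_left _)]
    congr 1; ext k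
    have r1 := iq_rec hq ((n : ℤ) + 1 - k)
    have r2 := iq_rec hq ((n : ℤ) + 1 + k)
    rw [show (n : ℤ) + 1 - k - 1 = n - k by ring] at r1
    rw [show (n : ℤ) + 1 + k - 1 = n + k by ring] at r2
    rw [← r1, ← r2]
    push_cast
    have hqk : q ^ k ≠ 0 := zpow_ne_zero _ hq0
    have hqn : q ^ n ≠ 0 := pow_ne_zero _ hq0
    have hk := hne k
    simp only [zpow_add₀ hq0, zpow_sub₀ hq0, inv_zpow, zpow_natCast, zpow_one, pow_add,
      pow_one, one_zpow]
    generalize q ^ k = u at *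
    field_simp
    ring
  have Lprod : ∀ n, (∏ j ∈ Finset.range n, (1 - z * q * q ^ j)) *
      (∏ j ∈ Finset.range n, (1 - q * z⁻¹ * q ^ j)) * L n = (1 - z)⁻¹ := by
    intro n
    induction n with
    | zero => simpa using L0
    | succ n ih =>
      rw [Finset.prod_range_succ, Finset.prod_range_succ, ← ih, ← Lrec n]
      ring
  have h3 := ((qp_tendsto (z * q) hq).mul (qp_tendsto (q * z⁻¹) hq)).mul hlim
  have h4 := tendsto_nhds_unique h3 ((tendsto_const_nhds (x := (1 - z)⁻¹)).congr
    fun n => (Lprod n).symm)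
  have h5 : qp q q ≠ 0 := qp_ne_zero_of_lt hq hq
  have h6 : qp z q ≠ 0 := qp_ne_zero hq fun n => by simpa using h n
  have h7 : qp (q * z⁻¹) q ≠ 0 := qp_ne_zero hq fun n hn => by
    apply h (n + 1)
    apply_fun (z⁻¹ * ·) at hn
    have h8 := h (-(n + 1))
    exfalso
    apply h8
    rw [zpow_neg, zpow_add₀ hq0]
    simp only [zpow_natCast, zpow_one]
    have : q * z⁻¹ * q ^ n = 1 := by
      have hzi := inv_ne_zero hz
      exact mul_left_cancel₀ hzi (by simpa using hn)
    have hqn : q ^ n ≠ 0 := pow_ne_zero _ hq0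
    field_simp at this ⊢
    exact this.symm
  have h8 : (1 - z) ≠ 0 := by simpa using hne 0
  rw [qp_succ z hq] at h6 ⊢
  have h9 : qp (z * q) q ≠ 0 := right_ne_zero_of_mul h6
  simp only [one_zpow, mul_one] at h4
  generalize qp (q * z⁻¹) q = B at *
  generalize (∑' k : ℤ, al q k * (1 - z * q ^ k)⁻¹) = S at *
  field_simp at h4 ⊢
  linear_combination h4

/-! ### The main partial fraction identity -/

lemma tri_add (k l : ℤ) : tri (k + l) = tri k + tri l + k * l := by
  have h1 := two_tri k
  have h2 := two_tri l
  have h3 := two_tri (k + l)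
  nlinarith

lemma al_add {q : ℂ} (hq0 : q ≠ 0) (k l : ℤ) : al q (k + l) = al q k * al q l * q ^ (k * l) := by
  rw [al, al, al, tri_add, zpow_add₀ hq0, zpow_add₀ hq0, zpow_add₀ (by norm_num : (-1 : ℂ) ≠ 0)]
  ring

lemma tsum_antisymm (f : ℤ → ℂ) (c : ℤ) (h : ∀ k, f (c - k) = - f k) : ∑' k, f k = 0 := by
  have h1 : ∑' k, f (c - k) = ∑' k, f k := (Equiv.subLeft c).tsum_eq f
  simp only [h, tsum_neg] at h1
  linear_combination -h1 / 2

lemma neg_one_zpow_sub_odd (j k : ℤ) : (-1 : ℂ) ^ (2 * j + 1 - k) = - (-1) ^ k := by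
  have h1 : (-1 : ℂ) ^ (2 * j + 1 - k) = (-1) ^ (2 * (j - k)) * (-1) * (-1) ^ k := by
    rw [← zpow_add_one₀ (by norm_num), ← zpow_add₀ (by norm_num)]
    congr 1; ring
  rw [h1, zpow_mul]; norm_num

lemma al_vanish {q : ℂ} (hq0 : q ≠ 0) (j : ℤ) : ∑' k : ℤ, al q k * (q ^ j) ^ k = 0 := by
  apply tsum_antisymm _ (2 * (-j - 1) + 1)
  intro k
  rw [al, al, neg_one_zpow_sub_odd, ← zpow_mul, ← zpow_mul, neg_mul, neg_mul, mul_assoc, mul_assoc,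
    ← zpow_add₀ hq0, ← zpow_add₀ hq0]
  congr 3
  have h1 := two_tri k
  have h2 := two_tri (2 * (-j - 1) + 1 - k)
  nlinarith

lemma geom_rec (U : ℤ → ℂ) (c : ℂ) (hc : c ≠ 0) (h : ∀ k, U (k + 1) = c * U k) (k : ℤ) :
    U k = c ^ k * U 0 := by
  induction k using Int.induction_on with
  | zero => simp
  | succ n ih => rw [h, ih, zpow_add_one₀ hc]; ring
  | pred n ih =>
    have := h (-(n : ℤ) - 1)
    rw [sub_add_cancel, ih] at this
    rw [zpow_sub_one₀ hc]
    field_simp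
    linear_combination -this

lemma isCompl_int (f : ℤ → ℂ) (hf : Summable f) :
    ∑' l, f l = ∑' s, f (2 * s) + ∑' s, f (2 * s - 1) := by
  have i1 : Function.Injective (fun s : ℤ => 2 * s) := fun a b h => by simpa using h
  have i2 : Function.Injective (fun s : ℤ => 2 * s - 1) := fun a b h => by simpa using h
  have he := (hf.comp_injective i1).hasSum
  have ho := (hf.comp_injective i2).hasSum
  have h1 := i1.hasSum_range_iff.2 he
  have h2 := i2.hasSum_range_iff.2 ho
  refine (h1.add_isCompl ?_ h2).tsum_eq
  have e1 : Set.range (fun s : ℤ => 2 * s) = {n : ℤ | Even n} := by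
    ext n; simp only [Set.mem_range, Set.mem_ofPred_eq, even_iff_two_dvd, dvd_def, eq_comm]
  have e2 : Set.range (fun s : ℤ => 2 * s - 1) = {n : ℤ | Odd n} := by
    ext n; simp only [Set.mem_range, Set.mem_ofPred_eq, Odd]
    constructor
    · rintro ⟨s, rfl⟩; exact ⟨s - 1, by ring⟩
    · rintro ⟨s, rfl⟩; exact ⟨s + 1, by ring⟩
  rw [e1, e2]
  exact Int.isCompl_even_odd

lemma norm_zpow_ne_one {q : ℂ} (hq0 : q ≠ 0) (hq : ‖q‖ < 1) {k : ℤ} (hk : k ≠ 0) :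
    ‖q ^ k‖ ≠ 1 := by
  rw [norm_zpow]
  intro h
  exact hk ((zpow_eq_one_iff_right₀ (norm_nonneg _) hq.ne).1 h)

/-- pentagonal exponents -/
def pent (k : ℤ) : ℤ := tri k + k ^ 2

/-- The bilateral sum in the rank generating function. -/
noncomputable def SR (x q : ℂ) : ℂ := ∑' k : ℤ, (-1) ^ k * q ^ pent k * (1 - x * q ^ k)⁻¹

lemma sr_summable {q : ℂ} (hq0 : q ≠ 0) (hq : ‖q‖ < 1) (f : ℤ → ℂ)
    {C : ℝ} (hf : ∀ k, ‖f k‖ ≤ C) : Summable (fun k : ℤ => (-1) ^ k * q ^ pent k * f k) := by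
  have h0 : 0 ≤ C := (norm_nonneg _).trans (hf 0)
  have := summable_al hq0 hq one_ne_zero (fun k => q ^ (k ^ 2) * f k) (C := C) (fun k => by
    rw [norm_mul, norm_zpow]
    have : ‖q‖ ^ (k ^ 2) ≤ 1 := zpow_le_one₀ (norm_pos_iff.2 hq0) hq.le (sq_nonneg k)
    calc _ ≤ 1 * C := mul_le_mul this (hf k) (norm_nonneg _) zero_le_one
      _ = C := one_mul C)
  refine this.congr fun k => ?_
  rw [pent, zpow_add₀ hq0, al, one_zpow]; ring

lemma odd_ne {q : ℂ} (hq0 : q ≠ 0) (hq : ‖q‖ < 1) {m : ℤ} (hm : m ≠ 0) :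
    1 - -(q ^ m) ≠ 0 := by
  intro h
  apply norm_zpow_ne_one hq0 hq hm
  have : q ^ m = -1 := by linear_combination h
  rw [this]; simp

lemma odd_bound {q : ℂ} (hq0 : q ≠ 0) (hq : ‖q‖ < 1) :
    ∃ C : ℝ, 0 ≤ C ∧ ∀ k : ℤ, ‖(1 - -(q ^ (2 * k + 1)))⁻¹‖ ≤ C := by
  have hQ0 : q ^ 2 ≠ 0 := pow_ne_zero _ hq0
  have hQ := norm_sq_lt hq
  have e : ∀ k : ℤ, -q * (q ^ 2) ^ k = -(q ^ (2 * k + 1)) := fun k => by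
    rw [zpow_add_one₀ hq0, zpow_mul, zpow_ofNat q 2]; ring
  obtain ⟨C, h0, hC⟩ := inv_bound hQ0 hQ (-q) (neg_ne_zero.2 hq0) (fun k h => by
    rw [e] at h
    exact odd_ne hq0 hq (show 2 * k + 1 ≠ 0 by omega) (by rw [h]; ring))
  exact ⟨C, h0, fun k => by rw [← e]; exact hC k⟩

lemma Ul_summable {q : ℂ} (hq0 : q ≠ 0) (hq : ‖q‖ < 1) (k : ℤ) :
    Summable fun l : ℤ => al (q ^ 2) l * ((q ^ 2) ^ k) ^ l * (1 - -(q ^ (2 * l + 1)))⁻¹ := by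
  obtain ⟨C, -, hC⟩ := odd_bound hq0 hq
  exact summable_al (pow_ne_zero _ hq0) (norm_sq_lt hq) (zpow_ne_zero _ (pow_ne_zero _ hq0)) _ hC

/-- auxiliary sums `U_k` -/
noncomputable def Ul (q : ℂ) (k : ℤ) : ℂ :=
  ∑' l : ℤ, al (q ^ 2) l * ((q ^ 2) ^ k) ^ l * (1 - -(q ^ (2 * l + 1)))⁻¹

lemma Ul_rec {q : ℂ} (hq0 : q ≠ 0) (hq : ‖q‖ < 1) (k : ℤ) : Ul q (k + 1) = (-q⁻¹) * Ul q k := by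
  have hQ0 : q ^ 2 ≠ 0 := pow_ne_zero _ hq0
  have h1 : Ul q k + q * Ul q (k + 1) = 0 := by
    rw [← al_vanish hQ0 k, Ul, Ul, ← tsum_mul_left,
      ← Summable.tsum_add (Ul_summable hq0 hq k) ((Ul_summable hq0 hq (k + 1)).mul_left q)]
    congr 1; ext l
    have h2 := odd_ne hq0 hq (show 2 * l + 1 ≠ 0 by omega)
    have h3 : q ^ (2 * l + 1) = q * (q ^ 2) ^ l := by
      rw [zpow_add_one₀ hq0, zpow_mul, zpow_ofNat q 2]; ring
    rw [zpow_add_one₀ hQ0, mul_zpow]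
    rw [h3] at h2 ⊢
    clear h3
    generalize (q ^ 2) ^ l = u at *
    field_simp
    ring
  field_simp
  linear_combination h1

lemma U_eval {q : ℂ} (hq0 : q ≠ 0) (hq : ‖q‖ < 1) (k : ℤ) :
    ∑' l : ℤ, al (q ^ 2) l * (1 - -(q ^ (2 * (l - k) + 1)))⁻¹ =
      q ^ (k ^ 2) * Ul q 0 := by
  have hQ0 : q ^ 2 ≠ 0 := pow_ne_zero _ hq0
  have hg := geom_rec (Ul q) (-q⁻¹) (by simpa using hq0) (Ul_rec hq0 hq) k
  rw [← tsum_shift _ k]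
  have : ∀ l : ℤ, al (q ^ 2) (l + k) * (1 - -(q ^ (2 * (l + k - k) + 1)))⁻¹ =
      al (q ^ 2) k * (al (q ^ 2) l * ((q ^ 2) ^ k) ^ l * (1 - -(q ^ (2 * l + 1)))⁻¹) := by
    intro l
    rw [al_add hQ0, add_sub_cancel_right, ← zpow_mul (q ^ 2) k l, mul_comm k l]
    ring
  rw [tsum_congr this, tsum_mul_left]
  change _ * Ul q k = _
  rw [hg, al, ← mul_assoc]
  congr 1
  have e2 : ((-1 : ℂ)) ^ k * (-1) ^ k = 1 := by
    rw [← mul_zpow]; simp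
  have e3 : (-q⁻¹) ^ k = (-1) ^ k * (q ^ k)⁻¹ := by
    rw [← inv_zpow, ← mul_zpow]; simp
  have e4 : (q ^ 2) ^ tri k = q ^ (k ^ 2) * q ^ k := by
    rw [← zpow_ofNat q 2, ← zpow_mul, ← zpow_add₀ hq0]
    congr 1
    have := two_tri k
    linarith
  rw [e3, e4]
  have hqk : q ^ k ≠ 0 := zpow_ne_zero _ hq0
  generalize (-1 : ℂ) ^ k = s at *
  generalize q ^ (k ^ 2) = t at *
  field_simp
  linear_combination t * e2

/-- auxiliary sums `S_l` -/
noncomputable def Sl (q : ℂ) (l : ℤ) : ℂ :=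
  ∑' k : ℤ, al q k * (q ^ l) ^ k * (1 - -(q ^ (2 * k - 1)))⁻¹

lemma Sl_summable {q : ℂ} (hq0 : q ≠ 0) (hq : ‖q‖ < 1) (l : ℤ) :
    Summable fun k : ℤ => al q k * (q ^ l) ^ k * (1 - -(q ^ (2 * k - 1)))⁻¹ := by
  obtain ⟨C, -, hC⟩ := odd_bound hq0 hq
  refine summable_al hq0 hq (zpow_ne_zero _ hq0) _ (C := C) (fun k => ?_)
  have := hC (k - 1)
  rwa [show 2 * (k - 1) + 1 = 2 * k - 1 by ring] at this

lemma Sl_rec {q : ℂ} (hq0 : q ≠ 0) (hq : ‖q‖ < 1) (l : ℤ) : Sl q (l + 2) = -q * Sl q l := by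
  have h1 : Sl q l + q⁻¹ * Sl q (l + 2) = 0 := by
    rw [← al_vanish hq0 l, Sl, Sl, ← tsum_mul_left,
      ← Summable.tsum_add (Sl_summable hq0 hq l) ((Sl_summable hq0 hq (l + 2)).mul_left _)]
    congr 1; ext k
    have h2 := odd_ne hq0 hq (show 2 * k - 1 ≠ 0 by omega)
    rw [zpow_sub_one₀ hq0, zpow_mul] at *
    rw [zpow_add₀ hq0, mul_zpow, ← zpow_mul _ 2 k, mul_comm 2 k, zpow_mul _ k] at *
    have h3 : (q ^ k) ^ (2 : ℤ) = (q ^ k) ^ 2 := zpow_ofNat _ _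
    rw [h3] at *
    have h4 : q + (q ^ k) ^ 2 ≠ 0 := by
      intro h; apply h2; field_simp; simpa using h
    have h5 : (1 - -((q ^ k) ^ 2 * q⁻¹))⁻¹ = q * (q + (q ^ k) ^ 2)⁻¹ := by
      rw [sub_neg_eq_add, inv_eq_iff_eq_inv, mul_inv, inv_inv]
      field_simp
    rw [h5]
    field_simp
  field_simp at h1
  linear_combination h1

lemma Sl_zero {q : ℂ} (hq0 : q ≠ 0) (hq : ‖q‖ < 1) : Sl q 0 = 0 := by
  apply tsum_antisymm _ (2 * 0 + 1)
  intro k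
  rw [al, al, neg_one_zpow_sub_odd]
  simp only [zpow_zero, one_zpow, mul_one]
  have h1 := odd_ne hq0 hq (show 2 * (2 * 0 + 1 - k) - 1 ≠ 0 by omega)
  have h2 := odd_ne hq0 hq (show 2 * k - 1 ≠ 0 by omega)
  have h3 : q ^ (2 * (2 * 0 + 1 - k) - 1) * q ^ (2 * k - 1) = 1 := by
    rw [← zpow_add₀ hq0]; ring_nf; simp
  have h4 : q ^ tri (2 * 0 + 1 - k) * q ^ (2 * k - 1) = q ^ tri k := by
    rw [← zpow_add₀ hq0]
    congr 1
    have h1 := two_tri k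
    have h2 := two_tri (2 * 0 + 1 - k)
    nlinarith
  rw [← h4]
  have hk1 : (-1 : ℂ) ^ k ≠ 0 := zpow_ne_zero _ (by norm_num)
  generalize q ^ tri (2 * 0 + 1 - k) = a at *
  generalize q ^ (2 * (2 * 0 + 1 - k) - 1) = b at *
  generalize q ^ (2 * k - 1) = c at *
  generalize (-1 : ℂ) ^ k = d at *
  have h5 : (1 - -b)⁻¹ = c * (1 - -c)⁻¹ := by
    rw [inv_eq_iff_eq_inv, mul_inv, inv_inv]
    have hc : c ≠ 0 := right_ne_zero_of_mul (h3 ▸ one_ne_zero)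
    field_simp
    linear_combination h3
  rw [h5]; ring

lemma Sl_one {q : ℂ} (hq0 : q ≠ 0) (hq : ‖q‖ < 1) :
    Sl q 1 = q * qp q q ^ 2 / qp (-q) (q ^ 2) := by
  obtain ⟨p, hp⟩ := IsAlgClosed.exists_pow_nat_eq q (show 0 < 2 by norm_num)
  have hp0 : p ≠ 0 := by rintro rfl; apply hq0; rw [← hp]; simp
  have hp1 : ‖p‖ < 1 := by
    rw [← hp, norm_pow] at hq
    by_contra h
    push Not at h
    exact absurd hq (not_lt.2 (one_le_pow₀ h))
  have hI := Complex.I_ne_zero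
  have hII : Complex.I ^ 2 = -1 := Complex.I_sq
  have e : ∀ k : ℤ, Complex.I / p * q ^ k = Complex.I * p ^ (2 * k - 1) := fun k => by
    rw [zpow_sub_one₀ hp0, zpow_mul, zpow_ofNat p 2, hp]; ring
  have hne : ∀ k : ℤ, Complex.I / p * q ^ k ≠ 1 := fun k h => by
    rw [e] at h
    apply norm_zpow_ne_one hp0 hp1 (show 2 * k - 1 ≠ 0 by omega)
    have := congrArg norm h
    rw [norm_mul, Complex.norm_I, one_mul] at this
    simpa using this
  have hk := key hq0 hq (div_ne_zero hI hp0) hne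
  have h1 : ∑' k : ℤ, al q k * (1 - Complex.I / p * q ^ k)⁻¹ =
      Sl q 0 + (Complex.I / p) * Sl q 1 := by
    rw [Sl, Sl, ← tsum_mul_left,
      ← Summable.tsum_add (Sl_summable hq0 hq 0) ((Sl_summable hq0 hq 1).mul_left _)]
    congr 1; ext k
    have h2 := odd_ne hq0 hq (show 2 * k - 1 ≠ 0 by omega)
    have h3 := sub_ne_zero.2 (hne k).symm
    have h4 : q ^ (2 * k - 1) = - (Complex.I / p * q ^ k) ^ 2 := by
      rw [zpow_sub_one₀ hq0, mul_comm 2 k, zpow_mul, mul_pow, div_pow, hII, hp,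
        zpow_ofNat (q ^ k) 2]
      field_simp
    rw [h4] at h2 ⊢
    rw [zpow_zero, one_zpow, zpow_one, neg_neg] at *
    generalize q ^ k = u at *
    have h5 : 1 + Complex.I / p * u ≠ 0 := by
      intro h; apply h2; linear_combination (1 - Complex.I / p * u) * h
    have h6 : (1 : ℂ) - (Complex.I / p * u) ^ 2 = (1 - Complex.I / p * u) * (1 + Complex.I / p * u) := by
      ring
    rw [h6]
    generalize Complex.I / p = w at *
    field_simp
  rw [h1, Sl_zero hq0 hq, zero_add] at hk
  have e1 : q * (Complex.I / p)⁻¹ = (-(Complex.I * p)) * q := by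
    field_simp; rw [hII]; ring
  have e2 : qp (Complex.I / p) q = (1 - Complex.I / p) * qp (Complex.I * p) q := by
    rw [qp_succ _ hq]; congr 2; rw [← hp]; field_simp
  have e3 := qp_succ (-(Complex.I * p)) hq
  have e4 := qp_sq (Complex.I * p) hq
  rw [mul_pow, hII, hp, show -1 * q = -q by ring] at e4
  have hn : ‖Complex.I * p‖ < 1 := by simpa using hp1
  have n1 := qp_ne_zero_of_lt hq hn
  have n2 := qp_ne_zero_of_lt hq (show ‖-(Complex.I * p)‖ < 1 by simpa using hp1)
  rw [e3] at n2 e4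
  rw [e1, e2] at hk
  rw [← e4]
  have n3 : 1 - Complex.I / p ≠ 0 := by simpa using sub_ne_zero.2 (hne 0).symm
  have n4 := left_ne_zero_of_mul n2
  have n5 := right_ne_zero_of_mul n2
  generalize qp (-(Complex.I * p) * q) q = a at *
  generalize qp (Complex.I * p) q = b at *
  have h7 : Sl q 1 = p / Complex.I * (qp q q ^ 2 / ((1 - Complex.I / p) * b * a)) := by
    rw [← hk]; field_simp
  rw [h7]
  have e5 : 1 - Complex.I / p = -(Complex.I / p) * (1 - -(Complex.I * p)) := by
    field_simp; linear_combination p * hII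
  rw [e5]
  generalize 1 - -(Complex.I * p) = c at *
  rw [← hp]
  generalize qp (p ^ 2) (p ^ 2) = d at *
  field_simp
  linear_combination (-d ^ 2) * hII

lemma inner_l {q : ℂ} (hq0 : q ≠ 0) (hq : ‖q‖ < 1) (z : ℂ) (l : ℤ) :
    ∑' k : ℤ, al q k * ((1 + z * q ^ k) * (1 - -(q ^ (2 * (k - l) - 1)))⁻¹) =
      al q l * (Sl q l + z * q ^ l * Sl q (l + 1)) := by
  rw [Sl, Sl, ← tsum_mul_left,
    ← Summable.tsum_add (Sl_summable hq0 hq l) ((Sl_summable hq0 hq (l + 1)).mul_left _),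
    ← tsum_mul_left, ← tsum_shift _ l]
  congr 1; ext k
  rw [add_sub_cancel_right, al_add hq0, zpow_add₀ hq0 l 1, zpow_one, mul_zpow, ← zpow_mul,
    mul_comm l k, zpow_add₀ hq0 k l]
  ring

lemma Sl_even {q : ℂ} (hq0 : q ≠ 0) (hq : ‖q‖ < 1) (s : ℤ) : Sl q (2 * s) = 0 := by
  have := geom_rec (fun s => Sl q (2 * s)) (-q) (neg_ne_zero.2 hq0)
    (fun k => by rw [← Sl_rec hq0 hq]; congr 1; ring) s
  simpa [Sl_zero hq0 hq] using this

lemma Sl_odd {q : ℂ} (hq0 : q ≠ 0) (hq : ‖q‖ < 1) (s : ℤ) :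
    Sl q (2 * s + 1) = (-q) ^ s * Sl q 1 := by
  have := geom_rec (fun s => Sl q (2 * s + 1)) (-q) (neg_ne_zero.2 hq0)
    (fun k => by rw [← Sl_rec hq0 hq]; congr 1; ring) s
  simpa using this

lemma norm_pow4_lt {q : ℂ} (hq : ‖q‖ < 1) : ‖q ^ 4‖ < 1 := by
  rw [norm_pow]
  exact pow_lt_one₀ (norm_nonneg _) hq (by norm_num)

lemma neg_q_zpow (q : ℂ) (s : ℤ) : (-q) ^ s = (-1) ^ s * q ^ s := by
  rw [← mul_zpow]; simp

lemma sr_sum_x {q : ℂ} (hq0 : q ≠ 0) (hq : ‖q‖ < 1) {x : ℂ} (hx : x ≠ 0)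
    (h : ∀ s : ℤ, x * q ^ s ≠ 1) :
    Summable (fun k : ℤ => (-1) ^ k * q ^ pent k * (1 - x * q ^ k)⁻¹) := by
  obtain ⟨C, -, hC⟩ := inv_bound hq0 hq x hx h
  exact sr_summable hq0 hq _ hC

lemma sr_sum_0 {q : ℂ} (hq0 : q ≠ 0) (hq : ‖q‖ < 1) :
    Summable (fun k : ℤ => (-1) ^ k * q ^ pent k * (1 - 0 * q ^ k)⁻¹) := by
  refine sr_summable hq0 hq _ (C := 1) (by simp)

lemma pow4_pent {q : ℂ} (hq0 : q ≠ 0) (s : ℤ) : (q ^ 4) ^ pent s = q ^ (6 * s ^ 2 + 2 * s) := by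
  rw [← zpow_ofNat q 4, ← zpow_mul]
  congr 1
  have := two_tri s
  rw [pent]; linarith

lemma pow4_zpow (q : ℂ) (s : ℤ) : (q ^ 4) ^ s = q ^ (4 * s) := by
  rw [← zpow_ofNat q 4, ← zpow_mul]

lemma even_part {q : ℂ} (hq0 : q ≠ 0) (hq : ‖q‖ < 1) {z : ℂ} (hz : z ≠ 0)
    (h2 : ∀ l : ℤ, 1 - -(z ^ 2 * q ^ (2 * l + 1)) ≠ 0) :
    ∑' s : ℤ, al (q ^ 2) (2 * s) * (1 - -(z ^ 2 * q ^ (2 * (2 * s) + 1)))⁻¹ *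
      (al q (2 * s) * (Sl q (2 * s) + z * q ^ (2 * s) * Sl q (2 * s + 1))) =
    - (Sl q 1 / q * (z⁻¹ * (SR (-z ^ 2 * q) (q ^ 4) - SR 0 (q ^ 4)))) := by
  have hQ0 : q ^ 4 ≠ 0 := pow_ne_zero _ hq0
  have hQ := norm_pow4_lt hq
  have hx : -z ^ 2 * q ≠ 0 := mul_ne_zero (neg_ne_zero.2 (pow_ne_zero _ hz)) hq0
  have e : ∀ s : ℤ, -z ^ 2 * q * (q ^ 4) ^ s = -(z ^ 2 * q ^ (2 * (2 * s) + 1)) := fun s => by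
    rw [zpow_add_one₀ hq0, pow4_zpow, ← mul_assoc 2 2 s]; norm_num; ring
  have hne : ∀ s : ℤ, -z ^ 2 * q * (q ^ 4) ^ s ≠ 1 := fun s h => by
    rw [e] at h; exact h2 (2 * s) (by rw [h]; ring)
  rw [SR, SR, ← Summable.tsum_sub (sr_sum_x hQ0 hQ hx hne) (sr_sum_0 hQ0 hQ), ← tsum_mul_left,
    ← tsum_mul_left, ← tsum_neg]
  congr 1; ext s
  have h2s := h2 (2 * s)
  rw [Sl_even hq0 hq, Sl_odd hq0 hq, neg_q_zpow, e, pow4_pent hq0]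
  have a1 : al (q ^ 2) (2 * s) = q ^ (4 * s ^ 2 + 2 * s) := by
    have a0 : (-1 : ℂ) ^ (2 * s) = 1 := by rw [zpow_mul]; norm_num
    rw [al, a0, ← zpow_ofNat q 2, ← zpow_mul, one_mul]
    have := two_tri (2 * s)
    rw [show 2 * tri (2 * s) = 4 * s ^ 2 + 2 * s by rw [this]; ring]
  have a2 : al q (2 * s) = q ^ (2 * s ^ 2 + s) := by
    rw [al, zpow_mul]
    have := two_tri (2 * s)
    rw [show tri (2 * s) = 2 * s ^ 2 + s by nlinarith]; norm_num
  have a3 : q ^ (4 * s ^ 2 + 2 * s) * q ^ (2 * s ^ 2 + s) * q ^ (2 * s) * q ^ s =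
      q ^ (6 * s ^ 2 + 2 * s) * q ^ (4 * s) := by
    simp only [← zpow_add₀ hq0]; congr 1; ring
  have a4 : q ^ (2 * (2 * s) + 1) = q ^ (4 * s) * q := by
    rw [zpow_add_one₀ hq0, ← mul_assoc 2 2 s]; norm_num
  rw [a1, a2]
  rw [a4] at h2s ⊢
  clear e hne
  calc _ = (q ^ (4 * s ^ 2 + 2 * s) * q ^ (2 * s ^ 2 + s) * q ^ (2 * s) * q ^ s) *
      ((-1) ^ s * z * Sl q 1 * (1 - -(z ^ 2 * (q ^ (4 * s) * q)))⁻¹) := by ring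
    _ = _ := by
      rw [a3]
      generalize q ^ (4 * s) = u at *
      have : (1 - -(z ^ 2 * (u * q))) = 1 + z ^ 2 * (u * q) := by ring
      rw [this] at h2s ⊢
      rw [zero_mul, sub_zero, inv_one]
      generalize hD : 1 + z ^ 2 * (u * q) = D at *
      field_simp
      linear_combination (Sl q 1) * hD

lemma odd_part {q : ℂ} (hq0 : q ≠ 0) (hq : ‖q‖ < 1) {z : ℂ} (hz : z ≠ 0)
    (h2 : ∀ l : ℤ, 1 - -(z ^ 2 * q ^ (2 * l + 1)) ≠ 0) :
    ∑' s : ℤ, al (q ^ 2) (2 * s - 1) * (1 - -(z ^ 2 * q ^ (2 * (2 * s - 1) + 1)))⁻¹ *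
      (al q (2 * s - 1) * (Sl q (2 * s - 1) + z * q ^ (2 * s - 1) * Sl q (2 * s - 1 + 1))) =
    - (Sl q 1 / q * (SR 0 (q ^ 4) - SR (-(z⁻¹) ^ 2 * q) (q ^ 4))) := by
  have hQ0 : q ^ 4 ≠ 0 := pow_ne_zero _ hq0
  have hQ := norm_pow4_lt hq
  have hx : -(z⁻¹) ^ 2 * q ≠ 0 :=
    mul_ne_zero (neg_ne_zero.2 (pow_ne_zero _ (inv_ne_zero hz))) hq0
  have e0 : ∀ s : ℤ, z ^ 2 * q ^ (2 * (-2 * s - 1) + 1) * ((z⁻¹) ^ 2 * q * (q ^ 4) ^ s) = 1 := by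
    intro s
    rw [pow4_zpow, show 2 * (-2 * s - 1) + 1 = -(4 * s + 1) by ring, zpow_neg, zpow_add_one₀ hq0]
    have : q ^ (4 * s) ≠ 0 := zpow_ne_zero _ hq0
    field_simp
  have hne : ∀ s : ℤ, -(z⁻¹) ^ 2 * q * (q ^ 4) ^ s ≠ 1 := fun s h => by
    apply h2 (-2 * s - 1)
    have := e0 s
    rw [show (z⁻¹) ^ 2 * q * (q ^ 4) ^ s = -1 by linear_combination -h] at this
    linear_combination -this
  rw [SR, SR, ← Summable.tsum_sub (sr_sum_0 hQ0 hQ) (sr_sum_x hQ0 hQ hx hne), ← tsum_mul_left,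
    ← tsum_neg, ← tsum_neg_int]
  congr 1; ext s
  have h2s := h2 (-2 * s - 1)
  have e0s := e0 s
  have hnes := sub_ne_zero.2 (hne s).symm
  rw [show 2 * -s - 1 + 1 = 2 * -s by ring, Sl_even hq0 hq, show 2 * -s - 1 = 2 * (-s - 1) + 1 by ring,
    Sl_odd hq0 hq, neg_q_zpow, pow4_pent hq0, show 2 * (-s - 1) + 1 = -2 * s - 1 by ring]
  have a0 : (-1 : ℂ) ^ (-2 * s - 1) = -1 := by
    rw [zpow_sub_one₀ (by norm_num), zpow_mul]; norm_num
  have a1 : al (q ^ 2) (-2 * s - 1) = -q ^ (4 * s ^ 2 + 2 * s) := by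
    rw [al, a0, ← zpow_ofNat q 2, ← zpow_mul]
    have := two_tri (-2 * s - 1)
    rw [show 2 * tri (-2 * s - 1) = 4 * s ^ 2 + 2 * s by rw [this]; ring]; norm_num
  have a2 : al q (-2 * s - 1) = -q ^ (2 * s ^ 2 + s) := by
    rw [al, a0]
    have := two_tri (-2 * s - 1)
    rw [show tri (-2 * s - 1) = 2 * s ^ 2 + s by nlinarith]; norm_num
  have a3 : q ^ (4 * s ^ 2 + 2 * s) * q ^ (2 * s ^ 2 + s) * q ^ (-s - 1) =
      q ^ (6 * s ^ 2 + 2 * s) * q⁻¹ := by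
    rw [← zpow_sub_one₀ hq0]
    simp only [← zpow_add₀ hq0]; congr 1; ring
  have a5 : (-1 : ℂ) ^ (-s - 1) = - (-1) ^ s := by
    have := neg_one_zpow_sub_odd (-s-1) (-s-1)
    rw [show 2 * (-s - 1) + 1 - (-s - 1) = -s by ring] at this
    rw [zpow_neg] at this
    have e2 : ((-1 : ℂ)) ^ s * (-1) ^ s = 1 := by
      rw [← mul_zpow]; simp
    have e3 : ((-1 : ℂ) ^ s)⁻¹ = (-1) ^ s := inv_eq_of_mul_eq_one_left e2
    rw [e3] at this
    linear_combination this
  rw [a1, a2, a5]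
  clear hne e0
  rw [show -(z⁻¹) ^ 2 * q * (q ^ 4) ^ s = - ((z⁻¹) ^ 2 * q * (q ^ 4) ^ s) by ring] at hnes ⊢
  generalize (z⁻¹) ^ 2 * q * (q ^ 4) ^ s = w at *
  generalize z ^ 2 * q ^ (2 * (-2 * s - 1) + 1) = v at *
  have e6 : (1 - -v)⁻¹ = 1 - (1 - -w)⁻¹ := by
    have hw : 1 + w ≠ 0 := by simpa using hnes
    have hv : 1 + v ≠ 0 := by simpa using h2s
    rw [sub_neg_eq_add, sub_neg_eq_add]
    field_simp
    linear_combination -e0s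
  rw [e6]
  linear_combination ((-1) ^ s * (1 - (1 - -w)⁻¹) * Sl q 1 * (-1)) * a3

lemma main_pf {q : ℂ} (hq0 : q ≠ 0) (hq : ‖q‖ < 1) {z : ℂ} (hz : z ≠ 0)
    (h1 : ∀ k : ℤ, z * q ^ k ≠ 1) (h2 : ∀ l : ℤ, 1 - -(z ^ 2 * q ^ (2 * l + 1)) ≠ 0) :
    (∑' k : ℤ, al q k * (1 - z * q ^ k)⁻¹) *
      (∑' l : ℤ, al (q ^ 2) l * (1 - -(z ^ 2 * q ^ (2 * l + 1)))⁻¹) =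
    Ul q 0 * SR z q - Sl q 1 / q * (z⁻¹ * (SR (-z ^ 2 * q) (q ^ 4) - SR 0 (q ^ 4)) +
      (SR 0 (q ^ 4) - SR (-(z⁻¹) ^ 2 * q) (q ^ 4))) := by
  have hQ0 : q ^ 2 ≠ 0 := pow_ne_zero _ hq0
  have hQ := norm_sq_lt hq
  have e : ∀ l : ℤ, -(z ^ 2 * q) * (q ^ 2) ^ l = -(z ^ 2 * q ^ (2 * l + 1)) := fun l => by
    rw [zpow_add_one₀ hq0, zpow_mul, zpow_ofNat q 2]; ring
  obtain ⟨C1, hC10, hC1⟩ := inv_bound hq0 hq z hz h1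
  obtain ⟨C2, hC20, hC2⟩ := inv_bound hQ0 hQ (-(z ^ 2 * q))
    (neg_ne_zero.2 (mul_ne_zero (pow_ne_zero _ hz) hq0)) (fun l h => by
      rw [e] at h; exact h2 l (by rw [h]; ring))
  simp only [e] at hC2
  obtain ⟨C3, hC30, hC3⟩ := odd_bound hq0 hq
  have sa := summable_al_norm hq0 hq one_ne_zero _ hC1
  have sb := summable_al_norm hQ0 hQ one_ne_zero _ hC2
  simp only [one_zpow, mul_one] at sa sb
  have sa0 := summable_al_norm hq0 hq one_ne_zero (fun _ => 1) (C := 1) (by simp)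
  have sa1 := summable_al_norm hq0 hq hq0 (fun _ => 1) (C := 1) (by simp)
  have sb0 := summable_al_norm hQ0 hQ one_ne_zero (fun _ => 1) (C := 1) (by simp)
  simp only [one_zpow, mul_one] at sa0 sb0 sa1
  have s1 : Summable (fun p : ℤ × ℤ => (al q p.1 * (1 - z * q ^ p.1)⁻¹) *
      (al (q ^ 2) p.2 * (1 - -(q ^ (2 * (p.2 - p.1) + 1)))⁻¹)) := by
    refine Summable.of_norm_bounded ((sa.mul_norm sb0).mul_right C3) (fun p => ?_)
    rw [← mul_assoc, norm_mul _ (1 - -(q ^ (2 * (p.2 - p.1) + 1)))⁻¹]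
    exact mul_le_mul_of_nonneg_left (hC3 _) (norm_nonneg _)
  have hC3' : ∀ m : ℤ, ‖(1 - -(q ^ (2 * m - 1)))⁻¹‖ ≤ C3 := fun m => by
    have := hC3 (m - 1)
    rwa [show 2 * (m - 1) + 1 = 2 * m - 1 by ring] at this
  have s2 : Summable (fun p : ℤ × ℤ => (al (q ^ 2) p.1 * (1 - -(z ^ 2 * q ^ (2 * p.1 + 1)))⁻¹) *
      (al q p.2 * ((1 + z * q ^ p.2) * (1 - -(q ^ (2 * (p.2 - p.1) - 1)))⁻¹))) := by
    have t1 := (sb.mul_norm sa0).mul_right C3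
    have t2 := ((sb.mul_norm sa1).mul_right (‖z‖ * C3))
    refine Summable.of_norm_bounded (t1.add t2) (fun p => ?_)
    have ee : (al (q ^ 2) p.1 * (1 - -(z ^ 2 * q ^ (2 * p.1 + 1)))⁻¹) *
      (al q p.2 * ((1 + z * q ^ p.2) * (1 - -(q ^ (2 * (p.2 - p.1) - 1)))⁻¹)) =
      (al (q ^ 2) p.1 * (1 - -(z ^ 2 * q ^ (2 * p.1 + 1)))⁻¹) * al q p.2 *
        (1 - -(q ^ (2 * (p.2 - p.1) - 1)))⁻¹ +
      (al (q ^ 2) p.1 * (1 - -(z ^ 2 * q ^ (2 * p.1 + 1)))⁻¹) * (al q p.2 * q ^ p.2) *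
        (z * (1 - -(q ^ (2 * (p.2 - p.1) - 1)))⁻¹) := by ring
    rw [ee]
    refine (norm_add_le _ _).trans (add_le_add ?_ ?_)
    · rw [norm_mul _ (1 - -(q ^ (2 * (p.2 - p.1) - 1)))⁻¹]
      exact mul_le_mul_of_nonneg_left (hC3' _) (norm_nonneg _)
    · rw [norm_mul _ (z * _), norm_mul z]
      exact mul_le_mul_of_nonneg_left (mul_le_mul_of_nonneg_left (hC3' _) (norm_nonneg _))
        (norm_nonneg _)
  have s2' : Summable (fun p : ℤ × ℤ => (al (q ^ 2) p.2 * (1 - -(z ^ 2 * q ^ (2 * p.2 + 1)))⁻¹) *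
      (al q p.1 * ((1 + z * q ^ p.1) * (1 - -(q ^ (2 * (p.1 - p.2) - 1)))⁻¹))) :=
    (Equiv.prodComm ℤ ℤ).summable_iff.2 s2
  have T2 : ∑' p : ℤ × ℤ, (al (q ^ 2) p.2 * (1 - -(z ^ 2 * q ^ (2 * p.2 + 1)))⁻¹) *
      (al q p.1 * ((1 + z * q ^ p.1) * (1 - -(q ^ (2 * (p.1 - p.2) - 1)))⁻¹)) =
      ∑' p : ℤ × ℤ, (al (q ^ 2) p.1 * (1 - -(z ^ 2 * q ^ (2 * p.1 + 1)))⁻¹) *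
      (al q p.2 * ((1 + z * q ^ p.2) * (1 - -(q ^ (2 * (p.2 - p.1) - 1)))⁻¹)) :=
    (Equiv.prodComm ℤ ℤ).tsum_eq (fun p : ℤ × ℤ =>
      (al (q ^ 2) p.1 * (1 - -(z ^ 2 * q ^ (2 * p.1 + 1)))⁻¹) *
      (al q p.2 * ((1 + z * q ^ p.2) * (1 - -(q ^ (2 * (p.2 - p.1) - 1)))⁻¹)))
  have hsplit : ∀ p : ℤ × ℤ, (al q p.1 * (1 - z * q ^ p.1)⁻¹) *
      (al (q ^ 2) p.2 * (1 - -(z ^ 2 * q ^ (2 * p.2 + 1)))⁻¹) =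
      (al q p.1 * (1 - z * q ^ p.1)⁻¹) *
      (al (q ^ 2) p.2 * (1 - -(q ^ (2 * (p.2 - p.1) + 1)))⁻¹) +
      (al (q ^ 2) p.2 * (1 - -(z ^ 2 * q ^ (2 * p.2 + 1)))⁻¹) *
      (al q p.1 * ((1 + z * q ^ p.1) * (1 - -(q ^ (2 * (p.1 - p.2) - 1)))⁻¹)) := by
    rintro ⟨k, l⟩
    simp only
    have n1 := sub_ne_zero.2 (h1 k).symm
    have n2 := h2 l
    have n3 := odd_ne hq0 hq (show 2 * (l - k) + 1 ≠ 0 by omega)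
    have n4 := odd_ne hq0 hq (show 2 * (k - l) - 1 ≠ 0 by omega)
    have hx : q ^ k ≠ 0 := zpow_ne_zero _ hq0
    have hy : q ^ (2 * l + 1) ≠ 0 := zpow_ne_zero _ hq0
    have f1 : q ^ (2 * (l - k) + 1) = q ^ (2 * l + 1) / (q ^ k) ^ 2 := by
      rw [eq_div_iff (pow_ne_zero _ hx), ← zpow_ofNat (q ^ k) 2, ← zpow_mul, ← zpow_add₀ hq0]
      congr 1; ring
    have f2 : q ^ (2 * (k - l) - 1) = (q ^ k) ^ 2 / q ^ (2 * l + 1) := by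
      rw [eq_div_iff hy, ← zpow_ofNat (q ^ k) 2, ← zpow_mul, ← zpow_add₀ hq0]
      congr 1; ring
    rw [f1] at n3 ⊢
    rw [f2] at n4 ⊢
    clear f1 f2
    generalize q ^ (2 * l + 1) = y at *
    generalize q ^ k = x at *
    have m1 : y + x ^ 2 ≠ 0 := by
      intro h; apply n3; field_simp; linear_combination h
    have g3 : (1 - -(y / x ^ 2))⁻¹ = x ^ 2 / (y + x ^ 2) := by
      rw [inv_eq_iff_eq_inv, inv_div]; field_simp; ring
    have g4 : (1 - -(x ^ 2 / y))⁻¹ = y / (y + x ^ 2) := by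
      rw [inv_eq_iff_eq_inv, inv_div]; field_simp; ring
    rw [g3, g4]
    rw [sub_neg_eq_add] at n2 ⊢
    field_simp
    ring
  rw [tsum_mul_tsum_of_summable_norm sa sb, tsum_congr hsplit, Summable.tsum_add s1 s2', T2,
    s1.tsum_prod, s2.tsum_prod]
  simp only
  have p1 : ∑' k : ℤ, ∑' l : ℤ, (al q k * (1 - z * q ^ k)⁻¹) *
      (al (q ^ 2) l * (1 - -(q ^ (2 * (l - k) + 1)))⁻¹) = Ul q 0 * SR z q := by
    rw [SR, ← tsum_mul_left]
    congr 1; ext k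
    rw [tsum_mul_left, U_eval hq0 hq, pent, zpow_add₀ hq0, al]
    ring
  have p2 : ∑' l : ℤ, ∑' k : ℤ, (al (q ^ 2) l * (1 - -(z ^ 2 * q ^ (2 * l + 1)))⁻¹) *
      (al q k * ((1 + z * q ^ k) * (1 - -(q ^ (2 * (k - l) - 1)))⁻¹)) =
      ∑' l : ℤ, (al (q ^ 2) l * (1 - -(z ^ 2 * q ^ (2 * l + 1)))⁻¹) *
        (al q l * (Sl q l + z * q ^ l * Sl q (l + 1))) := by
    congr 1; ext l
    rw [tsum_mul_left, inner_l hq0 hq]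
  have p3 : Summable fun l : ℤ => (al (q ^ 2) l * (1 - -(z ^ 2 * q ^ (2 * l + 1)))⁻¹) *
        (al q l * (Sl q l + z * q ^ l * Sl q (l + 1))) := by
    refine s2.prod.congr fun l => ?_
    simp only
    rw [tsum_mul_left, inner_l hq0 hq]
  rw [p1, p2, isCompl_int _ p3, even_part hq0 hq hz h2, odd_part hq0 hq hz h2]
  ring

/-! ### Rank and crank functions -/

/-- analytic rank generating function -/
noncomputable def Rf (z q : ℂ) : ℂ := (1 - z) * (qp q q)⁻¹ * SR z q
/-- analytic crank generating function -/
noncomputable def Cf (z q : ℂ) : ℂ := qp q q / (qp (z * q) q * qp (q * z⁻¹) q)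
/-- theta quotient -/
noncomputable def Tf (z q : ℂ) : ℂ :=
  Cf z q * qp (-q) (q ^ 2) ^ 2 / (qp (-z ^ 2 * q) (q ^ 2) * qp (-(z⁻¹) ^ 2 * q) (q ^ 2))
/-- the mock part -/
noncomputable def Gf (z q : ℂ) : ℂ :=
  z⁻¹ * (SR (-z ^ 2 * q) (q ^ 4) - SR 0 (q ^ 4)) + (SR 0 (q ^ 4) - SR (-(z⁻¹) ^ 2 * q) (q ^ 4))

lemma euler_prod {q : ℂ} (hq : ‖q‖ < 1) : qp (-q) q * qp q (q ^ 2) = 1 := by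
  have h1 := qp_sq q hq
  have h2 := qp_even_odd q hq
  rw [← sq] at h2
  have h3 := qp_ne_zero_of_lt (norm_sq_lt hq) (norm_sq_lt hq)
  rw [h2] at h1
  apply mul_left_cancel₀ h3
  linear_combination h1

lemma norm_neg_lt {q : ℂ} (hq : ‖q‖ < 1) : ‖-q‖ < 1 := by simpa using hq

lemma K_eval {q : ℂ} (hq : ‖q‖ < 1) :
    qp q q * qp (-q) (q ^ 2) * qp (q ^ 4) (q ^ 4) = qp (q ^ 2) (q ^ 2) ^ 2 := by
  have h1 := qp_even_odd q hq
  have h2 := qp_sq q (norm_sq_lt hq)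
  have h3 := qp_even_odd (q ^ 2) (norm_sq_lt hq)
  rw [← sq] at h1
  rw [← sq, ← pow_mul] at h3
  rw [← pow_mul] at h2
  norm_num at h2 h3
  rw [h1]
  linear_combination qp (q ^ 2) (q ^ 2) * qp (q ^ 4) (q ^ 4) * h2 - qp (q ^ 2) (q ^ 2) * h3

lemma z_ne {q z : ℂ} (hq : ‖q‖ < 1) (hq0 : q ≠ 0) (hz : ‖z‖ = 1) (hz1 : z ≠ 1) (k : ℤ) :
    z * q ^ k ≠ 1 := by
  intro h
  by_cases hk : k = 0
  · subst hk; simp at h; exact hz1 h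
  · apply norm_zpow_ne_one hq0 hq hk
    have := congrArg norm h
    rw [norm_mul, hz, one_mul] at this
    simpa using this

lemma z2_ne {q z : ℂ} (hq : ‖q‖ < 1) (hq0 : q ≠ 0) (hz : ‖z‖ = 1) (l : ℤ) :
    1 - -(z ^ 2 * q ^ (2 * l + 1)) ≠ 0 := by
  intro h
  apply norm_zpow_ne_one hq0 hq (show 2 * l + 1 ≠ 0 by omega)
  have : z ^ 2 * q ^ (2 * l + 1) = -1 := by linear_combination h
  have := congrArg norm this
  rw [norm_mul, norm_pow, hz, one_pow, one_mul] at this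
  simpa using this

lemma key_sq {q z : ℂ} (hq : ‖q‖ < 1) (hq0 : q ≠ 0) (hz : ‖z‖ = 1) :
    ∑' l : ℤ, al (q ^ 2) l * (1 - -(z ^ 2 * q ^ (2 * l + 1)))⁻¹ =
      qp (q ^ 2) (q ^ 2) ^ 2 / (qp (-z ^ 2 * q) (q ^ 2) * qp (-(z⁻¹) ^ 2 * q) (q ^ 2)) := by
  have hz0 : z ≠ 0 := by rintro rfl; simp at hz
  have hQ0 : q ^ 2 ≠ 0 := pow_ne_zero _ hq0
  have hQ := norm_sq_lt hq
  have e : ∀ l : ℤ, -z ^ 2 * q * (q ^ 2) ^ l = -(z ^ 2 * q ^ (2 * l + 1)) := fun l => by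
    rw [zpow_add_one₀ hq0, zpow_mul, zpow_ofNat q 2]; ring
  have hne : ∀ l : ℤ, -z ^ 2 * q * (q ^ 2) ^ l ≠ 1 := fun l h => by
    rw [e] at h; exact z2_ne hq hq0 hz l (by rw [h]; ring)
  have := key hQ0 hQ (mul_ne_zero (neg_ne_zero.2 (pow_ne_zero 2 hz0)) hq0) hne
  simp only [e] at this
  rw [this]
  congr 3
  field_simp

lemma Ul_zero {q : ℂ} (hq : ‖q‖ < 1) (hq0 : q ≠ 0) :
    Ul q 0 = qp (q ^ 2) (q ^ 2) ^ 2 / (qp (-q) (q ^ 2) * qp (-q) (q ^ 2)) := by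
  have := key_sq (z := 1) hq hq0 (by simp)
  simpa [Ul] using this

lemma Rf_eq {q z : ℂ} (hq0 : q ≠ 0) (hq : ‖q‖ < 1) (hz : ‖z‖ = 1) (hz1 : z ≠ 1) :
    Rf z q = (1 - z) * (qp (q ^ 4) (q ^ 4))⁻¹ * Gf z q + Tf z q := by
  have hz0 : z ≠ 0 := by rintro rfl; simp at hz
  have hm := main_pf hq0 hq hz0 (z_ne hq hq0 hz hz1) (z2_ne hq hq0 hz)
  rw [key hq0 hq hz0 (z_ne hq hq0 hz hz1), key_sq hq hq0 hz, Ul_zero hq hq0, Sl_one hq0 hq,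
    qp_succ z hq] at hm
  change _ = _ - _ * Gf z q at hm
  rw [Rf, Tf, Cf]
  have hK := K_eval hq
  have n1 : 1 - z ≠ 0 := sub_ne_zero.2 hz1.symm
  have n2 := qp_ne_zero_of_lt hq hq
  have n3 := qp_ne_zero_of_lt (norm_pow4_lt hq) (norm_pow4_lt hq)
  have n4 := qp_ne_zero_of_lt (norm_sq_lt hq) (norm_sq_lt hq)
  have n5 := qp_ne_zero_of_lt (norm_sq_lt hq) (norm_neg_lt hq)
  have n6 : qp (z * q) q ≠ 0 := qp_ne_zero_of_lt hq (by rw [norm_mul, hz]; simpa using hq)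
  have n7 : qp (q * z⁻¹) q ≠ 0 :=
    qp_ne_zero_of_lt hq (by rw [norm_mul, norm_inv, hz]; simpa using hq)
  have n8 : qp (-z ^ 2 * q) (q ^ 2) ≠ 0 := qp_ne_zero_of_lt (norm_sq_lt hq)
    (by rw [norm_mul, norm_neg, norm_pow, hz]; simpa using hq)
  have n9 : qp (-(z⁻¹) ^ 2 * q) (q ^ 2) ≠ 0 := qp_ne_zero_of_lt (norm_sq_lt hq)
    (by rw [norm_mul, norm_neg, norm_pow, norm_inv, hz]; simpa using hq)
  generalize qp (-(z⁻¹) ^ 2 * q) (q ^ 2) = a9 at *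
  generalize qp (-z ^ 2 * q) (q ^ 2) = a8 at *
  generalize qp (q * z⁻¹) q = a7 at *
  generalize qp (z * q) q = a6 at *
  generalize qp (-q) (q ^ 2) = a5 at *
  generalize qp (q ^ 2) (q ^ 2) = a4 at *
  generalize qp (q ^ 4) (q ^ 4) = a3 at *
  generalize qp q q = a2 at *
  generalize SR z q = s at *
  generalize Gf z q = g at *
  have hs : s = (a5 * a5 / a4 ^ 2) * (a2 ^ 2 / ((1 - z) * a6 * a7) * (a4 ^ 2 / (a8 * a9)) +
      q * a2 ^ 2 / a5 / q * g) := by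
    rw [hm]; field_simp; ring
  have ha3 : a3⁻¹ = a2 * a5 / a4 ^ 2 := by
    rw [← hK]; field_simp
  rw [hs, ha3]
  field_simp
  ring

/-- theta series -/
noncomputable def thV (z q : ℂ) : ℂ := ∑' k : ℤ, q ^ tri k * z ^ k

lemma thV_summable {z q : ℂ} (hq0 : q ≠ 0) (hq : ‖q‖ < 1) (hz : z ≠ 0) :
    Summable (fun k : ℤ => q ^ tri k * z ^ k) := by
  refine Summable.of_norm ((summable_tri_z hq0 hq hz).congr fun k => ?_)
  rw [norm_mul, norm_zpow, norm_zpow]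

lemma thV_eq {z q : ℂ} (hq0 : q ≠ 0) (hq : ‖q‖ < 1) (hz : z ≠ 0) :
    thV z q = qp q q * qp (-z * q) q * qp (-z⁻¹) q := by
  have h := jtp hq0 hq (neg_ne_zero.2 hz)
  rw [inv_neg] at h
  rw [← h, thV]
  congr 1; ext k
  rw [al, neg_q_zpow z]
  have e2 : ((-1 : ℂ)) ^ k * (-1) ^ k = 1 := by
    rw [← mul_zpow]; simp
  linear_combination -(q ^ tri k * z ^ k) * e2

/-- Jacobi theta function -/
noncomputable def th3 (q : ℂ) : ℂ := ∑' k : ℤ, q ^ (k ^ 2)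

lemma th3_term {q : ℂ} (hq0 : q ≠ 0) (k : ℤ) : al (q ^ 2) k * (-q⁻¹) ^ k = q ^ (k ^ 2) := by
  have e2 : ((-1 : ℂ)) ^ k * (-1) ^ k = 1 := by
    rw [← mul_zpow]; simp
  rw [al, neg_q_zpow q⁻¹, inv_zpow, ← zpow_neg, ← zpow_ofNat q 2, ← zpow_mul]
  have : q ^ (k ^ 2) = q ^ (2 * tri k) * q ^ (-k) := by
    rw [← zpow_add₀ hq0]; congr 1
    have := two_tri k
    linarith
  rw [this]
  linear_combination (q ^ (2 * tri k) * q ^ (-k)) * e2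

lemma th3_summable {q : ℂ} (hq0 : q ≠ 0) (hq : ‖q‖ < 1) : Summable (fun k : ℤ => q ^ (k ^ 2)) := by
  have := summable_al (pow_ne_zero 2 hq0) (norm_sq_lt hq) (neg_ne_zero.2 (inv_ne_zero hq0))
    (fun _ => 1) (C := 1) (by simp)
  refine this.congr fun k => ?_
  rw [mul_one, th3_term hq0]

lemma th3_eq {q : ℂ} (hq0 : q ≠ 0) (hq : ‖q‖ < 1) :
    th3 q = qp (q ^ 2) (q ^ 2) * qp (-q) (q ^ 2) ^ 2 := by
  have h := jtp (pow_ne_zero 2 hq0) (norm_sq_lt hq) (neg_ne_zero.2 (inv_ne_zero hq0))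
  simp only [th3_term hq0] at h
  rw [th3, h, show -q⁻¹ * q ^ 2 = -q by field_simp, inv_neg, inv_inv]
  ring

lemma sq_pow2 (q : ℂ) : (q ^ 2) ^ 2 = q ^ 4 := by ring

/-- crank at `z` with `z^4 = -1` -/
lemma Cf_zeta {z q : ℂ} (hq0 : q ≠ 0) (hq : ‖q‖ < 1) (hz : z ^ 4 = -1) :
    Cf z q * qp (-q ^ 4) (q ^ 4) * (1 + z⁻¹) = thV z q := by
  have hz0 : z ≠ 0 := by rintro rfl; norm_num at hz
  have hzn : ‖z‖ = 1 := by
    have := congrArg norm hz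
    rw [norm_pow, norm_neg, norm_one] at this
    exact (pow_eq_one_iff_of_nonneg (norm_nonneg _) (by norm_num)).1 this
  rw [thV_eq hq0 hq hz0, qp_succ (-z⁻¹) hq, Cf]
  have h1 := qp_sq (z * q) hq
  have h2 := qp_sq (q * z⁻¹) hq
  have h3 := qp_sq (z ^ 2 * q ^ 2) (norm_sq_lt hq)
  have hzi : (z⁻¹) ^ 2 = - z ^ 2 := by
    field_simp; rw [hz]; ring
  have e1 : (q * z⁻¹) ^ 2 = -(z ^ 2 * q ^ 2) := by rw [mul_pow, hzi]; ring
  rw [e1] at h2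
  rw [mul_pow] at h1
  rw [← h1, ← h2, sq_pow2, mul_pow, sq_pow2, sq_pow2, hz] at h3
  rw [show (-1 : ℂ) * q ^ 4 = -q ^ 4 by ring] at h3
  rw [← h3]
  have n6 : qp (z * q) q ≠ 0 := qp_ne_zero_of_lt hq (by rw [norm_mul, hzn]; simpa using hq)
  have n7 : qp (q * z⁻¹) q ≠ 0 :=
    qp_ne_zero_of_lt hq (by rw [norm_mul, norm_inv, hzn]; simpa using hq)
  rw [show -z * q = -(z * q) by ring, show -z⁻¹ * q = -(q * z⁻¹) by ring]
  generalize qp (q * z⁻¹) q = a at *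
  generalize qp (z * q) q = b at *
  generalize qp (-(q * z⁻¹)) q = c at *
  generalize qp (-(z * q)) q = d at *
  rw [sub_neg_eq_add]
  field_simp

lemma Tf_zeta {z q : ℂ} (hq0 : q ≠ 0) (hq : ‖q‖ < 1) (hz : z ^ 4 = -1) :
    Tf z q * (1 + z⁻¹) * qp (q ^ 4) (q ^ 4) = thV z q * th3 q := by
  have hz0 : z ≠ 0 := by rintro rfl; norm_num at hz
  rw [← Cf_zeta hq0 hq hz, th3_eq hq0 hq, Tf]
  have hzi : (z⁻¹) ^ 2 = - z ^ 2 := by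
    field_simp; rw [hz]; ring
  have h3 := qp_sq (z ^ 2 * q) (norm_sq_lt hq)
  rw [mul_pow, sq_pow2, sq_pow2, hz, show (-1 : ℂ) * q ^ 2 = -q ^ 2 by ring] at h3
  rw [hzi, neg_neg, show -z ^ 2 * q = -(z ^ 2 * q) by ring, mul_comm (qp (-(z ^ 2 * q)) _), h3]
  have h4 := qp_even_odd (-q ^ 2) (norm_sq_lt hq)
  rw [show -q ^ 2 * q ^ 2 = - q ^ 4 by ring, sq_pow2] at h4
  have h5 := euler_prod (norm_sq_lt hq)
  rw [sq_pow2, h4] at h5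
  have h6 := qp_even_odd (q ^ 2) (norm_sq_lt hq)
  rw [← sq, sq_pow2] at h6
  rw [h6]
  have n1 : qp (-q ^ 2) (q ^ 4) ≠ 0 := by
    intro h; rw [h] at h5; norm_num at h5
  generalize qp (-q ^ 2) (q ^ 4) = a at *
  field_simp
  linear_combination (-(Cf z q * qp (-q) (q ^ 2) ^ 2 * (z + 1) * qp (q ^ 4) (q ^ 4))) * h5

lemma I_inv_mul (q : ℂ) : q * Complex.I⁻¹ = -(Complex.I * q) := by
  rw [Complex.inv_I]; ring

/-- the theta quotient at `±i` -/
lemma Tf_I {z q : ℂ} (hq : ‖q‖ < 1) (hz : z ^ 2 = -1) :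
    Tf z q = qp (q ^ 2) (q ^ 2) * qp (-q) (q ^ 2) ^ 3 := by
  have hz0 : z ≠ 0 := by rintro rfl; norm_num at hz
  have hzi : z⁻¹ = -z := by
    field_simp; rw [hz]; ring
  have h1 := qp_sq (z * q) hq
  rw [mul_pow, hz, show (-1 : ℂ) * q ^ 2 = -q ^ 2 by ring] at h1
  rw [Tf, Cf, hzi, show q * -z = -(z * q) by ring, h1, neg_sq, hz, neg_neg, one_mul]
  have h2 := euler_prod hq
  have h3 := qp_even_odd (-q) hq
  have h4 := qp_even_odd q hq
  rw [show -q * q = - q ^ 2 by ring] at h3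
  rw [← sq] at h4
  rw [h3] at h2
  rw [h4]
  have n1 : qp q (q ^ 2) ≠ 0 := right_ne_zero_of_mul (h2 ▸ one_ne_zero)
  have n2 : qp (-q ^ 2) (q ^ 2) ≠ 0 :=
    right_ne_zero_of_mul (left_ne_zero_of_mul (h2 ▸ one_ne_zero))
  field_simp
  linear_combination (-(qp (q ^ 2) (q ^ 2) * qp (-q) (q ^ 2) ^ 2)) * h2

lemma Cf_neg_one {q : ℂ} (hq : ‖q‖ < 1) :
    Cf (-1) q = qp (q ^ 2) (q ^ 2) * qp q (q ^ 2) ^ 3 := by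
  have h2 := euler_prod hq
  have h4 := qp_even_odd q hq
  rw [← sq] at h4
  rw [Cf, inv_neg, inv_one, show q * -1 = -q by ring, show -1 * q = -q by ring, h4]
  have n1 : qp (-q) q ≠ 0 := left_ne_zero_of_mul (h2 ▸ one_ne_zero)
  have : qp q (q ^ 2) = (qp (-q) q)⁻¹ := eq_inv_of_mul_eq_one_right h2
  rw [this]
  field_simp

lemma Tf_I_theta {z q : ℂ} (hq0 : q ≠ 0) (hq : ‖q‖ < 1) (hz : z ^ 2 = -1) :
    2 * Tf z q * qp (q ^ 4) (q ^ 4) = thV 1 q * th3 q := by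
  rw [Tf_I hq hz, th3_eq hq0 hq, thV_eq hq0 hq one_ne_zero, inv_one, qp_succ (-1) hq]
  have h1 := qp_sq q hq
  have h3 := qp_even_odd (-q) hq
  have h4 := qp_sq (q ^ 2) (norm_sq_lt hq)
  rw [sq_pow2] at h4
  rw [show -q * q = - q ^ 2 by ring] at h3
  rw [show (-1 : ℂ) * q = -q by ring, ← h4]
  have : qp q q * qp (-q) q * ((1 - -1) * qp (-q) q) = 2 * qp (q ^ 2) (q ^ 2) *
    (qp (-q) (q ^ 2) * qp (-q ^ 2) (q ^ 2)) := by rw [← h3, ← h1]; ring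
  rw [this]
  ring

/-! ### Rotation identities -/

lemma tri_mod (m r : ℤ) : tri (8 * m + r) = 4 * (8 * m ^ 2 + 2 * m * r + m) + tri r := by
  have h1 := two_tri (8 * m + r)
  have h2 := two_tri r
  have : 2 * tri (8 * m + r) = 2 * (4 * (8 * m ^ 2 + 2 * m * r + m) + tri r) := by
    linear_combination h1 - h2
  omega

lemma zpow_per {z : ℂ} {d : ℤ} (hz0 : z ≠ 0) (hz : z ^ d = 1) (m r : ℤ) : z ^ (d * m + r) = z ^ r := by
  rw [zpow_add₀ hz0, zpow_mul, hz, one_zpow, one_mul]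

lemma mod8 (k : ℤ) : ∃ m r : ℤ, 0 ≤ r ∧ r < 8 ∧ k = 8 * m + r :=
  ⟨k / 8, k % 8, by omega, by omega, by omega⟩

lemma tri_refl (k : ℤ) : tri (-1 - k) = tri k := by
  have h1 := two_tri (-1 - k)
  have h2 := two_tri k
  have : (-1 - k) * (-1 - k + 1) = k * (k + 1) := by ring
  omega

lemma th_zero {q : ℂ} (c : ℤ → ℂ)
    (hc : ∀ k, c k + c (-1 - k) = 0) : ∑' k : ℤ, q ^ tri k * c k = 0 := by
  apply tsum_antisymm _ (-1)
  intro k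
  rw [tri_refl]
  linear_combination q ^ tri k * hc k

lemma thV_hasSum_rot {q z u : ℂ} (hq0 : q ≠ 0) (hq : ‖q‖ < 1) (hz : z ≠ 0) (hu : ‖u‖ = 1) :
    HasSum (fun k : ℤ => q ^ tri k * (u ^ tri k * z ^ k)) (thV z (u * q)) := by
  have hu0 : u ≠ 0 := by rintro rfl; simp at hu
  have h := (thV_summable (q := u * q) (mul_ne_zero hu0 hq0)
    (by rw [norm_mul, hu, one_mul]; exact hq) hz).hasSum
  have e : (fun k : ℤ => q ^ tri k * (u ^ tri k * z ^ k)) = fun k : ℤ => (u * q) ^ tri k * z ^ k := by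
    funext k; rw [mul_zpow]; ring
  rw [e]; exact h

/-- the theta combination occurring in the rank differences -/
noncomputable def Yf (ζ q : ℂ) : ℂ := thV 1 q - (1 + ζ - ζ ^ 2 + ζ ^ 3) / 2 * thV ζ q
  - (1 - ζ - ζ ^ 2 - ζ ^ 3) / 2 * thV (-ζ) q

/-- the theta combination occurring in the crank differences -/
noncomputable def Df (ζ q : ℂ) : ℂ := (1 + ζ - ζ ^ 2 + ζ ^ 3) / 2 * thV ζ q
  - (1 - ζ - ζ ^ 2 - ζ ^ 3) / 2 * thV (-ζ) q

lemma zeta8 {ζ : ℂ} (h : ζ ^ 4 = -1) : ζ ^ (8 : ℤ) = 1 := by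
  rw [zpow_ofNat ζ 8]; linear_combination (ζ ^ 4 - 1) * h

lemma u4 {u : ℂ} (h : u ^ 4 = 1) (m r : ℤ) : u ^ tri (8 * m + r) = u ^ tri r := by
  have hu0 : u ≠ 0 := by rintro rfl; norm_num at h
  rw [tri_mod, zpow_per hu0 (by rw [zpow_ofNat u 4]; exact h)]

lemma zpow_refl8 {z : ℂ} (hz0 : z ≠ 0) (hz : z ^ (8 : ℤ) = 1) (m r : ℤ) :
    z ^ (-1 - (8 * m + r)) = z ^ (7 - r) := by
  rw [show -1 - (8 * m + r) = 8 * (-m - 1) + (7 - r) by ring, zpow_per hz0 hz]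

lemma Yf_coeff {ζ : ℂ} (h : ζ ^ 4 = -1) (k : ℤ) :
    ((ζ ^ 2) ^ tri k - (ζ ^ 2 - 1) / 2 + (1 + ζ ^ 2) / 2 * (-1) ^ tri k) *
    ((1 - (1 + ζ - ζ ^ 2 + ζ ^ 3) / 2 * ζ ^ k - (1 - ζ - ζ ^ 2 - ζ ^ 3) / 2 * (-ζ) ^ k) +
    (1 - (1 + ζ - ζ ^ 2 + ζ ^ 3) / 2 * ζ ^ (-1 - k) -
      (1 - ζ - ζ ^ 2 - ζ ^ 3) / 2 * (-ζ) ^ (-1 - k))) = 0 := by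
  have hz0 : ζ ≠ 0 := by rintro rfl; norm_num at h
  obtain ⟨m, r, h0, h8, rfl⟩ := mod8 k
  have hm : (-ζ) ^ 4 = -1 := by rw [← h]; ring
  rw [u4 (by linear_combination (ζ ^ 4 - 1) * h), u4 (by norm_num), zpow_per hz0 (zeta8 h),
    zpow_per (neg_ne_zero.2 hz0) (zeta8 hm), zpow_refl8 hz0 (zeta8 h),
    zpow_refl8 (neg_ne_zero.2 hz0) (zeta8 hm)]
  have h5 : ζ ^ 5 = -ζ := by linear_combination ζ * h
  have h6 : ζ ^ 6 = -ζ ^ 2 := by linear_combination ζ ^ 2 * h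
  have h7 : ζ ^ 7 = -ζ ^ 3 := by linear_combination ζ ^ 3 * h
  interval_cases r <;> norm_num [tri, zpow_ofNat] <;> (try simp only [h5, h6, h7, h]) <;> grind

lemma Df_coeff {ζ : ℂ} (h : ζ ^ 4 = -1) (k : ℤ) :
    (1 + (-1) ^ tri k) *
    (((1 + ζ - ζ ^ 2 + ζ ^ 3) / 2 * ζ ^ k - (1 - ζ - ζ ^ 2 - ζ ^ 3) / 2 * (-ζ) ^ k) +
    ((1 + ζ - ζ ^ 2 + ζ ^ 3) / 2 * ζ ^ (-1 - k) -
      (1 - ζ - ζ ^ 2 - ζ ^ 3) / 2 * (-ζ) ^ (-1 - k))) = 0 := by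
  have hz0 : ζ ≠ 0 := by rintro rfl; norm_num at h
  obtain ⟨m, r, h0, h8, rfl⟩ := mod8 k
  have hm : (-ζ) ^ 4 = -1 := by rw [← h]; ring
  rw [u4 (by norm_num), zpow_per hz0 (zeta8 h),
    zpow_per (neg_ne_zero.2 hz0) (zeta8 hm), zpow_refl8 hz0 (zeta8 h),
    zpow_refl8 (neg_ne_zero.2 hz0) (zeta8 hm)]
  have h5 : ζ ^ 5 = -ζ := by linear_combination ζ * h
  have h6 : ζ ^ 6 = -ζ ^ 2 := by linear_combination ζ ^ 2 * h
  have h7 : ζ ^ 7 = -ζ ^ 3 := by linear_combination ζ ^ 3 * h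
  interval_cases r <;> norm_num [tri, zpow_ofNat] <;> (try simp only [h5, h6, h7, h]) <;> grind

lemma zeta_norm {z : ℂ} (hz : z ^ 4 = -1) : ‖z‖ = 1 := by
  have := congrArg norm hz
  rw [norm_pow, norm_neg, norm_one] at this
  exact (pow_eq_one_iff_of_nonneg (norm_nonneg _) (by norm_num)).1 this

lemma Yf_rot {ζ q : ℂ} (hq0 : q ≠ 0) (hq : ‖q‖ < 1) (h : ζ ^ 4 = -1) :
    Yf ζ (ζ ^ 2 * q) = (ζ ^ 2 - 1) / 2 * Yf ζ q - (1 + ζ ^ 2) / 2 * Yf ζ (-1 * q) := by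
  have hz0 : ζ ≠ 0 := by rintro rfl; norm_num at h
  have hu : ‖ζ ^ 2‖ = 1 := by rw [norm_pow, zeta_norm h, one_pow]
  have hY : ∀ u : ℂ, ‖u‖ = 1 → HasSum (fun k : ℤ => q ^ tri k * (u ^ tri k *
    (1 - (1 + ζ - ζ ^ 2 + ζ ^ 3) / 2 * ζ ^ k - (1 - ζ - ζ ^ 2 - ζ ^ 3) / 2 * (-ζ) ^ k)))
      (Yf ζ (u * q)) := by
    intro u hu
    have := ((thV_hasSum_rot hq0 hq one_ne_zero hu).sub
      ((thV_hasSum_rot hq0 hq hz0 hu).mul_left ((1 + ζ - ζ ^ 2 + ζ ^ 3) / 2))).sub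
      ((thV_hasSum_rot hq0 hq (neg_ne_zero.2 hz0) hu).mul_left ((1 - ζ - ζ ^ 2 - ζ ^ 3) / 2))
    refine Eq.mp (congrArg (fun f => HasSum f _) ?_) this
    funext k; rw [one_zpow]; ring
  have h1 := ((hY (ζ ^ 2) hu).sub ((hY 1 (by simp)).mul_left ((ζ ^ 2 - 1) / 2))).add
    ((hY (-1) (by simp)).mul_left ((1 + ζ ^ 2) / 2))
  have h2 := h1.tsum_eq
  have h3 := th_zero (q := q) (fun k => ((ζ ^ 2) ^ tri k - (ζ ^ 2 - 1) / 2 + (1 + ζ ^ 2) / 2 * (-1) ^ tri k) *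
    (1 - (1 + ζ - ζ ^ 2 + ζ ^ 3) / 2 * ζ ^ k - (1 - ζ - ζ ^ 2 - ζ ^ 3) / 2 * (-ζ) ^ k)) (by
      intro k
      rw [tri_refl, ← mul_add]
      exact Yf_coeff h k)
  have h4 : Yf ζ (ζ ^ 2 * q) - (ζ ^ 2 - 1) / 2 * Yf ζ (1 * q) + (1 + ζ ^ 2) / 2 * Yf ζ (-1 * q) = 0 := by
    rw [← h2, ← h3]
    congr 1
    funext k; rw [one_zpow]; ring
  rw [one_mul] at h4
  linear_combination h4

lemma Df_rot {ζ q : ℂ} (hq0 : q ≠ 0) (hq : ‖q‖ < 1) (h : ζ ^ 4 = -1) :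
    Df ζ (-1 * q) = - Df ζ q := by
  have hz0 : ζ ≠ 0 := by rintro rfl; norm_num at h
  have hY : ∀ u : ℂ, ‖u‖ = 1 → HasSum (fun k : ℤ => q ^ tri k * (u ^ tri k *
    ((1 + ζ - ζ ^ 2 + ζ ^ 3) / 2 * ζ ^ k - (1 - ζ - ζ ^ 2 - ζ ^ 3) / 2 * (-ζ) ^ k)))
      (Df ζ (u * q)) := by
    intro u hu
    have := ((thV_hasSum_rot hq0 hq hz0 hu).mul_left ((1 + ζ - ζ ^ 2 + ζ ^ 3) / 2)).sub
      ((thV_hasSum_rot hq0 hq (neg_ne_zero.2 hz0) hu).mul_left ((1 - ζ - ζ ^ 2 - ζ ^ 3) / 2))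
    refine Eq.mp (congrArg (fun f => HasSum f _) ?_) this
    funext k; ring
  have h1 := ((hY 1 (by simp)).add (hY (-1) (by simp)))
  have h2 := h1.tsum_eq
  have h3 := th_zero (q := q) (fun k => (1 + (-1) ^ tri k) *
    ((1 + ζ - ζ ^ 2 + ζ ^ 3) / 2 * ζ ^ k - (1 - ζ - ζ ^ 2 - ζ ^ 3) / 2 * (-ζ) ^ k)) (by
      intro k
      rw [tri_refl, ← mul_add]
      exact Df_coeff h k)
  have h4 : Df ζ (1 * q) + Df ζ (-1 * q) = 0 := by
    rw [← h2, ← h3]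
    congr 1
    funext k; rw [one_zpow]; ring
  rw [one_mul] at h4
  linear_combination h4

lemma th3_rot {u q : ℂ} (hq0 : q ≠ 0) (hq : ‖q‖ < 1) (hu : u ^ 2 = -1) :
    th3 (u * q) = (1 + u) / 2 * th3 q + (1 - u) / 2 * th3 (-1 * q) := by
  have hu0 : u ≠ 0 := by rintro rfl; norm_num at hu
  have hneg : ‖-1 * q‖ < 1 := by simpa using hq
  have hneg0 : -1 * q ≠ 0 := by simpa using hq0
  rw [th3, th3, th3, ← tsum_mul_left, ← tsum_mul_left,
    ← ((th3_summable hq0 hq).mul_left _).tsum_add ((th3_summable hneg0 hneg).mul_left _)]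
  congr 1
  funext k
  rw [mul_zpow, mul_zpow]
  have h4 : u ^ (4 : ℤ) = 1 := by rw [zpow_ofNat u 4]; linear_combination (u ^ 2 - 1) * hu
  have h2 : (-1 : ℂ) ^ (4 : ℤ) = 1 := by norm_num
  rcases Int.even_or_odd' k with ⟨m, rfl | rfl⟩
  · rw [show (2 * m) ^ 2 = 4 * m ^ 2 + 0 by ring, zpow_per hu0 h4, zpow_per (by norm_num) h2]
    simp; ring
  · rw [show (2 * m + 1) ^ 2 = 4 * (m ^ 2 + m) + 1 by ring, zpow_per hu0 h4,
      zpow_per (by norm_num) h2]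
    simp; ring

/-- sum over the four rotations of the variable -/
noncomputable def sec (f : ℂ → ℂ) (u q : ℂ) : ℂ := f q + f (u * q) + f (-1 * q) + f (u * (-1 * q))

lemma Tf_neg_one {q : ℂ} (hq : ‖q‖ < 1) : Tf (-1) q = Cf (-1) q := by
  have n : qp (-q) (q ^ 2) ≠ 0 := by
    have h := qp_sq q (norm_sq_lt hq)
    have h2 := qp_ne_zero_of_lt (x := q ^ 2) (q := (q ^ 2) ^ 2) (norm_sq_lt (norm_sq_lt hq)) (norm_sq_lt hq)
    exact right_ne_zero_of_mul (h ▸ h2)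
  have e : -(-1 : ℂ) ^ 2 * q = -q := by ring
  have e2 : -((-1 : ℂ)⁻¹) ^ 2 * q = -q := by norm_num
  rw [Tf, e, e2]
  field_simp

lemma Rf_neg_one {q : ℂ} (hq0 : q ≠ 0) (hq : ‖q‖ < 1) :
    Rf (-1) q = 4 * (qp (q ^ 4) (q ^ 4))⁻¹ * (SR 0 (q ^ 4) - SR (-1 * q) (q ^ 4)) + Cf (-1) q := by
  rw [Rf_eq hq0 hq (by simp) (by norm_num), Tf_neg_one hq, Gf]
  have e : -(-1 : ℂ) ^ 2 * q = -1 * q := by ring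
  have e2 : -((-1 : ℂ)⁻¹) ^ 2 * q = -1 * q := by norm_num
  rw [e, e2]
  norm_num
  ring

lemma Rf_I {z q : ℂ} (hq0 : q ≠ 0) (hq : ‖q‖ < 1) (hz : z ^ 2 = -1) :
    Rf z q = 2 * (qp (q ^ 4) (q ^ 4))⁻¹ * (SR 0 (q ^ 4) - SR q (q ^ 4)) + Tf z q := by
  have hz0 : z ≠ 0 := by rintro rfl; norm_num at hz
  have hzi : z⁻¹ = -z := by
    field_simp; rw [hz]; ring
  have hzn : ‖z‖ = 1 := by
    have := congrArg norm hz
    rw [norm_pow, norm_neg, norm_one] at this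
    exact (pow_eq_one_iff_of_nonneg (norm_nonneg _) (by norm_num)).1 this
  rw [Rf_eq hq0 hq hzn (by rintro rfl; norm_num at hz), Gf, hzi, neg_sq, hz, neg_neg, one_mul]
  linear_combination (qp (q ^ 4) (q ^ 4))⁻¹ * (SR q (q ^ 4) - SR 0 (q ^ 4)) * hz

lemma Rf_zeta {z q : ℂ} (hq0 : q ≠ 0) (hq : ‖q‖ < 1) (hz : z ^ 4 = -1) :
    Rf z q + Rf (-z) q = (qp (q ^ 4) (q ^ 4))⁻¹ * (4 * SR 0 (q ^ 4) - 2 * SR (z ^ 2 * q) (q ^ 4)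
      - 2 * SR (z ^ 2 * (-1 * q)) (q ^ 4)) + Tf z q + Tf (-z) q := by
  have hz0 : z ≠ 0 := by rintro rfl; norm_num at hz
  have hzn := zeta_norm hz
  have hzi : (z⁻¹) ^ 2 = - z ^ 2 := by
    field_simp; rw [hz]; ring
  rw [Rf_eq hq0 hq hzn (by rintro rfl; norm_num at hz),
    Rf_eq hq0 hq (z := -z) (by rw [norm_neg, hzn]) (by
      intro h; have : (-z) ^ 4 = 1 := by rw [h]; norm_num
      rw [neg_pow, hz] at this; norm_num at this), Gf, Gf, inv_neg, neg_sq, neg_sq, hzi, neg_neg,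
      show -z ^ 2 * q = z ^ 2 * (-1 * q) by ring]
  field_simp
  ring

lemma rot4 {u q : ℂ} (hu : u ^ 2 = -1) : (u * q) ^ 4 = q ^ 4 := by
  rw [mul_pow]; linear_combination q ^ 4 * (u ^ 2 - 1) * hu

lemma neg4 (q : ℂ) : (-1 * q) ^ 4 = q ^ 4 := by ring

lemma rot_rot {u : ℂ} (q : ℂ) (hu : u ^ 2 = -1) : u * (u * q) = -1 * q := by
  linear_combination q * hu

lemma neg_neg1 (q : ℂ) : -1 * (-1 * q) = q := by ring

lemma neg_rot (u q : ℂ) : -1 * (u * q) = u * (-1 * q) := by ring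

lemma w1_inv {ζ : ℂ} (h : ζ ^ 4 = -1) : (1 + ζ - ζ ^ 2 + ζ ^ 3) / 2 * (1 + ζ⁻¹) = 1 := by
  have hz0 : ζ ≠ 0 := by rintro rfl; norm_num at h
  field_simp; linear_combination h

lemma w2_inv {ζ : ℂ} (h : ζ ^ 4 = -1) : (1 - ζ - ζ ^ 2 - ζ ^ 3) / 2 * (1 + (-ζ)⁻¹) = 1 := by
  have hz0 : ζ ≠ 0 := by rintro rfl; norm_num at h
  rw [inv_neg]
  field_simp; linear_combination -h

lemma T_comb {ζ q : ℂ} (hq0 : q ≠ 0) (hq : ‖q‖ < 1) (h : ζ ^ 4 = -1) :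
    2 * Tf (ζ ^ 2) q - Tf ζ q - Tf (-ζ) q = th3 q * Yf ζ q * (qp (q ^ 4) (q ^ 4))⁻¹ := by
  have n : qp (q ^ 4) (q ^ 4) ≠ 0 := qp_ne_zero_of_lt (norm_pow4_lt hq) (norm_pow4_lt hq)
  have hm : (-ζ) ^ 4 = -1 := by rw [← h]; ring
  have h1 := Tf_I_theta hq0 hq (z := ζ ^ 2) (by rw [← h]; ring)
  have h2 := Tf_zeta hq0 hq h
  have h3 := Tf_zeta hq0 hq hm
  have w1 := w1_inv h
  have w2 := w2_inv h
  rw [eq_mul_inv_iff_mul_eq₀ n, Yf]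
  linear_combination h1 - (1 + ζ - ζ ^ 2 + ζ ^ 3) / 2 * h2 - (1 - ζ - ζ ^ 2 - ζ ^ 3) / 2 * h3
    + Tf ζ q * qp (q ^ 4) (q ^ 4) * w1 + Tf (-ζ) q * qp (q ^ 4) (q ^ 4) * w2

lemma C_comb {ζ q : ℂ} (hq0 : q ≠ 0) (hq : ‖q‖ < 1) (h : ζ ^ 4 = -1) :
    Cf ζ q - Cf (-ζ) q = Df ζ q * (qp (-q ^ 4) (q ^ 4))⁻¹ := by
  have n : qp (-q ^ 4) (q ^ 4) ≠ 0 :=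
    qp_ne_zero_of_lt (norm_pow4_lt hq) (by rw [norm_neg]; exact norm_pow4_lt hq)
  have hm : (-ζ) ^ 4 = -1 := by rw [← h]; ring
  have h2 := Cf_zeta hq0 hq h
  have h3 := Cf_zeta hq0 hq hm
  have w1 := w1_inv h
  have w2 := w2_inv h
  rw [eq_mul_inv_iff_mul_eq₀ n, Df]
  linear_combination (1 + ζ - ζ ^ 2 + ζ ^ 3) / 2 * h2 - (1 - ζ - ζ ^ 2 - ζ ^ 3) / 2 * h3
    - Cf ζ q * qp (-q ^ 4) (q ^ 4) * w1 + Cf (-ζ) q * qp (-q ^ 4) (q ^ 4) * w2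

lemma u_norm {u : ℂ} (hu : u ^ 2 = -1) : ‖u‖ = 1 := by
  have := congrArg norm hu
  rw [norm_pow, norm_neg, norm_one] at this
  exact (pow_eq_one_iff_of_nonneg (norm_nonneg _) (by norm_num)).1 this

lemma Tf_I_neg {z q : ℂ} (hq : ‖q‖ < 1) (hz : z ^ 2 = -1) : Tf (-z) q = Tf z q := by
  rw [Tf_I hq (by rw [neg_sq, hz]), Tf_I hq hz]

lemma F1 {ζ q : ℂ} (hq0 : q ≠ 0) (hq : ‖q‖ < 1) (h : ζ ^ 4 = -1) :
    sec (fun q => Rf (ζ ^ 2) q + Rf (-ζ ^ 2) q - Rf ζ q - Rf (-ζ) q) (ζ ^ 2) q = 0 := by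
  have hu : (ζ ^ 2) ^ 2 = -1 := by rw [← h]; ring
  have hu' : (-ζ ^ 2) ^ 2 = -1 := by rw [← h]; ring
  have step : ∀ q : ℂ, q ≠ 0 → ‖q‖ < 1 → Rf (ζ ^ 2) q + Rf (-ζ ^ 2) q - Rf ζ q - Rf (-ζ) q =
    (qp (q ^ 4) (q ^ 4))⁻¹ * (-4 * SR q (q ^ 4) + 2 * SR (ζ ^ 2 * q) (q ^ 4)
      + 2 * SR (ζ ^ 2 * (-1 * q)) (q ^ 4) + th3 q * Yf ζ q) := by
    intro q hq0 hq
    have h1 := T_comb hq0 hq h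
    have h2 := Rf_zeta hq0 hq h
    rw [Rf_I hq0 hq hu, Rf_I hq0 hq hu', Tf_I_neg hq hu]
    linear_combination h1 - h2
  have hun := u_norm hu
  have hu0 : ζ ^ 2 ≠ 0 := by intro h; rw [h] at hun; simp at hun
  have hn : ‖-1 * q‖ < 1 := by simpa using hq
  have hn0 : -1 * q ≠ 0 := by simpa using hq0
  have s1 := step q hq0 hq
  have s2 := step (ζ ^ 2 * q) (mul_ne_zero hu0 hq0) (by rw [norm_mul, hun, one_mul]; exact hq)
  have s3 := step (-1 * q) hn0 hn
  have s4 := step (ζ ^ 2 * (-1 * q)) (mul_ne_zero hu0 hn0) (by rw [norm_mul, hun, one_mul]; exact hn)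
  have y1 := Yf_rot hq0 hq h
  have y2 := Yf_rot hn0 hn h
  have x1 := th3_rot hq0 hq hu
  have x2 := th3_rot hn0 hn hu
  rw [rot4 hu, rot_rot q hu, neg_rot, rot_rot _ hu, neg_neg1, x1, y1] at s2
  rw [neg4, neg_neg1] at s3
  rw [rot4 hu, neg4, rot_rot _ hu, neg_neg1, neg_rot, neg_neg1, rot_rot _ hu] at s4
  rw [neg_neg1] at x2 y2
  rw [x2, y2] at s4
  simp only [sec]
  rw [s1, s2, s3, s4]
  generalize ζ ^ 2 = u at *
  generalize th3 q = X
  generalize th3 (-1 * q) = X'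
  generalize Yf ζ q = Y
  generalize Yf ζ (-1 * q) = Y'
  linear_combination (qp (q ^ 4) (q ^ 4))⁻¹ * (X * Y + X' * Y' - X * Y' - X' * Y) / 2 * hu

lemma F2 {u q : ℂ} (hq0 : q ≠ 0) (hq : ‖q‖ < 1) (hu : u ^ 2 = -1) :
    sec (fun q => Rf (-1) q - Rf u q - Rf (-u) q + Cf (-1) q) u q = 0 := by
  have hu' : (-u) ^ 2 = -1 := by rw [neg_sq, hu]
  have tc : ∀ q : ℂ, ‖q‖ < 1 → Cf (-1) q = Tf u (-1 * q) := by
    intro q hq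
    rw [Cf_neg_one hq, Tf_I (by simpa using hq) hu]
    rw [show (-1 * q) ^ 2 = q ^ 2 by ring, show -(-1 * q) = q by ring]
  have step : ∀ q : ℂ, q ≠ 0 → ‖q‖ < 1 → Rf (-1) q - Rf u q - Rf (-u) q + Cf (-1) q =
    (qp (q ^ 4) (q ^ 4))⁻¹ * (4 * SR q (q ^ 4) - 4 * SR (-1 * q) (q ^ 4))
      + 2 * Tf u (-1 * q) - 2 * Tf u q := by
    intro q hq0 hq
    rw [Rf_I hq0 hq hu, Rf_I hq0 hq hu', Tf_I_neg hq hu, Rf_neg_one hq0 hq, tc q hq]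
    ring
  have hun := u_norm hu
  have hu0 : u ≠ 0 := by intro h; rw [h] at hun; simp at hun
  have hn : ‖-1 * q‖ < 1 := by simpa using hq
  have hn0 : -1 * q ≠ 0 := by simpa using hq0
  have s1 := step q hq0 hq
  have s2 := step (u * q) (mul_ne_zero hu0 hq0) (by rw [norm_mul, hun, one_mul]; exact hq)
  have s3 := step (-1 * q) hn0 hn
  have s4 := step (u * (-1 * q)) (mul_ne_zero hu0 hn0) (by rw [norm_mul, hun, one_mul]; exact hn)
  rw [rot4 hu, neg_rot] at s2
  rw [neg4, neg_neg1] at s3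
  rw [rot4 hu, neg4, neg_rot, neg_neg1] at s4
  simp only [sec]
  rw [s1, s2, s3, s4]
  ring

lemma F3 {ζ q : ℂ} (hq0 : q ≠ 0) (hq : ‖q‖ < 1) (h : ζ ^ 4 = -1) :
    sec (fun q => Cf ζ q - Cf (-ζ) q) (ζ ^ 2) q = 0 := by
  have hu : (ζ ^ 2) ^ 2 = -1 := by rw [← h]; ring
  have hun := u_norm hu
  have hu0 : ζ ^ 2 ≠ 0 := by intro h; rw [h] at hun; simp at hun
  have hn : ‖-1 * q‖ < 1 := by simpa using hq
  have hn0 : -1 * q ≠ 0 := by simpa using hq0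
  have hm : ‖ζ ^ 2 * q‖ < 1 := by rw [norm_mul, hun, one_mul]; exact hq
  have hm0 := mul_ne_zero hu0 hq0
  have d1 := Df_rot hq0 hq h
  have d2 := Df_rot hm0 hm h
  have s1 := C_comb hq0 hq h
  have s2 := C_comb hm0 hm h
  have s3 := C_comb hn0 hn h
  have s4 := C_comb (mul_ne_zero hu0 hn0) (by rw [norm_mul, hun, one_mul]; exact hn) h
  rw [neg_rot] at d2
  rw [rot4 hu] at s2
  rw [neg4] at s3
  rw [rot4 hu, neg4] at s4
  simp only [sec]
  rw [s1, s2, s3, s4, d1, d2]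
  ring

lemma F4 {u q : ℂ} (hu : u ^ 2 = -1) : Cf u q = Cf (-u) q := by
  have hz0 : u ≠ 0 := by rintro rfl; norm_num at hu
  have hzi : u⁻¹ = -u := by
    field_simp; rw [hu]; ring
  rw [Cf, Cf, inv_neg, hzi, neg_neg, mul_comm q, mul_comm q, mul_comm (qp (u * q) q)]

/-! ### Sums over partitions (multisets of positive integers) -/

/-- weight of a multiset -/
noncomputable def wq (q : ℂ) (s : Multiset ℕ) : ℂ := if 0 ∈ s then 0 else q ^ s.sum
/-- real weight of a multiset -/
noncomputable def wr (r : ℝ) (s : Multiset ℕ) : ℝ := if 0 ∈ s then 0 else r ^ s.sum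

lemma norm_wq (q : ℂ) (s : Multiset ℕ) : ‖wq q s‖ = wr ‖q‖ s := by
  unfold wq wr; split_ifs <;> simp

lemma wr_nonneg {r : ℝ} (hr : 0 ≤ r) (s : Multiset ℕ) : 0 ≤ wr r s := by
  unfold wr; split_ifs <;> positivity

/-- all partitions as multisets -/
def ptm (x : Σ n : ℕ, n.Partition) : Multiset ℕ := x.2.parts

lemma ptm_inj : Function.Injective ptm := by
  rintro ⟨n, π⟩ ⟨m, ρ⟩ h
  have h' : π.parts = ρ.parts := h
  have hn : n = m := by rw [← π.parts_sum, ← ρ.parts_sum, h']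
  subst hn
  congr 1
  exact Nat.Partition.ext h'

lemma ptm_range (s : Multiset ℕ) (hs : 0 ∉ s) : s ∈ Set.range ptm :=
  ⟨⟨s.sum, ⟨s, fun {i} hi => Nat.pos_of_ne_zero fun h => hs (h ▸ hi), rfl⟩⟩, rfl⟩

lemma wr_ptm (r : ℝ) (x : Σ n : ℕ, n.Partition) : wr r (ptm x) = r ^ x.1 := by
  have : 0 ∉ x.2.parts := fun h => (x.2.parts_pos h).ne' rfl
  rw [wr, ptm, if_neg this, x.2.parts_sum]

lemma wq_ptm (q : ℂ) (x : Σ n : ℕ, n.Partition) : wq q (ptm x) = q ^ x.1 := by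
  have : 0 ∉ x.2.parts := fun h => (x.2.parts_pos h).ne' rfl
  rw [wq, ptm, if_neg this, x.2.parts_sum]

lemma card_partition_le (n : ℕ) : Fintype.card n.Partition ≤ 2 ^ n := by
  refine (Fintype.card_le_of_surjective _ Nat.Partition.ofComposition_surj).trans ?_
  rw [composition_card]
  exact Nat.pow_le_pow_right (by norm_num) (by omega)

lemma wr_summable {r : ℝ} (h0 : 0 ≤ r) (h1 : r < 1 / 2) : Summable (wr r) := by
  rw [← ptm_inj.summable_iff]
  · rw [summable_sigma_of_nonneg (f := wr r ∘ ptm) (fun x => wr_nonneg h0 _)]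
    refine ⟨fun n => (hasSum_fintype _).summable, ?_⟩
    simp only [Function.comp, wr_ptm, tsum_fintype, Finset.sum_const, nsmul_eq_mul, Finset.card_univ]
    refine Summable.of_nonneg_of_le (fun n => by positivity) (fun n => ?_)
      (summable_geometric_of_lt_one (r := 2 * r) (by linarith) (by linarith))
    rw [mul_pow]
    have := card_partition_le n
    gcongr
    exact_mod_cast this
  · intro s hs
    unfold wr
    rw [if_pos]
    by_contra h
    exact hs (ptm_range s h)

lemma wq_norm_summable {q : ℂ} (hq : ‖q‖ < 1 / 2) : Summable (fun s => ‖wq q s‖) := by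
  simp only [norm_wq]; exact wr_summable (norm_nonneg _) hq

lemma wq_mul_summable {q : ℂ} (hq : ‖q‖ < 1 / 2) (f : Multiset ℕ → ℂ) (hf : ∀ s, ‖f s‖ ≤ 1) :
    Summable (fun s => f s * wq q s) := by
  refine Summable.of_norm_bounded (wq_norm_summable hq) fun s => ?_
  rw [norm_mul]
  exact mul_le_of_le_one_left (norm_nonneg _) (hf s)

/-- the sum over partitions as a power series -/
lemma tsum_wq_eq {q : ℂ} (hq : ‖q‖ < 1 / 2) (f : Multiset ℕ → ℂ) (hf : ∀ s, ‖f s‖ ≤ 1) :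
    HasSum (fun n : ℕ => (∑ π : n.Partition, f π.parts) * q ^ n) (∑' s, f s * wq q s) := by
  have h := (wq_mul_summable hq f hf).hasSum
  rw [← ptm_inj.hasSum_iff] at h
  · have h2 := h.sigma (fun n => hasSum_fintype _)
    refine Eq.mp (congrArg (fun f => HasSum f _) ?_) h2
    funext n
    rw [Finset.sum_mul]
    refine Finset.sum_congr rfl fun π _ => ?_
    simp only [Function.comp]
    rw [wq_ptm]; rfl
  · intro s hs
    unfold wq
    rw [if_pos, mul_zero]
    by_contra h
    exact hs (ptm_range s h)

/-- product weights -/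
noncomputable def pw (g : ℕ → ℂ) (s : Multiset ℕ) : ℂ := (s.map g).prod

/-- the sum of product weights -/
noncomputable def PF (g : ℕ → ℂ) : ℂ := ∑' s, pw g s

lemma pw_eq (w : ℕ → ℂ) (q : ℂ) (s : Multiset ℕ) :
    pw (fun i => if i = 0 then 0 else w i * q ^ i) s = (s.map w).prod * wq q s := by
  induction s using Multiset.induction with
  | empty => simp [pw, wq]
  | cons a s ih =>
    unfold pw wq at *
    rw [Multiset.map_cons, Multiset.prod_cons, ih]
    by_cases ha : a = 0
    · subst ha; simp
    · have : (0 ∈ a ::ₘ s) ↔ 0 ∈ s := by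
        rw [Multiset.mem_cons]; constructor
        · rintro (h | h)
          · exact absurd h.symm ha
          · exact h
        · exact Or.inr
      simp only [this, if_neg ha, Multiset.map_cons, Multiset.prod_cons, Multiset.sum_cons, pow_add]
      split_ifs <;> ring

/-- admissible weights -/
def Adm (r : ℝ) (g : ℕ → ℂ) : Prop := g 0 = 0 ∧ ∀ i, ‖g i‖ ≤ r ^ i

lemma Adm.norm_pw {r : ℝ} {g : ℕ → ℂ} (h : Adm r g) (s : Multiset ℕ) : ‖pw g s‖ ≤ wr r s := by
  induction s using Multiset.induction with
  | empty => simp [pw, wr]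
  | cons a s ih =>
    unfold pw wr at *
    rw [Multiset.map_cons, Multiset.prod_cons, norm_mul]
    by_cases ha : a = 0
    · subst ha; simp [h.1]
    · have : (0 ∈ a ::ₘ s) ↔ 0 ∈ s := by
        rw [Multiset.mem_cons]; constructor
        · rintro (h | h)
          · exact absurd h.symm ha
          · exact h
        · exact Or.inr
      simp only [this, Multiset.sum_cons, pow_add]
      split_ifs with h0
      · rw [if_pos h0] at ih
        have : ‖(s.map g).prod‖ = 0 := le_antisymm ih (norm_nonneg _)
        rw [this, mul_zero]
      · rw [if_neg h0] at ih
        exact mul_le_mul (h.2 a) ih (norm_nonneg _) ((norm_nonneg _).trans (h.2 a))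

lemma Adm.summable {r : ℝ} {g : ℕ → ℂ} (h : Adm r g) (h0 : 0 ≤ r) (h1 : r < 1 / 2) :
    Summable (pw g) :=
  Summable.of_norm_bounded (wr_summable h0 h1) h.norm_pw

lemma pw_update_zero (g : ℕ → ℂ) (i : ℕ) (s : Multiset ℕ) :
    pw (Function.update g i 0) s = if i ∈ s then 0 else pw g s := by
  split_ifs with hi
  · refine Multiset.prod_eq_zero ?_
    rw [Multiset.mem_map]
    exact ⟨i, hi, by simp⟩
  · unfold pw
    congr 1
    refine Multiset.map_congr rfl fun x hx => ?_
    rw [Function.update_of_ne]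
    rintro rfl; exact hi hx

lemma Adm.update {r : ℝ} {g : ℕ → ℂ} (h : Adm r g) (h0 : 0 ≤ r) (i : ℕ) : Adm r (Function.update g i 0) := by
  refine ⟨?_, fun j => ?_⟩ <;> rw [Function.update_apply] <;> split_ifs
  · rfl
  · exact h.1
  · simp; positivity
  · exact h.2 j

lemma PF_step {r : ℝ} {g : ℕ → ℂ} (h : Adm r g) (h0 : 0 ≤ r) (h1 : r < 1 / 2) (i : ℕ) :
    PF g * (1 - g i) = PF (Function.update g i 0) := by
  have hs := h.summable h0 h1
  have hs' := (h.update h0 i).summable h0 h1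
  have inj : Function.Injective (fun s : Multiset ℕ => i ::ₘ s) := fun a b hab =>
    (Multiset.cons_inj_right i).1 hab
  have e : ∑' s, (fun s => if i ∈ s then pw g s else 0) (i ::ₘ s) =
      ∑' s, (fun s => if i ∈ s then pw g s else 0) s := by
    apply inj.tsum_eq (f := fun s => if i ∈ s then pw g s else 0)
    intro s hs
    have : i ∈ s := by
      by_contra h
      exact hs (if_neg h)
    exact ⟨s.erase i, Multiset.cons_erase this⟩
  have e2 : ∑' s, (fun s => if i ∈ s then pw g s else 0) (i ::ₘ s) = g i * PF g := by
    rw [PF, ← tsum_mul_left]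
    congr 1
    funext s
    simp [pw]
  have e3 : PF g - PF (Function.update g i 0) = ∑' s, (fun s => if i ∈ s then pw g s else 0) s := by
    rw [PF, PF, ← hs.tsum_sub hs']
    congr 1
    funext s
    rw [pw_update_zero]
    split_ifs with hh <;> simp [hh]
  rw [← e, e2] at e3
  linear_combination e3

/-- weights with the first parts removed -/
def cutg (g : ℕ → ℂ) (M : ℕ) (i : ℕ) : ℂ := if i < M then 0 else g i

lemma cutg_adm {r : ℝ} {g : ℕ → ℂ} (h : Adm r g) (h0 : 0 ≤ r) (M : ℕ) : Adm r (cutg g M) := by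
  refine ⟨?_, fun j => ?_⟩ <;> rw [cutg] <;> split_ifs
  · rfl
  · exact h.1
  · simp; positivity
  · exact h.2 j

lemma PF_fin {r : ℝ} {g : ℕ → ℂ} (h : Adm r g) (h0 : 0 ≤ r) (h1 : r < 1 / 2) (M : ℕ) :
    PF g * ∏ i ∈ Finset.range M, (1 - g i) = PF (cutg g M) := by
  induction M with
  | zero => simp; congr 1
  | succ M ih =>
    rw [Finset.prod_range_succ, ← mul_assoc, ih]
    have := PF_step (cutg_adm h h0 M) h0 h1 M
    rw [show cutg g M M = g M by simp [cutg]] at this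
    rw [this]
    congr 1
    funext i
    rw [Function.update_apply, cutg, cutg]
    split_ifs <;> first | rfl | omega

lemma PF_cut_tendsto {r : ℝ} {g : ℕ → ℂ} (h : Adm r g) (h0 : 0 ≤ r) (h1 : r < 1 / 2) :
    Tendsto (fun M => PF (cutg g M)) atTop (𝓝 1) := by
  have e : (1 : ℂ) = ∑' s : Multiset ℕ, if s = 0 then (1 : ℂ) else 0 := by
    rw [tsum_ite_eq]
  rw [e]
  refine tendsto_tsum_of_dominated_convergence (wr_summable h0 h1) (fun s => ?_)
    (Eventually.of_forall fun M s => (cutg_adm h h0 M).norm_pw s)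
  by_cases hs : s = 0
  · subst hs; simp [pw]
  · rw [if_neg hs]
    obtain ⟨a, ha⟩ := Multiset.exists_mem_of_ne_zero hs
    refine tendsto_const_nhds.congr' ?_
    filter_upwards [eventually_gt_atTop a] with M hM
    symm
    refine Multiset.prod_eq_zero ?_
    rw [Multiset.mem_map]
    exact ⟨a, ha, by simp [cutg, hM]⟩

/-- the product formula -/
lemma PF_tendsto {r : ℝ} {g : ℕ → ℂ} (h : Adm r g) (h0 : 0 ≤ r) (h1 : r < 1 / 2) :
    Tendsto (fun M => PF g * ∏ i ∈ Finset.range M, (1 - g i)) atTop (𝓝 1) := by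
  simp only [PF_fin h h0 h1]
  exact PF_cut_tendsto h h0 h1

/-! ### The `q`-binomial theorem and the crank generating function -/

/-- finite shifted factorial -/
noncomputable def Pn (x q : ℂ) (n : ℕ) : ℂ := ∏ i ∈ Finset.range n, (1 - x * q ^ i)

lemma Pn_succ (x q : ℂ) (n : ℕ) : Pn x q (n + 1) = Pn x q n * (1 - x * q ^ n) :=
  Finset.prod_range_succ _ _

lemma qp_split (x : ℂ) {q : ℂ} (hq : ‖q‖ < 1) (n : ℕ) : qp x q = Pn x q n * qp (x * q ^ n) q := by
  induction n with
  | zero => simp [Pn]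
  | succ n ih =>
    rw [ih, Pn_succ, qp_succ (x * q ^ n) hq, pow_succ]
    ring_nf

lemma one_sub_ne {x q : ℂ} (hq : ‖q‖ < 1) (hx : ‖x‖ < 1) (n : ℕ) : 1 - x * q ^ n ≠ 0 := by
  intro h
  have h1 : ‖x * q ^ n‖ < 1 := by
    rw [norm_mul, norm_pow]
    calc ‖x‖ * ‖q‖ ^ n ≤ ‖x‖ * 1 := by
          gcongr
          exact pow_le_one₀ (norm_nonneg _) hq.le
      _ < 1 := by simpa using hx
  rw [show x * q ^ n = 1 by linear_combination -h] at h1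
  simp at h1

lemma Pn_ne {x q : ℂ} (hq : ‖q‖ < 1) (hx : ‖x‖ < 1) (n : ℕ) : Pn x q n ≠ 0 :=
  Finset.prod_ne_zero_iff.2 fun i _ => one_sub_ne hq hx i

lemma qbin_bound (a : ℂ) {q : ℂ} (hq : ‖q‖ < 1) : ∃ C, ∀ n, ‖Pn a q n / Pn q q n‖ ≤ C := by
  have := (qp_tendsto a hq).div (qp_tendsto q hq) (qp_ne_zero_of_lt hq hq)
  obtain ⟨C, hC⟩ := (Metric.isBounded_range_of_tendsto _ this).exists_norm_le
  exact ⟨C, fun n => hC _ ⟨n, rfl⟩⟩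

lemma qbin_summable (a : ℂ) {q x : ℂ} (hq : ‖q‖ < 1) (hx : ‖x‖ < 1) :
    Summable (fun n => Pn a q n / Pn q q n * x ^ n) := by
  obtain ⟨C, hC⟩ := qbin_bound a hq
  refine Summable.of_norm_bounded ((summable_geometric_of_lt_one (norm_nonneg _) hx).mul_left C)
    fun n => ?_
  rw [norm_mul, norm_pow]
  have := hC n
  gcongr

lemma qbin_step (a : ℂ) {q x : ℂ} (hq : ‖q‖ < 1) (hx : ‖x‖ < 1) :
    (1 - x) * ∑' n, Pn a q n / Pn q q n * x ^ n =
      (1 - a * x) * ∑' n, Pn a q n / Pn q q n * (x * q) ^ n := by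
  have hxq : ‖x * q‖ < 1 := by
    rw [norm_mul]; nlinarith [norm_nonneg x, norm_nonneg q]
  have s1 := qbin_summable a hq hx
  have s2 := qbin_summable a hq hxq
  have e1 := s1.tsum_eq_zero_add
  have e2 := s2.tsum_eq_zero_add
  have s1' := (summable_nat_add_iff 1).2 s1
  have s2' := (summable_nat_add_iff 1).2 s2
  have e3 : ∑' n, Pn a q (n + 1) / Pn q q (n + 1) * x ^ (n + 1) -
      ∑' n, Pn a q (n + 1) / Pn q q (n + 1) * (x * q) ^ (n + 1) =
      x * (∑' n, Pn a q n / Pn q q n * x ^ n) - a * x * ∑' n, Pn a q n / Pn q q n * (x * q) ^ n := by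
    rw [← s1'.tsum_sub s2', ← tsum_mul_left, ← tsum_mul_left, ← (s1.mul_left _).tsum_sub (s2.mul_left _)]
    congr 1
    funext n
    rw [Pn_succ, Pn_succ]
    have h1 := Pn_ne hq hq n
    have h2 := one_sub_ne hq hq n
    rw [mul_pow, pow_succ, pow_succ]
    generalize hD : 1 - q * q ^ n = D at *
    field_simp
    rw [← hD]
    ring
  simp only [pow_zero] at e1 e2
  linear_combination e1 - e2 + e3

lemma qbin (a : ℂ) {q x : ℂ} (hq : ‖q‖ < 1) (hx : ‖x‖ < 1) :
    ∑' n, Pn a q n / Pn q q n * x ^ n = qp (a * x) q / qp x q := by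
  have hN : ∀ N : ℕ, Pn x q N * ∑' n, Pn a q n / Pn q q n * x ^ n =
      Pn (a * x) q N * ∑' n, Pn a q n / Pn q q n * (x * q ^ N) ^ n := by
    intro N
    induction N with
    | zero => simp [Pn]
    | succ N ih =>
      have hxN : ‖x * q ^ N‖ < 1 := by
        rw [norm_mul, norm_pow]
        calc ‖x‖ * ‖q‖ ^ N ≤ ‖x‖ * 1 := by
              gcongr
              exact pow_le_one₀ (norm_nonneg _) hq.le
          _ < 1 := by simpa using hx
      have := qbin_step a hq hxN
      rw [Pn_succ, Pn_succ, pow_succ, ← mul_assoc x]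
      linear_combination (1 - x * q ^ N) * ih + Pn (a * x) q N * this
  have lim : Tendsto (fun N : ℕ => ∑' n, Pn a q n / Pn q q n * (x * q ^ N) ^ n) atTop (𝓝 1) := by
    have e : (1 : ℂ) = ∑' n : ℕ, if n = 0 then (1 : ℂ) else 0 := by
      rw [tsum_ite_eq]
    rw [e]
    obtain ⟨C, hC⟩ := qbin_bound a hq
    refine tendsto_tsum_of_dominated_convergence
      ((summable_geometric_of_lt_one (norm_nonneg _) hx).mul_left C) (fun n => ?_)
      (Eventually.of_forall fun N n => ?_)
    · by_cases hn : n = 0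
      · subst hn; simp [Pn]
      · rw [if_neg hn]
        have h1 : Tendsto (fun N : ℕ => x * q ^ N) atTop (𝓝 (x * 0)) :=
          (tendsto_pow_atTop_nhds_zero_of_norm_lt_one hq).const_mul x
        have h2 := (h1.pow n).const_mul (Pn a q n / Pn q q n)
        simpa [hn] using h2
    · rw [norm_mul, norm_pow, norm_mul, norm_pow]
      have := hC n
      refine mul_le_mul this (pow_le_pow_left₀ (by positivity) ?_ n) (by positivity)
        ((norm_nonneg _).trans this)
      calc ‖x‖ * ‖q‖ ^ N ≤ ‖x‖ * 1 := by
            gcongr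
            exact pow_le_one₀ (norm_nonneg _) hq.le
        _ = ‖x‖ := mul_one _
  have l1 := (qp_tendsto x hq).mul_const (∑' n, Pn a q n / Pn q q n * x ^ n)
  have l2 := (qp_tendsto (a * x) hq).mul lim
  have := tendsto_nhds_unique l1 (l2.congr fun N => (hN N).symm)
  rw [eq_div_iff (qp_ne_zero_of_lt hq hx)]
  linear_combination this

/-- weights attached to parts -/
noncomputable def gw (w : ℕ → ℂ) (q : ℂ) (i : ℕ) : ℂ := if i = 0 then 0 else w i * q ^ i

lemma gw_adm {w : ℕ → ℂ} (hw : ∀ i, ‖w i‖ ≤ 1) (q : ℂ) : Adm ‖q‖ (gw w q) := by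
  refine ⟨by simp [gw], fun i => ?_⟩
  unfold gw
  split_ifs
  · simp
  · rw [norm_mul, norm_pow]
    exact mul_le_of_le_one_left (by positivity) (hw i)

lemma PF_gw (w : ℕ → ℂ) (q : ℂ) : PF (gw w q) = ∑' s, (s.map w).prod * wq q s := by
  unfold PF
  congr 1
  funext s
  exact pw_eq w q s

lemma P_gf {q : ℂ} (hq : ‖q‖ < 1 / 2) : ∑' s, wq q s = (qp q q)⁻¹ := by
  have hq1 : ‖q‖ < 1 := by linarith
  have h := PF_tendsto (gw_adm (w := fun _ => 1) (by simp) q) (norm_nonneg _) hq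
  have h2 := h.comp (tendsto_add_atTop_nat 1)
  have h3 : Tendsto (fun M => PF (gw (fun _ => 1) q) * ∏ i ∈ Finset.range M, (1 - q * q ^ i)) atTop (𝓝 1) := by
    refine h2.congr fun M => ?_
    simp only [Function.comp]
    rw [Finset.prod_range_succ']
    simp [gw, pow_succ']
  have h4 := tendsto_nhds_unique h3 ((qp_tendsto q hq1).const_mul _)
  rw [PF_gw] at h4
  simp at h4
  exact eq_inv_of_mul_eq_one_left h4.symm

lemma fin_part {g : ℕ → ℂ} {q : ℂ} (n : ℕ) (hn : 1 ≤ n) (h0 : g 0 = 0) (h1 : g 1 = 0)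
    (h : ∀ i, 2 ≤ i → i ≤ n → g i = q ^ i) :
    (1 - q) * ∏ i ∈ Finset.range (n + 1), (1 - g i) = Pn q q n := by
  induction n, hn using Nat.le_induction with
  | base => simp [Finset.prod_range_succ, h0, h1, Pn]
  | succ n hn ih =>
    rw [Finset.prod_range_succ, Pn_succ, ← mul_assoc, ih (fun i h2 h3 => h i h2 (by omega)),
      h (n + 1) (by omega) le_rfl, pow_succ']

/-- weights for the `nu`-part of the crank -/
def wc (z : ℂ) (n : ℕ) (i : ℕ) : ℂ := if i = 1 then 0 else if n < i then z else 1
/-- weights for parts between 2 and `L` -/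
def wl (L : ℕ) (i : ℕ) : ℂ := if i = 1 then 0 else if L < i then 0 else 1

lemma wc_gf {z q : ℂ} (hz : ‖z‖ = 1) (hq : ‖q‖ < 1 / 2) (n : ℕ) (hn : 1 ≤ n) :
    (∑' s, (s.map (wc z n)).prod * wq q s) * Pn q q n * qp (z * q ^ (n + 1)) q = 1 - q := by
  have hq1 : ‖q‖ < 1 := by linarith
  have h := PF_tendsto (gw_adm (w := wc z n) (by
    intro i; unfold wc; split_ifs <;> simp [hz]) q) (norm_nonneg _) hq
  have h2 := h.comp (tendsto_add_atTop_nat (n + 1))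
  rw [PF_gw] at h2
  set A := ∑' s, (s.map (wc z n)).prod * wq q s
  have h3 : Tendsto (fun M => (A * Pn q q n) * ∏ i ∈ Finset.range M, (1 - (z * q ^ (n + 1)) * q ^ i))
      atTop (𝓝 ((1 - q) * 1)) := by
    refine (h2.const_mul (1 - q)).congr fun M => ?_
    simp only [Function.comp]
    rw [add_comm M, Finset.prod_range_add, ← fin_part (g := gw (wc z n) q) n hn (by simp [gw]) (by simp [gw, wc])]
    · have : ∀ x ∈ Finset.range M, 1 - gw (wc z n) q (n + 1 + x) = 1 - z * q ^ (n + 1) * q ^ x := by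
        intro x _
        rw [gw, if_neg (by omega), wc, if_neg (by omega), if_pos (by omega), pow_add]
        ring
      rw [Finset.prod_congr rfl this]
      ring
    · intro i h2 h3
      rw [gw, if_neg (by omega), wc, if_neg (by omega), if_neg (by omega), one_mul]
  have h4 := tendsto_nhds_unique h3 ((qp_tendsto _ hq1).const_mul _)
  rw [← h4, mul_one]

lemma wl_gf {q : ℂ} (hq : ‖q‖ < 1 / 2) (n : ℕ) (hn : 1 ≤ n) :
    (∑' s, (s.map (wl n)).prod * wq q s) * Pn q q n = 1 - q := by
  have hq1 : ‖q‖ < 1 := by linarith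
  have h := PF_tendsto (gw_adm (w := wl n) (by
    intro i; unfold wl; split_ifs <;> simp) q) (norm_nonneg _) hq
  have h2 := h.comp (tendsto_add_atTop_nat (n + 1))
  rw [PF_gw] at h2
  set A := ∑' s, (s.map (wl n)).prod * wq q s
  have h3 : Tendsto (fun _ : ℕ => (A * Pn q q n))
      atTop (𝓝 ((1 - q) * 1)) := by
    refine (h2.const_mul (1 - q)).congr fun M => ?_
    simp only [Function.comp]
    rw [add_comm M, Finset.prod_range_add, ← fin_part (g := gw (wl n) q) n hn (by simp [gw]) (by simp [gw, wl])]
    · have : ∀ x ∈ Finset.range M, 1 - gw (wl n) q (n + 1 + x) = 1 := by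
        intro x _
        rw [gw, if_neg (by omega), wl, if_neg (by omega), if_pos (by omega)]
        ring
      rw [Finset.prod_congr rfl this, Finset.prod_const_one]
      ring
    · intro i h2 h3
      rw [gw, if_neg (by omega), wl, if_neg (by omega), if_neg (by omega), one_mul]
  have h4 := tendsto_nhds_unique h3 tendsto_const_nhds
  rw [← h4, mul_one]

lemma wc_prod (z : ℂ) (n : ℕ) (s : Multiset ℕ) :
    (s.map (wc z n)).prod = if 1 ∈ s then 0 else z ^ (s.filter (fun x => n < x)).card := by
  induction s using Multiset.induction with
  | empty => simp
  | cons a s ih =>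
    rw [Multiset.map_cons, Multiset.prod_cons, ih, Multiset.filter_cons, wc]
    by_cases h1 : a = 1
    · subst h1; simp
    · have : (1 ∈ a ::ₘ s) ↔ 1 ∈ s := by
        rw [Multiset.mem_cons]; constructor
        · rintro (h | h)
          · exact absurd h.symm h1
          · exact h
        · exact Or.inr
      simp only [this, if_neg h1]
      split_ifs <;> simp [pow_succ', pow_add]

lemma wl_prod (n : ℕ) (s : Multiset ℕ) :
    (s.map (wl n)).prod = if 1 ∈ s then 0 else if s.sup ≤ n then 1 else 0 := by
  induction s using Multiset.induction with
  | empty => simp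
  | cons a s ih =>
    rw [Multiset.map_cons, Multiset.prod_cons, ih, wl, Multiset.sup_cons]
    by_cases h1 : a = 1
    · subst h1; simp
    · have : (1 ∈ a ::ₘ s) ↔ 1 ∈ s := by
        rw [Multiset.mem_cons]; constructor
        · rintro (h | h)
          · exact absurd h.symm h1
          · exact h
        · exact Or.inr
      simp only [this, if_neg h1, sup_le_iff]
      split_ifs <;> first | omega | simp

/-- crank of a multiset -/
def crk (s : Multiset ℕ) : ℤ :=
  if s.count 1 = 0 then (s.sup : ℤ)
  else ((s.filter (fun x => s.count 1 < x)).card : ℤ) - s.count 1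

lemma norm_zpow_one {z : ℂ} (hz : ‖z‖ = 1) (k : ℤ) : ‖z ^ k‖ = 1 := by
  rw [norm_zpow, hz, one_zpow]

lemma split_one (s : Multiset ℕ) : s.filter (fun x => x ≠ 1) + Multiset.replicate (s.count 1) 1 = s := by
  rw [← Multiset.filter_eq' s 1, add_comm]
  exact Multiset.filter_add_not (fun x => x = 1) s

lemma wq_add_ones (q : ℂ) (n : ℕ) (s : Multiset ℕ) :
    wq q (s + Multiset.replicate n 1) = wq q s * q ^ n := by
  unfold wq
  have : (0 ∈ s + Multiset.replicate n 1) ↔ 0 ∈ s := by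
    rw [Multiset.mem_add, Multiset.mem_replicate]
    constructor
    · rintro (h | h)
      · exact h
      · exact absurd h.2 (by norm_num)
    · exact Or.inl
  simp only [this, Multiset.sum_add, Multiset.sum_replicate, smul_eq_mul, mul_one, pow_add]
  split_ifs <;> simp

lemma fiber_tsum (f : Multiset ℕ → ℂ) (g : Multiset ℕ → ℕ) (n : ℕ) :
    ∑' s : (g ⁻¹' {n} : Set (Multiset ℕ)), f s = ∑' s, if g s = n then f s else 0 := by
  rw [tsum_subtype (g ⁻¹' {n}) f]
  congr 1
  funext s
  simp [Set.indicator]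

/-- the crank sum over partitions with `n ≥ 1` ones -/
lemma crank_ones {z q : ℂ} (hz : ‖z‖ = 1) (n : ℕ) (hn : 1 ≤ n) :
    (∑' s : Multiset ℕ, if s.count 1 = n then z ^ crk s * wq q s else 0) =
      (q * z⁻¹) ^ n * ∑' s, (s.map (wc z n)).prod * wq q s := by
  have hz0 : z ≠ 0 := by rintro rfl; simp at hz
  have inj : Function.Injective (fun s : Multiset ℕ => s + Multiset.replicate n 1) :=
    add_left_injective _
  have e := inj.tsum_eq (f := fun s => if s.count 1 = n then z ^ crk s * wq q s else 0) (by
    intro s hs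
    have : s.count 1 = n := by
      by_contra h
      exact hs (if_neg h)
    refine ⟨s.filter (fun x => x ≠ 1), ?_⟩
    rw [← this]
    exact split_one s)
  rw [← e, ← tsum_mul_left]
  congr 1
  funext s
  rw [wc_prod]
  have hc : (s + Multiset.replicate n 1).count 1 = s.count 1 + n := by simp
  simp only [hc]
  by_cases h1 : 1 ∈ s
  · have : s.count 1 ≠ 0 := by rwa [Ne, Multiset.count_eq_zero, not_not]
    rw [if_neg (by omega), if_pos h1]; ring
  · have : s.count 1 = 0 := by rwa [Multiset.count_eq_zero]
    rw [if_pos (by omega), if_neg h1, wq_add_ones, crk, hc, this, zero_add, if_neg (by omega)]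
    have : (s + Multiset.replicate n 1).filter (fun x => n < x) = s.filter (fun x => n < x) := by
      rw [Multiset.filter_add, add_eq_left, Multiset.filter_eq_nil]
      intro a ha
      rw [Multiset.mem_replicate] at ha
      omega
    rw [this, zpow_sub₀ hz0, zpow_natCast, zpow_natCast, mul_pow, inv_pow]
    field_simp

/-- the crank sum over partitions without ones -/
lemma crank_zero {z q : ℂ} (hz : ‖z‖ = 1) (hq : ‖q‖ < 1 / 2) :
    (∑' s : Multiset ℕ, if s.count 1 = 0 then z ^ crk s * wq q s else 0) =
      (1 - q) / qp (z * q) q + q - z * q := by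
  have hq1 : ‖q‖ < 1 := by linarith
  have hzq : ‖z * q‖ < 1 := by rw [norm_mul, hz, one_mul]; exact hq1
  set f : Multiset ℕ → ℂ := fun s => if s.count 1 = 0 then z ^ crk s * wq q s else 0 with hf
  have hsum : Summable f := by
    refine (wq_mul_summable hq (fun s => if s.count 1 = 0 then z ^ crk s else 0) ?_).congr ?_
    · intro s; split_ifs
      · rw [norm_zpow_one hz]
      · simp
    · intro s; simp only [hf]; split_ifs <;> simp
  have h1 := hsum.hasSum.tsum_fiberwise (fun s => s.sup)
  have hE : ∀ L : ℕ, Summable (fun s : Multiset ℕ => (s.map (wl L)).prod * wq q s) := by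
    intro L
    apply wq_mul_summable hq
    intro s; rw [wl_prod]; split_ifs <;> simp
  have hb : ∀ L : ℕ, ∑' s : ((fun s : Multiset ℕ => s.sup) ⁻¹' {L} : Set (Multiset ℕ)), f s =
      (1 - q) * (Pn 0 q L / Pn q q L * (z * q) ^ L) + ((if L = 0 then q else 0) + if L = 1 then - (z * q) else 0) := by
    intro L
    rw [fiber_tsum]
    have hP0 : ∀ n, Pn 0 q n = 1 := by intro n; simp [Pn]
    rw [hP0]
    rcases Nat.eq_zero_or_pos L with rfl | hL
    · rw [tsum_eq_single 0]
      · simp [hf, crk, wq, Pn]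
      · intro s hs
        split_ifs with h
        · obtain ⟨a, ha⟩ := Multiset.exists_mem_of_ne_zero hs
          have h2 : a ≤ 0 := h ▸ Multiset.le_sup ha
          have : a = 0 := by omega
          subst this
          simp [hf, wq, ha]
        · rfl
    · have e1 : (∑' s : Multiset ℕ, if s.sup = L then f s else 0) = z ^ L *
          ((∑' s, (s.map (wl L)).prod * wq q s) - ∑' s, (s.map (wl (L - 1))).prod * wq q s) := by
        rw [← (hE _).tsum_sub (hE _), ← tsum_mul_left]
        congr 1
        funext s
        rw [wl_prod, wl_prod]
        simp only [hf, crk, Multiset.count_eq_zero]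
        by_cases h1 : 1 ∈ s
        · simp [h1]
        · simp only [h1, not_false_eq_true, if_true, if_false]
          by_cases hs : s.sup = L
          · rw [if_pos hs, hs, if_pos le_rfl, if_neg (by omega), zpow_natCast]; ring
          · rw [if_neg hs]
            by_cases hs2 : s.sup ≤ L
            · rw [if_pos hs2, if_pos (by omega)]; ring
            · rw [if_neg hs2, if_neg (by omega)]; ring
      rw [e1, if_neg (by omega), zero_add]
      have p1 := Pn_ne hq1 hq1 L
      have g1 := wl_gf hq L hL
      rw [← eq_div_iff p1] at g1
      by_cases hL1 : L = 1
      · subst hL1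
        have e2 : (∑' s, (s.map (wl (1 - 1))).prod * wq q s) = ∑' s, (s.map (wl 1)).prod * wq q s := by
          congr 1
          funext s
          by_cases h0 : 0 ∈ s
          · simp [wq, h0]
          · rw [wl_prod, wl_prod]
            by_cases h1 : 1 ∈ s
            · simp [h1]
            · rw [if_neg h1, if_neg h1]
              congr 1
              have : s.sup ≤ 1 - 1 ↔ s.sup ≤ 1 := by
                constructor
                · intro h; omega
                · intro h
                  rw [Multiset.sup_le] at h ⊢
                  intro b hb
                  have := h b hb
                  have h3 : b ≠ 0 := fun h => h0 (h ▸ hb)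
                  have h4 : b ≠ 1 := fun h => h1 (h ▸ hb)
                  omega
              simp only [this]
        rw [e2, sub_self, mul_zero]
        have : (1 - q) ≠ 0 := by simpa using one_sub_ne hq1 hq1 0
        simp [Pn]
        field_simp
        ring
      · obtain ⟨m, rfl⟩ : ∃ m, L = m + 1 := ⟨L - 1, by omega⟩
        have p2 := Pn_ne hq1 hq1 m
        have g2 := wl_gf hq m (by omega)
        rw [← eq_div_iff p2] at g2
        rw [Nat.add_sub_cancel, g1, g2, if_neg hL1, add_zero, Pn_succ]
        have p3 := one_sub_ne hq1 hq1 m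
        rw [mul_pow, pow_succ q]
        generalize hD : 1 - q * q ^ m = D at *
        field_simp
        rw [← hD]
        ring
  simp only [hb] at h1
  have h2 := (((qbin_summable 0 hq1 hzq).hasSum).mul_left (1 - q)).add
    ((hasSum_ite_eq (0 : ℕ) q).add (hasSum_ite_eq (1 : ℕ) (-(z * q))))
  have h3 := h1.unique h2
  rw [h3, qbin 0 hq1 hzq, zero_mul]
  have : qp 0 q = 1 := by simp [qp]
  rw [this]
  ring

lemma crank_gf {z q : ℂ} (hz : ‖z‖ = 1) (hq : ‖q‖ < 1 / 2) :
    ∑' s, z ^ crk s * wq q s = Cf z q + q - z * q := by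
  have hq1 : ‖q‖ < 1 := by linarith
  have hz0 : z ≠ 0 := by rintro rfl; simp at hz
  have hzq : ‖z * q‖ < 1 := by rw [norm_mul, hz, one_mul]; exact hq1
  have hzi : ‖q * z⁻¹‖ < 1 := by rw [norm_mul, norm_inv, hz, inv_one, mul_one]; exact hq1
  have hsum := wq_mul_summable hq (fun s => z ^ crk s) (fun s => (norm_zpow_one hz _).le)
  have h1 := hsum.hasSum.tsum_fiberwise (fun s => s.count 1)
  have n1 := qp_ne_zero_of_lt hq1 hzq
  have hb : ∀ n : ℕ, ∑' s : ((fun s : Multiset ℕ => s.count 1) ⁻¹' {n} : Set (Multiset ℕ)), z ^ crk s * wq q s =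
      (1 - q) / qp (z * q) q * (Pn (z * q) q n / Pn q q n * (q * z⁻¹) ^ n) +
        (if n = 0 then q - z * q else 0) := by
    intro n
    rw [fiber_tsum (fun s => z ^ crk s * wq q s)]
    rcases Nat.eq_zero_or_pos n with rfl | hn
    · rw [crank_zero hz hq]
      simp [Pn]; ring
    · rw [crank_ones hz n hn, if_neg (by omega), add_zero]
      have g := wc_gf hz hq n hn
      have sp := qp_split (z * q) hq1 n
      rw [show z * q * q ^ n = z * q ^ (n + 1) by ring] at sp
      rw [sp] at n1 ⊢
      have p1 := Pn_ne hq1 hq1 n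
      rw [mul_assoc, ← eq_div_iff (mul_ne_zero p1 (right_ne_zero_of_mul n1))] at g
      rw [g]
      have := left_ne_zero_of_mul n1
      have := right_ne_zero_of_mul n1
      generalize Pn (z * q) q n = A at *
      field_simp
  simp only [hb] at h1
  have h2 := (((qbin_summable (z * q) hq1 hzi).hasSum).mul_left ((1 - q) / qp (z * q) q)).add
    (hasSum_ite_eq (0 : ℕ) (q - z * q))
  have h3 := h1.unique h2
  rw [h3, qbin (z * q) hq1 hzi, Cf, qp_succ q hq1]
  rw [show z * q * (q * z⁻¹) = q * q by field_simp]
  have := qp_ne_zero_of_lt hq1 hzi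
  field_simp
  ring

/-! ### The rank bijection -/

/-- rank of a multiset -/
def rk (s : Multiset ℕ) : ℤ := (s.sup : ℤ) - s.card

lemma sup_mem_of_ne (s : Multiset ℕ) (hs : s ≠ 0) : s.sup ∈ s := by
  induction s using Multiset.induction with
  | empty => exact absurd rfl hs
  | cons a s ih =>
    rw [Multiset.sup_cons]
    by_cases h : s = 0
    · subst h; simp
    · have := ih h
      rcases le_total a s.sup with h1 | h1
      · rw [sup_eq_right.2 h1]; exact Multiset.mem_cons_of_mem this
      · rw [sup_eq_left.2 h1]; exact Multiset.mem_cons_self _ _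

/-- adding a column -/
def phiR (r : ℤ) (s : Multiset ℕ) : Multiset ℕ :=
  ((s.card + r).toNat ::ₘ s.map Nat.pred).filter (fun x => 0 < x)

/-- removing the largest part -/
def psiR (r : ℤ) (t : Multiset ℕ) : Multiset ℕ :=
  (t.erase t.sup).map Nat.succ + Multiset.replicate ((t.sup : ℤ) - r - (t.erase t.sup).card).toNat 1

/-- source of the bijection -/
def TR (r : ℤ) : Set (Multiset ℕ) := {t | 0 ∉ t ∧ ((t.erase t.sup).card : ℤ) + r ≤ t.sup}
/-- target of the bijection -/
def SR' (r : ℤ) : Set (Multiset ℕ) := {s | 0 ∉ s ∧ (s.sup : ℤ) ≤ s.card + r + 1 ∧ 0 ≤ (s.card : ℤ) + r}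

lemma pred_succ_split (s : Multiset ℕ) (h : 0 ∉ s) :
    ((s.map Nat.pred).filter (fun x => 0 < x)).map Nat.succ + Multiset.replicate (s.count 1) 1 = s := by
  induction s using Multiset.induction with
  | empty => simp
  | cons a s ih =>
    rw [Multiset.mem_cons, not_or] at h
    have := ih h.2
    rw [Multiset.map_cons, Multiset.filter_cons]
    by_cases h1 : a = 1
    · subst h1
      rw [if_neg (by simp), zero_add, Multiset.count_cons_self, Multiset.replicate_succ, Multiset.add_cons, this]
    · have h2 : 1 < a := by have := h.1; omega
      rw [if_pos (by simp; omega), Multiset.count_cons_of_ne (by omega), Multiset.map_add,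
        Multiset.map_singleton, add_assoc, this]
      rw [show Nat.succ (Nat.pred a) = a by rw [Nat.succ_pred]; omega, Multiset.singleton_add]

lemma card_split (s : Multiset ℕ) (h : 0 ∉ s) :
    ((s.map Nat.pred).filter (fun x => 0 < x)).card + s.count 1 = s.card := by
  have := congrArg Multiset.card (pred_succ_split s h)
  simpa using this

lemma phiR_data {r : ℤ} {s : Multiset ℕ} (hs : s ∈ SR' r) :
    (phiR r s).sup = (s.card + r).toNat ∧
    (phiR r s).erase (phiR r s).sup = (s.map Nat.pred).filter (fun x => 0 < x) := by
  obtain ⟨h0, h1, h2⟩ := hs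
  have hu : ∀ x ∈ (s.map Nat.pred).filter (fun x => 0 < x), 0 < x ∧ x ≤ (s.card + r).toNat := by
    intro x hx
    rw [Multiset.mem_filter, Multiset.mem_map] at hx
    obtain ⟨⟨y, hy, rfl⟩, hp⟩ := hx
    have := Multiset.le_sup hy
    refine ⟨hp, ?_⟩
    rw [Nat.pred_eq_sub_one]
    omega
  unfold phiR
  rw [Multiset.filter_cons]
  generalize (s.map Nat.pred).filter (fun x => 0 < x) = u at *
  by_cases hL : 0 < (s.card + r).toNat
  · rw [if_pos hL, Multiset.singleton_add]
    have : ((s.card + r).toNat ::ₘ u).sup = (s.card + r).toNat := by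
      rw [Multiset.sup_cons, sup_eq_left, Multiset.sup_le]
      exact fun b hb => (hu b hb).2
    refine ⟨this, ?_⟩
    rw [this, Multiset.erase_cons_head]
  · rw [if_neg hL, zero_add]
    have : u = 0 := by
      rw [Multiset.eq_zero_iff_forall_notMem]
      intro x hx
      have := hu x hx
      omega
    subst this
    refine ⟨?_, ?_⟩
    · simp; omega
    · simp

lemma phiR_mem {r : ℤ} {s : Multiset ℕ} (hs : s ∈ SR' r) : phiR r s ∈ TR r := by
  obtain ⟨e1, e2⟩ := phiR_data hs
  refine ⟨?_, ?_⟩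
  · intro h
    unfold phiR at h
    rw [Multiset.mem_filter] at h
    exact absurd h.2 (lt_irrefl _)
  · rw [e2, e1]
    have := card_split s hs.1
    have := hs.2.2
    omega

lemma psi_phi {r : ℤ} {s : Multiset ℕ} (hs : s ∈ SR' r) : psiR r (phiR r s) = s := by
  obtain ⟨e1, e2⟩ := phiR_data hs
  unfold psiR
  rw [e2, e1]
  have h1 := card_split s hs.1
  have h2 := hs.2.2
  rw [show ((((s.card : ℤ) + r).toNat : ℤ) - r -
    (((s.map Nat.pred).filter (fun x => 0 < x)).card : ℤ)).toNat = s.count 1 by omega]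
  exact pred_succ_split s hs.1

lemma psiR_card {r : ℤ} {t : Multiset ℕ} (ht : t ∈ TR r) : ((psiR r t).card : ℤ) + r = t.sup := by
  have := ht.2
  unfold psiR
  rw [Multiset.card_add, Multiset.card_map, Multiset.card_replicate]
  omega

lemma psiR_mem {r : ℤ} {t : Multiset ℕ} (ht : t ∈ TR r) : psiR r t ∈ SR' r := by
  have hc := psiR_card ht
  refine ⟨?_, ?_, by omega⟩
  · intro h
    unfold psiR at h
    rw [Multiset.mem_add, Multiset.mem_map, Multiset.mem_replicate] at h
    rcases h with ⟨a, _, h⟩ | ⟨_, h⟩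
    · exact absurd h (Nat.succ_ne_zero a)
    · omega
  · rw [hc]
    have : (psiR r t).sup ≤ t.sup + 1 := by
      rw [Multiset.sup_le]
      intro b hb
      unfold psiR at hb
      rw [Multiset.mem_add, Multiset.mem_map, Multiset.mem_replicate] at hb
      rcases hb with ⟨a, ha, rfl⟩ | ⟨_, rfl⟩
      · have := Multiset.le_sup (Multiset.mem_of_mem_erase ha)
        omega
      · omega
    exact_mod_cast this

lemma cons_filter (t : Multiset ℕ) (h0 : 0 ∉ t) :
    (t.sup ::ₘ t.erase t.sup).filter (fun x => 0 < x) = t := by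
  by_cases ht : t = 0
  · subst ht; simp
  · rw [Multiset.cons_erase (sup_mem_of_ne t ht), Multiset.filter_eq_self]
    intro a ha
    exact Nat.pos_of_ne_zero fun h => h0 (h ▸ ha)

lemma phi_psi {r : ℤ} {t : Multiset ℕ} (ht : t ∈ TR r) : phiR r (psiR r t) = t := by
  have hc := psiR_card ht
  unfold phiR
  rw [hc, Int.toNat_natCast]
  unfold psiR
  rw [Multiset.map_add, Multiset.map_map, Multiset.map_replicate]
  have : (t.erase t.sup).map (Nat.pred ∘ Nat.succ) = t.erase t.sup := by
    conv_rhs => rw [← Multiset.map_id (t.erase t.sup)]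
    rfl
  rw [this, ← Multiset.cons_add, Multiset.filter_add, cons_filter t ht.1, add_eq_left,
    Multiset.filter_eq_nil]
  intro a ha
  rw [Multiset.mem_replicate] at ha
  rw [ha.2]; simp

lemma psiR_sum {r : ℤ} {t : Multiset ℕ} (ht : t ∈ TR r) : (t.sum : ℤ) = (psiR r t).sum + r := by
  have h := ht.2
  have e : t.sum = t.sup + (t.erase t.sup).sum := by
    by_cases h0 : t = 0
    · subst h0; simp
    · conv_lhs => rw [← Multiset.cons_erase (sup_mem_of_ne t h0)]
      rw [Multiset.sum_cons]
  have e2 : ((t.erase t.sup).map Nat.succ).sum = (t.erase t.sup).sum + (t.erase t.sup).card := by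
    generalize t.erase t.sup = u
    induction u using Multiset.induction with
    | empty => simp
    | cons a s ih => rw [Multiset.map_cons, Multiset.sum_cons, ih, Multiset.sum_cons, Multiset.card_cons]; omega
  unfold psiR
  rw [Multiset.sum_add, e2, Multiset.sum_replicate, e, smul_eq_mul, mul_one]
  push_cast
  omega

/-- the bijection -/
def rankEquiv (r : ℤ) : TR r ≃ SR' r where
  toFun t := ⟨psiR r t, psiR_mem t.2⟩
  invFun s := ⟨phiR r s, phiR_mem s.2⟩
  left_inv t := Subtype.ext (phi_psi t.2)
  right_inv s := Subtype.ext (psi_phi s.2)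

lemma rank_bij (r : ℤ) {q : ℂ} (hq0 : q ≠ 0) :
    (∑' t, (TR r).indicator (wq q) t) = q ^ r * ∑' s, (SR' r).indicator (wq q) s := by
  rw [← tsum_subtype, ← tsum_subtype, ← (rankEquiv r).tsum_eq, ← tsum_mul_left]
  congr 1
  funext t
  have h1 := t.2.1
  have h2 := (psiR_mem t.2).1
  show wq q t = q ^ r * wq q (psiR r t)
  rw [wq, wq, if_neg h1, if_neg h2, ← zpow_natCast, ← zpow_natCast, psiR_sum t.2, zpow_add₀ hq0, mul_comm]

/-- generating function for rank at least `m` -/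
noncomputable def AA (m : ℤ) (q : ℂ) : ℂ := ∑' s : Multiset ℕ, if s ≠ 0 ∧ m ≤ rk s then wq q s else 0
/-- generating function for rank at most `-m` -/
noncomputable def DD (m : ℤ) (q : ℂ) : ℂ := ∑' s : Multiset ℕ, if s ≠ 0 ∧ rk s ≤ -m then wq q s else 0

lemma ite_summable {q : ℂ} (hq : ‖q‖ < 1 / 2) (p : Multiset ℕ → Prop) [DecidablePred p] :
    Summable (fun s => if p s then wq q s else 0) := by
  refine (wq_mul_summable hq (fun s => if p s then 1 else 0) ?_).congr ?_
  · intro s; split_ifs <;> simp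
  · intro s; split_ifs <;> simp

lemma rk_pos_card {s : Multiset ℕ} (hs : s ≠ 0) : 0 < s.card := Multiset.card_pos.2 hs

lemma sup_pos_of {s : Multiset ℕ} (hs : s ≠ 0) (h0 : 0 ∉ s) : 0 < s.sup := by
  have := sup_mem_of_ne s hs
  exact Nat.pos_of_ne_zero fun h => h0 (h ▸ this)

lemma AA_rec (m : ℤ) (hm : 0 ≤ m) {q : ℂ} (hq0 : q ≠ 0) (hq : ‖q‖ < 1 / 2) :
    AA m q = q ^ (m + 1) * ((∑' s, wq q s) - AA (m + 3) q) := by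
  have h := rank_bij (m + 1) hq0
  have e1 : ∑' t, (TR (m + 1)).indicator (wq q) t = AA m q := by
    unfold AA
    congr 1
    funext t
    classical
    rw [Set.indicator_apply]
    by_cases h0 : 0 ∈ t
    · simp [wq, h0]
    · congr 1
      rw [eq_iff_iff]
      by_cases ht : t = 0
      · subst ht; simp [TR]; omega
      · have := Multiset.card_erase_of_mem (sup_mem_of_ne t ht)
        have := rk_pos_card ht
        simp only [TR, Set.mem_ofPred_eq, rk]
        constructor
        · rintro ⟨_, h⟩; refine ⟨ht, by rw [Nat.pred_eq_sub_one] at *; omega⟩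
        · rintro ⟨_, h⟩; refine ⟨h0, by rw [Nat.pred_eq_sub_one] at *; omega⟩
  have e2 : ∑' t, (SR' (m + 1)).indicator (wq q) t = (∑' s, wq q s) - AA (m + 3) q := by
    unfold AA
    rw [← (wq_norm_summable hq).of_norm.tsum_sub (ite_summable hq _)]
    congr 1
    funext t
    classical
    rw [Set.indicator_apply]
    by_cases h0 : 0 ∈ t
    · simp [wq, h0]
    · have : t ∈ SR' (m + 1) ↔ ¬ (t ≠ 0 ∧ m + 3 ≤ rk t) := by
        simp only [SR', Set.mem_ofPred_eq, rk, h0]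
        by_cases ht : t = 0
        · subst ht; simp; omega
        · simp [ht]; omega
      simp only [this]
      split_ifs <;> simp_all
  rw [← e1, h, e2]

lemma DD_rec (m : ℤ) (hm : 0 ≤ m) {q : ℂ} (hq0 : q ≠ 0) (hq : ‖q‖ < 1 / 2) :
    DD m q = q ^ (m + 1) * ((∑' s, wq q s) - DD (m + 3) q) := by
  have h := rank_bij (-(m + 1)) hq0
  have e1 : ∑' t, (SR' (-(m + 1))).indicator (wq q) t = DD m q := by
    unfold DD
    congr 1
    funext t
    classical
    rw [Set.indicator_apply]
    by_cases h0 : 0 ∈ t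
    · simp [wq, h0]
    · congr 1
      rw [eq_iff_iff]
      by_cases ht : t = 0
      · subst ht; simp [SR']; omega
      · have := sup_pos_of ht h0
        simp only [SR', Set.mem_ofPred_eq, rk, h0]
        simp [ht]; omega
  have e2 : ∑' t, (TR (-(m + 1))).indicator (wq q) t = (∑' s, wq q s) - DD (m + 3) q := by
    unfold DD
    rw [← (wq_norm_summable hq).of_norm.tsum_sub (ite_summable hq _)]
    congr 1
    funext t
    classical
    rw [Set.indicator_apply]
    by_cases h0 : 0 ∈ t
    · simp [wq, h0]
    · have : t ∈ TR (-(m + 1)) ↔ ¬ (t ≠ 0 ∧ rk t ≤ -(m + 3)) := by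
        simp only [TR, Set.mem_ofPred_eq, rk, h0]
        by_cases ht : t = 0
        · subst ht; simp; omega
        · have h1 := Multiset.card_erase_of_mem (sup_mem_of_ne t ht)
          have := rk_pos_card ht
          rw [h1, Nat.pred_eq_sub_one]
          simp [ht]; omega
      simp only [this]
      split_ifs <;> simp_all
  rw [← e1, ← e2, h, ← mul_assoc, ← zpow_add₀ hq0]
  simp

/-- exponents in the expansion of `AA` -/
def EE (k : ℕ) : ℤ := pent (-((k : ℤ) + 1))

lemma two_EE (k : ℕ) : 2 * EE k = (k + 1) * (3 * k + 2) := by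
  have := two_tri (-((k : ℤ) + 1))
  unfold EE pent
  linear_combination this

lemma EE_zero : EE 0 = 1 := by have := two_EE 0; push_cast at this; linarith

lemma EE_succ (k : ℕ) : EE (k + 1) = EE k + 3 * k + 4 := by
  have h1 := two_EE k
  have h2 := two_EE (k + 1)
  push_cast at h2
  linarith

lemma EE_ge (k : ℕ) : (k : ℤ) + 1 ≤ EE k := by
  have := two_EE k
  nlinarith [Int.natCast_nonneg k]

lemma EE_bound {q : ℂ} (hq0 : q ≠ 0) (hq : ‖q‖ < 1) (k : ℕ) (m : ℤ) (hm : 0 ≤ m) :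
    ‖(-1) ^ k * q ^ (EE k + m * (k + 1))‖ ≤ ‖q‖ ^ k * ‖q‖ ^ m := by
  have hp : 0 < ‖q‖ := norm_pos_iff.2 hq0
  rw [norm_mul, norm_pow, norm_neg, norm_one, one_pow, one_mul, norm_zpow, ← zpow_natCast ‖q‖ k,
    ← zpow_add₀ hp.ne']
  apply zpow_le_zpow_right_of_le_one₀ hp hq.le
  have := EE_ge k
  nlinarith [Int.natCast_nonneg k]

/-- the series for `AA` -/
noncomputable def YY (q : ℂ) (m : ℤ) : ℂ := ∑' k : ℕ, (-1) ^ k * q ^ (EE k + m * (k + 1))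

lemma YY_summable {q : ℂ} (hq0 : q ≠ 0) (hq : ‖q‖ < 1) (m : ℤ) (hm : 0 ≤ m) :
    Summable (fun k : ℕ => (-1) ^ k * q ^ (EE k + m * (k + 1))) :=
  Summable.of_norm_bounded ((summable_geometric_of_lt_one (norm_nonneg q) hq).mul_right _)
    (fun k => EE_bound hq0 hq k m hm)

lemma YY_rec {q : ℂ} (hq0 : q ≠ 0) (hq : ‖q‖ < 1) (m : ℤ) (hm : 0 ≤ m) :
    YY q m = q ^ (m + 1) * (1 - YY q (m + 3)) := by
  unfold YY
  rw [(YY_summable hq0 hq m hm).tsum_eq_zero_add, mul_sub, ← tsum_mul_left, mul_one, sub_eq_add_neg,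
    ← tsum_neg]
  congr 1
  · simp [EE_zero, add_comm]
  · congr 1
    funext k
    rw [EE_succ, mul_left_comm, ← zpow_add₀ hq0, pow_succ]
    have : EE k + 3 * k + 4 + m * (((k + 1 : ℕ) : ℤ) + 1) = m + 1 + (EE k + (m + 3) * (k + 1)) := by
      push_cast; ring
    rw [this]; ring

lemma YY_norm {q : ℂ} (hq0 : q ≠ 0) (hq : ‖q‖ < 1) (m : ℤ) (hm : 0 ≤ m) :
    ‖YY q m‖ ≤ ∑' k : ℕ, ‖q‖ ^ k := by
  refine tsum_of_norm_bounded (summable_geometric_of_lt_one (norm_nonneg q) hq).hasSum fun k => ?_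
  refine (EE_bound hq0 hq k m hm).trans (mul_le_of_le_one_right (by positivity) ?_)
  have hp : 0 < ‖q‖ := norm_pos_iff.2 hq0
  simpa using zpow_le_zpow_right_of_le_one₀ hp hq.le hm

lemma rec_unique {q : ℂ} (hq0 : q ≠ 0) (hq : ‖q‖ < 1) (X : ℤ → ℂ) (P : ℂ) (C : ℝ)
    (hX : ∀ m, 0 ≤ m → X m = q ^ (m + 1) * (P - X (m + 3))) (hC : ∀ m, 0 ≤ m → ‖X m‖ ≤ C)
    (m : ℤ) (hm : 0 ≤ m) : X m = P * YY q m := by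
  have hp : 0 < ‖q‖ := norm_pos_iff.2 hq0
  set G : ℝ := ∑' k : ℕ, ‖q‖ ^ k
  have key : ∀ K : ℕ, ∀ m, 0 ≤ m → ‖X m - P * YY q m‖ ≤ ‖q‖ ^ K * (C + ‖P‖ * G) := by
    intro K
    induction K with
    | zero =>
      intro m hm
      rw [pow_zero, one_mul]
      refine (norm_sub_le _ _).trans (add_le_add (hC m hm) ?_)
      rw [norm_mul]
      exact mul_le_mul_of_nonneg_left (YY_norm hq0 hq m hm) (norm_nonneg _)
    | succ K ih =>
      intro m hm
      have : X m - P * YY q m = -(q ^ (m + 1) * (X (m + 3) - P * YY q (m + 3))) := by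
        rw [hX m hm, YY_rec hq0 hq m hm]; ring
      rw [this, norm_neg, norm_mul, pow_succ', mul_assoc]
      refine mul_le_mul ?_ (ih _ (by omega)) (norm_nonneg _) (norm_nonneg _)
      rw [norm_zpow]
      simpa using zpow_le_zpow_right_of_le_one₀ hp hq.le (show 1 ≤ m + 1 by omega)
  have h1 : Tendsto (fun K : ℕ => ‖q‖ ^ K * (C + ‖P‖ * G)) atTop (𝓝 (0 * (C + ‖P‖ * G))) :=
    (tendsto_pow_atTop_nhds_zero_of_lt_one (norm_nonneg q) hq).mul_const _
  have h2 := ge_of_tendsto' h1 (fun K => key K m hm)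
  rw [zero_mul] at h2
  exact sub_eq_zero.1 (norm_le_zero_iff.1 h2)

lemma ite_tsum_norm {q : ℂ} (hq : ‖q‖ < 1 / 2) (p : Multiset ℕ → Prop) [DecidablePred p] :
    ‖∑' s, (if p s then wq q s else 0)‖ ≤ ∑' s, ‖wq q s‖ := by
  refine tsum_of_norm_bounded (wq_norm_summable hq).hasSum fun s => ?_
  split_ifs <;> simp

lemma AA_eq {q : ℂ} (hq0 : q ≠ 0) (hq : ‖q‖ < 1 / 2) (m : ℤ) (hm : 0 ≤ m) :
    AA m q = (∑' s, wq q s) * YY q m :=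
  rec_unique hq0 (by linarith) (fun m => AA m q) _ _ (fun m hm => AA_rec m hm hq0 hq)
    (fun m _ => ite_tsum_norm hq _) m hm

lemma DD_eq {q : ℂ} (hq0 : q ≠ 0) (hq : ‖q‖ < 1 / 2) (m : ℤ) (hm : 0 ≤ m) :
    DD m q = (∑' s, wq q s) * YY q m :=
  rec_unique hq0 (by linarith) (fun m => DD m q) _ _ (fun m hm => DD_rec m hm hq0 hq)
    (fun m _ => ite_tsum_norm hq _) m hm

/-! the weighted sum over `m` -/

lemma sum_YY {q w : ℂ} (hq0 : q ≠ 0) (hq : ‖q‖ < 1) (hw : ‖w‖ = 1) :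
    ∑' j : ℕ, w ^ j * YY q (j + 1) =
      ∑' k : ℕ, (-1) ^ k * q ^ (EE k + (k + 1)) * (1 - w * q ^ (k + 1))⁻¹ := by
  have hp : 0 < ‖q‖ := norm_pos_iff.2 hq0
  have hs := summable_geometric_of_lt_one (norm_nonneg q) hq
  have hsum : Summable (Function.uncurry fun (j : ℕ) (k : ℕ) => w ^ j * ((-1) ^ k * q ^ (EE k + ((j : ℤ) + 1) * (k + 1)))) := by
    refine Summable.of_norm_bounded (g := fun x : ℕ × ℕ => ‖q‖ ^ x.1 * ‖q‖ ^ x.2) (hs.mul_of_nonneg hs (fun _ => by positivity) (fun _ => by positivity)) ?_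
    rintro ⟨j, k⟩
    simp only [Function.uncurry]
    rw [norm_mul, norm_pow, hw, one_pow, one_mul]
    refine (EE_bound hq0 hq k _ (by omega)).trans ?_
    rw [mul_comm]
    refine mul_le_mul_of_nonneg_right ?_ (by positivity)
    rw [← zpow_natCast]
    exact zpow_le_zpow_right_of_le_one₀ hp hq.le (by omega)
  have e1 : ∀ j : ℕ, w ^ j * YY q (j + 1) = ∑' k : ℕ, w ^ j * ((-1) ^ k * q ^ (EE k + ((j : ℤ) + 1) * (k + 1))) := by
    intro j; unfold YY; rw [tsum_mul_left]
  simp only [e1]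
  rw [← hsum.tsum_comm]
  congr 1
  funext k
  have e2 : ∀ j : ℕ, w ^ j * ((-1) ^ k * q ^ (EE k + ((j : ℤ) + 1) * (k + 1)))
      = ((-1) ^ k * q ^ (EE k + (k + 1))) * (w * q ^ (k + 1)) ^ j := by
    intro j
    have : EE k + ((j : ℤ) + 1) * (k + 1) = (EE k + (k + 1)) + (((k + 1) * j : ℕ) : ℤ) := by push_cast; ring
    rw [this, zpow_add₀ hq0 _ (((k + 1) * j : ℕ) : ℤ), zpow_natCast, mul_pow, pow_mul]; ring
  simp only [e2]
  rw [tsum_mul_left, tsum_geometric_of_norm_lt_one]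
  rw [norm_mul, hw, one_mul, norm_pow]
  exact pow_lt_one₀ (norm_nonneg _) hq (by omega)

/-! pointwise identity -/

lemma geo_ind (w : ℂ) (N : ℕ) : HasSum (fun j : ℕ => if j < N then w ^ j else 0) (∑ j ∈ Finset.range N, w ^ j) := by
  have : HasSum (fun j : ℕ => if j < N then w ^ j else 0) _ := hasSum_sum_of_ne_finset_zero (f := fun j : ℕ => if j < N then w ^ j else 0) (s := Finset.range N)
    (fun b hb => by simp at hb; simp; omega)
  refine Eq.mp (congrArg (fun f => HasSum _ f) ?_) this
  exact Finset.sum_congr rfl fun j hj => if_pos (Finset.mem_range.1 hj)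

lemma ind_tsum {z : ℂ} (ρ : ℤ) : ∑' j : ℕ, (if (j : ℤ) + 1 ≤ ρ then z ^ j else 0) = ∑ j ∈ Finset.range ρ.toNat, z ^ j := by
  rw [← (geo_ind z ρ.toNat).tsum_eq]
  congr 1; funext j; congr 1; rw [eq_iff_iff]; omega

lemma zpow_expand {z : ℂ} (hz0 : z ≠ 0) (ρ : ℤ) :
    z ^ ρ = 1 + (1 - z) * (z⁻¹ * (∑' j : ℕ, if (j : ℤ) + 1 ≤ -ρ then z⁻¹ ^ j else 0)
      - ∑' j : ℕ, if (j : ℤ) + 1 ≤ ρ then z ^ j else 0) := by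
  rw [ind_tsum, ind_tsum]
  rcases le_total 0 ρ with h | h
  · obtain ⟨n, rfl⟩ := Int.eq_ofNat_of_zero_le h
    have : (-(n : ℤ)).toNat = 0 := by omega
    rw [this, Int.toNat_natCast]
    simp only [Finset.range_zero, Finset.sum_empty, mul_zero, zero_sub, zpow_natCast]
    have := mul_neg_geom_sum z n
    linear_combination this
  · obtain ⟨n, hn⟩ := Int.eq_ofNat_of_zero_le (show 0 ≤ -ρ by omega)
    have h' : ρ = -(n : ℤ) := by omega
    subst h'
    have : (-(n : ℤ)).toNat = 0 := by omega
    rw [this, neg_neg, Int.toNat_natCast]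
    simp only [Finset.range_zero, Finset.sum_empty, sub_zero, zpow_neg, zpow_natCast]
    have := mul_neg_geom_sum z⁻¹ n
    have hz : z * z⁻¹ = 1 := mul_inv_cancel₀ hz0
    rw [← inv_pow]
    generalize (∑ i ∈ Finset.range n, z⁻¹ ^ i) = S at *
    linear_combination this + S * hz

lemma rk_le_sum {s : Multiset ℕ} (h0 : 0 ∉ s) : rk s ≤ s.sum ∧ -rk s ≤ s.sum := by
  have h1 : s.sup ≤ s.sum := by
    rw [Multiset.sup_le]
    intro b hb
    exact Multiset.le_sum_of_mem hb
  have h2 : s.card ≤ s.sum := by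
    have := Multiset.card_nsmul_le_sum (s := s) (a := 1) (fun x hx => Nat.pos_of_ne_zero fun h => h0 (h ▸ hx))
    simpa using this
  unfold rk
  omega

lemma dbl_summable {q w : ℂ} (hq : ‖q‖ < 1 / 4) (hw : ‖w‖ = 1) (ρ : Multiset ℕ → ℤ)
    (hρ : ∀ s, 0 ∉ s → ρ s ≤ s.sum) :
    Summable (Function.uncurry fun (s : Multiset ℕ) (j : ℕ) => (if (j : ℤ) + 1 ≤ ρ s then w ^ j else 0) * wq q s) := by
  set b := Real.sqrt ‖q‖
  have hb0 : 0 ≤ b := Real.sqrt_nonneg _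
  have hb : b < 1 / 2 := by
    rw [Real.sqrt_lt' (by norm_num)]; norm_num; linarith
  have hbb : b * b = ‖q‖ := Real.mul_self_sqrt (norm_nonneg _)
  refine Summable.of_norm_bounded (g := fun x : Multiset ℕ × ℕ => wr b x.1 * b ^ x.2)
    ((wr_summable hb0 hb).mul_of_nonneg (summable_geometric_of_lt_one hb0 (by linarith)) (fun _ => wr_nonneg hb0 _) (fun _ => by positivity)) ?_
  rintro ⟨s, j⟩
  simp only [Function.uncurry]
  have hn := mul_nonneg (wr_nonneg hb0 s) (pow_nonneg hb0 j)
  split_ifs with h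
  · rw [norm_mul, norm_pow, hw, one_pow, one_mul, norm_wq, ← hbb]
    by_cases h0 : 0 ∈ s
    · simp [wr, h0]
    · simp only [wr, h0, if_false]
      rw [mul_pow]
      refine mul_le_mul_of_nonneg_left ?_ (by positivity)
      exact pow_le_pow_of_le_one hb0 (by linarith) (by have := hρ s h0; omega)
  · simpa using hn

lemma rk_zero : rk 0 = 0 := by simp [rk]

lemma rank_sum_aux {q w : ℂ} (hq : ‖q‖ < 1 / 4) (hw : ‖w‖ = 1) (ρ : Multiset ℕ → ℤ)
    (hρ : ∀ s, 0 ∉ s → ρ s ≤ s.sum) :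
    HasSum (fun s => (∑' j : ℕ, if (j : ℤ) + 1 ≤ ρ s then w ^ j else 0) * wq q s)
      (∑' j : ℕ, w ^ j * ∑' s, if (j : ℤ) + 1 ≤ ρ s then wq q s else 0) := by
  have h := dbl_summable hq hw ρ hρ
  have h1 := h.tsum_comm
  have h2 := h.prod.hasSum
  simp only [Function.uncurry] at h2 h1
  rw [← h1] at h2
  simp only [tsum_mul_right] at h2
  refine Eq.mp (congrArg (fun f => HasSum _ f) ?_) h2
  congr 1; funext j
  rw [← tsum_mul_left]
  congr 1; funext s
  split_ifs <;> simp

lemma rank_sum {q z : ℂ} (hq : ‖q‖ < 1 / 4) (hz : ‖z‖ = 1) :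
    ∑' s, z ^ rk s * wq q s = (∑' s, wq q s) + (1 - z) * (z⁻¹ * (∑' j : ℕ, z⁻¹ ^ j * DD (j + 1) q)
      - ∑' j : ℕ, z ^ j * AA (j + 1) q) := by
  have hz0 : z ≠ 0 := by rintro rfl; simp at hz
  have h1 := rank_sum_aux hq (w := z⁻¹) (by simp [hz]) (fun s => -rk s) (fun s h => (rk_le_sum h).2)
  have h2 := rank_sum_aux hq hz rk (fun s h => (rk_le_sum h).1)
  have h3 := (wq_norm_summable (q := q) (by linarith)).of_norm.hasSum
  have h4 := h3.add (((h1.mul_left z⁻¹).sub h2).mul_left (1 - z))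
  have eD : ∀ j : ℕ, (∑' s, if (j : ℤ) + 1 ≤ -rk s then wq q s else 0) = DD (j + 1) q := by
    intro j; unfold DD; congr 1; funext s
    congr 1; rw [eq_iff_iff]
    constructor
    · intro h; refine ⟨?_, by omega⟩
      rintro rfl; rw [rk_zero] at h; omega
    · rintro ⟨_, h⟩; omega
  have eA : ∀ j : ℕ, (∑' s, if (j : ℤ) + 1 ≤ rk s then wq q s else 0) = AA (j + 1) q := by
    intro j; unfold AA; congr 1; funext s
    congr 1; rw [eq_iff_iff]
    constructor
    · intro h; refine ⟨?_, by omega⟩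
      rintro rfl; rw [rk_zero] at h; omega
    · rintro ⟨_, h⟩; omega
  simp only [eD, eA] at h4
  rw [← h4.tsum_eq]
  congr 1; funext s
  rw [zpow_expand hz0 (rk s)]; ring

lemma int_split (f : ℤ → ℂ) (hf : Summable f) :
    ∑' k, f k = f 0 + ∑' k : ℕ, f (k + 1) + ∑' k : ℕ, f (-((k : ℤ) + 1)) := by
  have h := (HasSum.of_nat_of_neg_add_one (f := f)
    (hf.comp_injective Nat.cast_injective).hasSum
    (hf.comp_injective (i := fun n : ℕ => -((n : ℤ) + 1)) (fun a b h => by simpa using h)).hasSum).tsum_eq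
  rw [h]
  congr 1
  have := (hf.comp_injective (Nat.cast_injective (R := ℤ))).tsum_eq_zero_add
  simpa using this

lemma rank_gf {q z : ℂ} (hq0 : q ≠ 0) (hq : ‖q‖ < 1 / 4) (hz : ‖z‖ = 1) (hz1 : z ≠ 1) :
    ∑' s, z ^ rk s * wq q s = Rf z q := by
  have hz0 : z ≠ 0 := by rintro rfl; simp at hz
  have hq1 : ‖q‖ < 1 := by linarith
  have hq2 : ‖q‖ < 1 / 2 := by linarith
  have hP := P_gf hq2
  rw [rank_sum hq hz]
  have eD : ∀ j : ℕ, z⁻¹ ^ j * DD (j + 1) q = (qp q q)⁻¹ * (z⁻¹ ^ j * YY q (j + 1)) := by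
    intro j; rw [DD_eq hq0 hq2 _ (by omega), hP]; ring
  have eA : ∀ j : ℕ, z ^ j * AA (j + 1) q = (qp q q)⁻¹ * (z ^ j * YY q (j + 1)) := by
    intro j; rw [AA_eq hq0 hq2 _ (by omega), hP]; ring
  simp only [eD, eA]
  rw [tsum_mul_left, tsum_mul_left, sum_YY hq0 hq1 hz, sum_YY hq0 hq1 (by simp [hz]), hP]
  unfold Rf SR
  rw [int_split]
  · have hz2 : 1 - z ≠ 0 := sub_ne_zero.2 (Ne.symm hz1)
    have ep : ∀ k : ℕ, (-1 : ℂ) ^ ((k : ℤ) + 1) * q ^ pent ((k : ℤ) + 1) * (1 - z * q ^ ((k : ℤ) + 1))⁻¹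
        = - ((-1) ^ k * q ^ (EE k + (k + 1)) * (1 - z * q ^ (k + 1))⁻¹) := by
      intro k
      have : pent ((k : ℤ) + 1) = EE k + (k + 1) := by
        have h1 := two_EE k
        have h2 := two_tri ((k : ℤ) + 1)
        unfold pent; linarith
      rw [this]
      have e1 : (-1 : ℂ) ^ ((k : ℤ) + 1) = - (-1) ^ k := by
        rw [zpow_add₀ (by norm_num)]; simp
      have e2 : q ^ ((k : ℤ) + 1) = q ^ (k + 1) := by exact_mod_cast zpow_natCast q (k + 1)
      rw [e1, e2]; ring
    have en : ∀ k : ℕ, (-1 : ℂ) ^ (-((k : ℤ) + 1)) * q ^ pent (-((k : ℤ) + 1)) * (1 - z * q ^ (-((k : ℤ) + 1)))⁻¹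
        = z⁻¹ * ((-1) ^ k * q ^ (EE k + (k + 1)) * (1 - z⁻¹ * q ^ (k + 1))⁻¹) := by
      intro k
      have e1 : (-1 : ℂ) ^ (-((k : ℤ) + 1)) = - (-1) ^ k := by
        rw [zpow_neg, zpow_add₀ (by norm_num)]
        rcases neg_one_pow_eq_or ℂ k with h | h <;> simp [h]
      have e2 : q ^ ((k : ℤ) + 1) = q ^ (k + 1) := by exact_mod_cast zpow_natCast q (k + 1)
      have e3 : q ^ (EE k + (k + 1)) = q ^ EE k * q ^ (k + 1) := by rw [zpow_add₀ hq0, e2]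
      have hne := z_ne hq1 hq0 hz hz1 (-((k : ℤ) + 1))
      rw [zpow_neg, e2] at hne
      rw [e1, e3, zpow_neg, e2]
      change _ * q ^ EE k * _ = _
      have hQ : q ^ (k + 1) ≠ 0 := pow_ne_zero _ hq0
      generalize q ^ (k + 1) = Q at *
      generalize q ^ EE k = E at *
      generalize (-1 : ℂ) ^ k = S at *
      have h3 : 1 - z * Q⁻¹ ≠ 0 := sub_ne_zero.2 (Ne.symm hne)
      have h4 : (1 - z * Q⁻¹) = - (z * Q⁻¹) * (1 - z⁻¹ * Q) := by field_simp; ring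
      rw [h4, mul_inv, inv_neg, mul_inv, inv_inv]; ring
    simp only [ep, en]
    rw [tsum_neg, tsum_mul_left]
    have e0 : pent 0 = 0 := by decide
    simp only [e0, zpow_zero, mul_one, one_mul]
    generalize (∑' k : ℕ, (-1 : ℂ) ^ k * q ^ (EE k + (k + 1)) * (1 - z * q ^ (k + 1))⁻¹) = A
    generalize (∑' k : ℕ, (-1 : ℂ) ^ k * q ^ (EE k + (k + 1)) * (1 - z⁻¹ * q ^ (k + 1))⁻¹) = B
    field_simp
    ring
  · exact sr_sum_x hq0 hq1 hz0 (z_ne hq1 hq0 hz hz1)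

lemma coeff_zero (a : ℕ → ℂ) (h : ∀ q : ℂ, q ≠ 0 → ‖q‖ < 1 / 4 → HasSum (fun n : ℕ => a n * q ^ n) 0) (n : ℕ) :
    a n = 0 := by
  set b : ℕ → ℂ := fun n => if n = 0 then 0 else a (n - 1) with hb
  have hH : HasFPowerSeriesAt (0 : ℂ → ℂ) (FormalMultilinearSeries.ofScalars ℂ b) 0 := by
    rw [hasFPowerSeriesAt_iff]
    have : ∀ᶠ z : ℂ in 𝓝 0, ‖z‖ < 1 / 4 := by
      have := Metric.ball_mem_nhds (0 : ℂ) (show (0 : ℝ) < 1 / 4 by norm_num)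
      filter_upwards [this] with z hz
      simpa using hz
    filter_upwards [this] with z hz
    simp only [FormalMultilinearSeries.coeff_ofScalars, smul_eq_mul, Pi.zero_apply]
    rw [← hasSum_nat_add_iff' 1]
    simp only [hb, Finset.range_one, Finset.sum_singleton, if_true, mul_zero, sub_zero, Nat.add_sub_cancel,
      Nat.add_eq_zero_iff, one_ne_zero, and_false, if_false]
    by_cases hz0 : z = 0
    · subst hz0; simp [hasSum_zero]
    · have := (h z hz0 hz).mul_left z
      rw [mul_zero] at this
      refine Eq.mp (congrArg (fun f => HasSum f _) ?_) this
      funext k; ring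
  have h0 := hH.eq_zero
  have h1 := congrArg (fun p => p.coeff (n + 1)) h0
  have h2 : (0 : FormalMultilinearSeries ℂ ℂ ℂ).coeff (n + 1) = 0 := rfl
  simp only [h2] at h1
  simpa [FormalMultilinearSeries.coeff_ofScalars, hb] using h1

lemma sec_coeff {u : ℂ} (hu : u ^ 2 = -1) (f : ℂ → ℂ) (a : ℕ → ℂ)
    (hf : ∀ q : ℂ, q ≠ 0 → ‖q‖ < 1 / 4 → HasSum (fun n : ℕ => a n * q ^ n) (f q))
    (hs : ∀ q : ℂ, q ≠ 0 → ‖q‖ < 1 / 4 → sec f u q = 0) (m : ℕ) : a (4 * m) = 0 := by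
  have hun := u_norm hu
  have hu0 : u ≠ 0 := by rintro rfl; simp at hun
  have := coeff_zero (fun n => a n * (1 + u ^ n + (-1) ^ n + (u * (-1)) ^ n)) (fun q h0 hq => by
    have h1 := hf q h0 hq
    have h2 := hf (u * q) (mul_ne_zero hu0 h0) (by rw [norm_mul, hun]; linarith)
    have h3 := hf (-1 * q) (by simpa using h0) (by simpa using hq)
    have h4 := hf (u * (-1 * q)) (mul_ne_zero hu0 (by simpa using h0)) (by rw [norm_mul, hun]; simpa using hq)
    have h5 := ((h1.add h2).add h3).add h4
    have h6 := hs q h0 hq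
    unfold sec at h6
    rw [h6] at h5
    refine Eq.mp (congrArg (fun f => HasSum f _) ?_) h5
    funext k
    simp only [mul_pow]; ring) (4 * m)
  have hu4 : u ^ 4 = 1 := by linear_combination (u ^ 2 - 1) * hu
  have h2 : (u * (-1)) ^ 4 = 1 := by linear_combination hu4
  have h3 : (-1 : ℂ) ^ 4 = 1 := by norm_num
  simp only [pow_mul, hu4, h2, h3, one_pow] at this
  norm_num at this
  exact this

noncomputable def aN (n : ℕ) (z : ℂ) : ℂ := ∑ π : n.Partition, z ^ rk π.parts
noncomputable def cN (n : ℕ) (z : ℂ) : ℂ := ∑ π : n.Partition, z ^ crk π.parts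
noncomputable def cc (n : ℕ) (z : ℂ) : ℂ := cN n z - if n = 1 then 1 - z else 0

lemma aN_sum {z : ℂ} (hz : ‖z‖ = 1) (hz1 : z ≠ 1) (q : ℂ) (h0 : q ≠ 0) (hq : ‖q‖ < 1 / 4) :
    HasSum (fun n : ℕ => aN n z * q ^ n) (Rf z q) := by
  rw [← rank_gf h0 hq hz hz1]
  exact tsum_wq_eq (by linarith) (fun s => z ^ rk s) (fun s => (norm_zpow_one hz _).le)

lemma cc_sum {z : ℂ} (hz : ‖z‖ = 1) (q : ℂ) (hq : ‖q‖ < 1 / 4) :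
    HasSum (fun n : ℕ => cc n z * q ^ n) (Cf z q) := by
  have h1 := tsum_wq_eq (q := q) (by linarith) (fun s => z ^ crk s) (fun s => (norm_zpow_one hz (crk s)).le)
  rw [crank_gf hz (by linarith)] at h1
  have h2 := hasSum_ite_eq (1 : ℕ) ((1 - z) * q)
  have h3 := h1.sub h2
  have e : Cf z q + q - z * q - (1 - z) * q = Cf z q := by ring
  rw [e] at h3
  refine Eq.mp (congrArg (fun f => HasSum f _) ?_) h3
  funext n
  unfold cc cN
  by_cases hn : n = 1
  · subst hn; simp; ring
  · simp [hn]

lemma zeta_ne {z : ℂ} (h : z ^ 4 = -1) : z ≠ 1 := by rintro rfl; norm_num at h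
lemma u_ne {z : ℂ} (h : z ^ 2 = -1) : z ≠ 1 := by rintro rfl; norm_num at h

lemma G1 {ζ : ℂ} (h : ζ ^ 4 = -1) (m : ℕ) :
    aN (4 * m) (ζ ^ 2) + aN (4 * m) (-ζ ^ 2) - aN (4 * m) ζ - aN (4 * m) (-ζ) = 0 := by
  have h2 : (ζ ^ 2) ^ 2 = -1 := by rw [← h]; ring
  have h3 : (-ζ ^ 2) ^ 2 = -1 := by rw [← h]; ring
  have h4 : (-ζ) ^ 4 = -1 := by rw [← h]; ring
  refine sec_coeff h2 (fun q => Rf (ζ^2) q + Rf (-ζ^2) q - Rf ζ q - Rf (-ζ) q)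
    (fun n => aN n (ζ ^ 2) + aN n (-ζ ^ 2) - aN n ζ - aN n (-ζ)) ?_
    (fun q h0 hq => F1 h0 (by linarith) h) m
  intro q h0 hq
  have := (((aN_sum (u_norm h2) (u_ne h2) q h0 hq).add (aN_sum (u_norm h3) (u_ne h3) q h0 hq)).sub
    (aN_sum (zeta_norm h) (zeta_ne h) q h0 hq)).sub (aN_sum (zeta_norm h4) (zeta_ne h4) q h0 hq)
  refine Eq.mp (congrArg (fun f => HasSum f _) ?_) this
  funext n; ring

lemma G2 {u : ℂ} (h : u ^ 2 = -1) (m : ℕ) :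
    aN (4 * m) (-1) - aN (4 * m) u - aN (4 * m) (-u) + cN (4 * m) (-1) = 0 := by
  have h3 : (-u) ^ 2 = -1 := by rw [← h]; ring
  have := sec_coeff h (fun q => Rf (-1) q - Rf u q - Rf (-u) q + Cf (-1) q)
    (fun n => aN n (-1) - aN n u - aN n (-u) + cc n (-1)) (by
    intro q h0 hq
    have := (((aN_sum (z := -1) (by simp) (by norm_num) q h0 hq).sub (aN_sum (u_norm h) (u_ne h) q h0 hq)).sub
      (aN_sum (u_norm h3) (u_ne h3) q h0 hq)).add (cc_sum (z := -1) (by simp) q hq)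
    refine Eq.mp (congrArg (fun f => HasSum f _) ?_) this
    funext n; ring) (fun q h0 hq => F2 h0 (by linarith) h) m
  have e : 4 * m ≠ 1 := by omega
  simpa [cc, e] using this

lemma G3 {ζ : ℂ} (h : ζ ^ 4 = -1) (m : ℕ) : cN (4 * m) ζ - cN (4 * m) (-ζ) = 0 := by
  have h2 : (ζ ^ 2) ^ 2 = -1 := by rw [← h]; ring
  have h4 : (-ζ) ^ 4 = -1 := by rw [← h]; ring
  have := sec_coeff h2 (fun q => Cf ζ q - Cf (-ζ) q) (fun n => cc n ζ - cc n (-ζ)) (by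
    intro q h0 hq
    have := (cc_sum (zeta_norm h) q hq).sub (cc_sum (zeta_norm h4) q hq)
    refine Eq.mp (congrArg (fun f => HasSum f _) ?_) this
    funext n; ring) (fun q h0 hq => F3 h0 (by linarith) h) m
  have e : 4 * m ≠ 1 := by omega
  simpa [cc, e] using this

lemma G4 {u : ℂ} (h : u ^ 2 = -1) (m : ℕ) : cN (4 * m) u - cN (4 * m) (-u) = 0 := by
  have h3 : (-u) ^ 2 = -1 := by rw [← h]; ring
  have := coeff_zero (fun n => cc n u - cc n (-u)) (by
    intro q h0 hq
    have := (cc_sum (u_norm h) q hq).sub (cc_sum (u_norm h3) q hq)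
    rw [F4 h, sub_self] at this
    refine Eq.mp (congrArg (fun f => HasSum f _) ?_) this
    funext n; ring) (4 * m)
  have e : 4 * m ≠ 1 := by omega
  simpa [cc, e] using this

/-- residue class counts -/
def rescount {ι : Type} [Fintype ι] (g : ι → ℤ) (r : ℕ) : ℕ :=
  (Finset.univ.filter (fun i => g i % 8 = r)).card

lemma res_sum {ι : Type} [Fintype ι] (g : ι → ℤ) {z : ℂ} (hz : z ^ 8 = 1) :
    ∑ i, z ^ g i = ∑ r ∈ Finset.range 8, (rescount g r : ℂ) * z ^ r := by
  have hz0 : z ≠ 0 := by rintro rfl; norm_num at hz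
  have e : ∀ r ∈ Finset.range 8, (rescount g r : ℂ) * z ^ r = ∑ i, if g i % 8 = r then z ^ r else 0 := by
    intro r _
    unfold rescount
    rw [← Finset.sum_filter, Finset.sum_const, nsmul_eq_mul]
  rw [Finset.sum_congr rfl e, Finset.sum_comm]
  refine Finset.sum_congr rfl fun i _ => ?_
  have h1 : 0 ≤ g i % 8 := Int.emod_nonneg _ (by norm_num)
  have h2 : g i % 8 < 8 := Int.emod_lt_of_pos _ (by norm_num)
  obtain ⟨t, ht⟩ := Int.eq_ofNat_of_zero_le h1
  have h3 : z ^ g i = z ^ t := by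
    rw [← Int.mul_ediv_add_emod (g i) 8, zpow_add₀ hz0, zpow_mul, ht]
    have : z ^ (8 : ℤ) = 1 := by exact_mod_cast hz
    rw [this]; simp
  rw [Finset.sum_eq_single t]
  · rw [if_pos ht, h3]
  · intro b _ hb; rw [if_neg]; rw [ht]; intro h; apply hb; simp at h; exact h.symm
  · intro h; simp at h; omega

lemma rescount_total {ι : Type} [Fintype ι] (g : ι → ℤ) :
    ((Fintype.card ι : ℕ) : ℂ) = ∑ r ∈ Finset.range 8, (rescount g r : ℂ) := by
  have := res_sum g (z := 1) (by simp)
  simpa using this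

lemma final_alg {N C : ℕ → ℕ} {a c : ℂ → ℂ} (ζ : ℂ) (hζ : ζ ^ 2 = Complex.I)
    (ha : ∀ z : ℂ, z ^ 8 = 1 → a z = ∑ r ∈ Finset.range 8, (N r : ℂ) * z ^ r)
    (hc : ∀ z : ℂ, z ^ 8 = 1 → c z = ∑ r ∈ Finset.range 8, (C r : ℂ) * z ^ r)
    (htot : ∑ r ∈ Finset.range 8, (N r : ℂ) = ∑ r ∈ Finset.range 8, (C r : ℂ))
    (g1 : a (ζ ^ 2) + a (-ζ ^ 2) - a ζ - a (-ζ) = 0)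
    (g2 : a (-1) - a (ζ ^ 2) - a (-ζ ^ 2) + c (-1) = 0)
    (g3 : c ζ - c (-ζ) = 0)
    (g4 : c (ζ ^ 2) - c (-ζ ^ 2) = 0) :
    C 1 = C 3 ∧ C 3 = N 2 ∧ N 2 = N 4 := by
  have h4 : ζ ^ 4 = -1 := by
    have : ζ ^ 4 = (ζ ^ 2) ^ 2 := by ring
    rw [this, hζ, Complex.I_sq]
  have h8 : ζ ^ 8 = 1 := by
    have : ζ ^ 8 = (ζ ^ 4) ^ 2 := by ring
    rw [this, h4]; norm_num
  have hζ0 : ζ ≠ 0 := by rintro rfl; norm_num at h4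
  have hI := Complex.I_sq
  have e1 : (ζ ^ 2) ^ 8 = 1 := by rw [← pow_mul, mul_comm, pow_mul, h8, one_pow]
  have e2 : (-ζ ^ 2) ^ 8 = 1 := by rw [← e1]; ring
  have e3 : (-ζ) ^ 8 = 1 := by rw [← h8]; ring
  have e4 : (-1 : ℂ) ^ 8 = 1 := by norm_num
  rw [ha _ e1, ha _ e2, ha _ h8, ha _ e3] at g1
  rw [ha _ e4, ha _ e1, ha _ e2, hc _ e4] at g2
  rw [hc _ h8, hc _ e3] at g3
  rw [hc _ e1, hc _ e2] at g4
  simp only [Finset.sum_range_succ, Finset.sum_range_zero] at g1 g2 g3 g4 htot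
  have k1 : (2 * (N 4 : ℂ) - N 2 - N 6) - Complex.I * ((N 2 : ℂ) - N 6) = 0 := by
    rw [← hζ]
    linear_combination (1/2) * g1 + ((-1) * ((N 2 : ℕ) : ℂ) * ζ ^ 0 + (2) * ((N 4 : ℕ) : ℂ) * ζ ^ 0 + (-1) * ((N 6 : ℕ) : ℂ) * ζ ^ 0 + (1) * ((N 6 : ℕ) : ℂ) * ζ ^ 2 + (-1) * ((N 4 : ℕ) : ℂ) * ζ ^ 4 + (1) * ((N 6 : ℕ) : ℂ) * ζ ^ 4 + (-1) * ((N 6 : ℕ) : ℂ) * ζ ^ 8) * h4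
  have k2 : 2 * ((N 2 : ℂ) + N 6) = C 1 + C 3 + C 5 + C 7 := by
    rw [hζ] at g2
    linear_combination (1/2) * g2 + (1/2) * htot + ((1) * ((N 2 : ℕ) : ℂ) * Complex.I ^ 0 + (-1) * ((N 4 : ℕ) : ℂ) * Complex.I ^ 0 + (1) * ((N 6 : ℕ) : ℂ) * Complex.I ^ 0 + (1) * ((N 4 : ℕ) : ℂ) * Complex.I ^ 2 + (-1) * ((N 6 : ℕ) : ℂ) * Complex.I ^ 2 + (1) * ((N 6 : ℕ) : ℂ) * Complex.I ^ 4) * hI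
  have k3 : ((C 1 : ℂ) - C 5) + Complex.I * ((C 3 : ℂ) - C 7) = 0 := by
    rw [← hζ]
    apply mul_left_cancel₀ hζ0
    linear_combination (1/2) * g3 + ((-1) * ((C 5 : ℕ) : ℂ) * ζ ^ 1 + (-1) * ((C 7 : ℕ) : ℂ) * ζ ^ 3) * h4
  have k4 : (C 1 : ℂ) + C 5 = C 3 + C 7 := by
    apply mul_left_cancel₀ Complex.I_ne_zero
    rw [hζ] at g4
    linear_combination (1/2) * g4 + ((-1) * ((C 3 : ℕ) : ℂ) * Complex.I ^ 1 + (1) * ((C 5 : ℕ) : ℂ) * Complex.I ^ 1 + (-1) * ((C 7 : ℕ) : ℂ) * Complex.I ^ 1 + (-1) * ((C 5 : ℕ) : ℂ) * Complex.I ^ 3 + (1) * ((C 7 : ℕ) : ℂ) * Complex.I ^ 3 + (-1) * ((C 7 : ℕ) : ℂ) * Complex.I ^ 5) * hI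
  have r1 := congrArg Complex.re k1
  have i1 := congrArg Complex.im k1
  have r3 := congrArg Complex.re k3
  have i3 := congrArg Complex.im k3
  simp at r1 i1 r3 i3
  have k2' : 2 * ((N 2 : ℝ) + N 6) = C 1 + C 3 + C 5 + C 7 := by exact_mod_cast k2
  have k4' : (C 1 : ℝ) + C 5 = C 3 + C 7 := by exact_mod_cast k4
  refine ⟨?_, ?_, ?_⟩
  · have : (C 1 : ℝ) = C 3 := by linarith
    exact_mod_cast this
  · have : (C 3 : ℝ) = N 2 := by linarith
    exact_mod_cast this
  · have : (N 2 : ℝ) = N 4 := by linarith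
    exact_mod_cast this

theorem stmt_14 : ∀ n : ℕ, 1 ≤ n →
    crankCount 1 8 (4 * n) = crankCount 3 8 (4 * n) ∧
    crankCount 3 8 (4 * n) = rankCount 2 8 (4 * n) ∧
    rankCount 2 8 (4 * n) = rankCount 4 8 (4 * n) := by
  intro n _
  obtain ⟨ζ, hζ⟩ := IsAlgClosed.exists_pow_nat_eq Complex.I (n := 2) (by norm_num)
  have h4 : ζ ^ 4 = -1 := by
    have : ζ ^ 4 = (ζ ^ 2) ^ 2 := by ring
    rw [this, hζ, Complex.I_sq]
  have h2 : (ζ ^ 2) ^ 2 = -1 := by rw [hζ, Complex.I_sq]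
  have := final_alg (N := rescount (fun π : (4 * n).Partition => rk π.parts))
    (C := rescount (fun π : (4 * n).Partition => crk π.parts)) (a := aN (4 * n)) (c := cN (4 * n)) ζ hζ
    (fun z hz => res_sum _ hz) (fun z hz => res_sum _ hz)
    (by rw [← rescount_total, ← rescount_total]) (G1 h4 n) (G2 h2 n) (G3 h4 n) (G4 h2 n)
  exact this
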